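/- arXiv:2209.08134 — 3 statements merged into one kernel-verified Lean document; each statement's English description precedes it below -/
import Mathlib

section
/- There exists L such that for every integer ℓ ≥ L with ℓ not divisible by 3 and every ε > 0 there exists n₀ such that the following holds for all n ≥ n₀: every 3-uniform hypergraph H on n vertices with e(H) ≥ (2√3 − 3 + ε)·(n choose 3) contains a copy of the tight cycle C_ℓ³. (This is the upper-bound direction of π(C_ℓ³) = 2√3 − 3 for all sufficiently large ℓ not divisible by 3.) -/
/-- `H` contains a copy of the tight cycle `C_ℓ³`: an injective map from `ZMod ℓ`
sending every three cyclically consecutive vertices to an edge of `H`. -/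
def HasTightCycleCopy {V : Type} [DecidableEq V] (H : Finset (Finset V)) (ℓ : ℕ) : Prop :=
  ∃ c : ZMod ℓ → V, Function.Injective c ∧
    ∀ i : ZMod ℓ, ({c i, c (i + 1), c (i + 2)} : Finset V) ∈ H


namespace TightCycle

/-- uniform average over a finite type -/
noncomputable def Ex {V : Type} [Fintype V] (f : V → ℝ) : ℝ := (∑ x, f x) / (Fintype.card V : ℝ)

open Classical in
/-- indicator of a proposition -/
noncomputable def ind (p : Prop) : ℝ := if p then 1 else 0

theorem ind_true {p : Prop} (h : p) : ind p = 1 := by simp [ind, h]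
theorem ind_false {p : Prop} (h : ¬ p) : ind p = 0 := by simp [ind, h]
theorem ind_nonneg (p : Prop) : 0 ≤ ind p := by unfold ind; split_ifs <;> norm_num
theorem ind_le_one (p : Prop) : ind p ≤ 1 := by unfold ind; split_ifs <;> norm_num
theorem ind_mono {p q : Prop} (h : p → q) : ind p ≤ ind q := by
  by_cases hp : p
  · rw [ind_true hp, ind_true (h hp)]
  · rw [ind_false hp]; exact ind_nonneg q
theorem ind_congr {p q : Prop} (h : p ↔ q) : ind p = ind q := by rw [propext h]
theorem ind_and (p q : Prop) : ind (p ∧ q) = ind p * ind q := by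
  by_cases hp : p <;> by_cases hq : q <;> simp [ind, hp, hq]
theorem ind_mul_self (p : Prop) : ind p * ind p = ind p := by
  by_cases hp : p <;> simp [ind, hp]
theorem ind_not (p : Prop) : ind (¬ p) = 1 - ind p := by
  by_cases hp : p <;> simp [ind, hp]

section Avg
variable {V W : Type} [Fintype V] [Fintype W]

theorem Ex_add (f g : V → ℝ) : Ex (fun x => f x + g x) = Ex f + Ex g := by
  unfold Ex; rw [Finset.sum_add_distrib, add_div]
theorem Ex_sub (f g : V → ℝ) : Ex (fun x => f x - g x) = Ex f - Ex g := by
  unfold Ex; rw [Finset.sum_sub_distrib, sub_div]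
theorem Ex_mul_left (c : ℝ) (f : V → ℝ) : Ex (fun x => c * f x) = c * Ex f := by
  unfold Ex; rw [← Finset.mul_sum, mul_div_assoc]
theorem Ex_mul_right (c : ℝ) (f : V → ℝ) : Ex (fun x => f x * c) = Ex f * c := by
  unfold Ex; rw [← Finset.sum_mul, div_mul_eq_mul_div]
theorem Ex_const [Nonempty V] (c : ℝ) : Ex (fun _ : V => c) = c := by
  unfold Ex
  have : (Fintype.card V : ℝ) ≠ 0 := by exact_mod_cast Fintype.card_ne_zero
  simp [this]
theorem Ex_mono {f g : V → ℝ} (h : ∀ x, f x ≤ g x) : Ex f ≤ Ex g := by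
  unfold Ex; gcongr with x; exact h x
theorem Ex_nonneg {f : V → ℝ} (h : ∀ x, 0 ≤ f x) : 0 ≤ Ex f := by
  unfold Ex; exact div_nonneg (Finset.sum_nonneg fun x _ => h x) (by positivity)
theorem Ex_comm (f : V → W → ℝ) :
    Ex (fun x => Ex (fun y => f x y)) = Ex (fun y => Ex (fun x => f x y)) := by
  unfold Ex
  rw [← Finset.sum_div, ← Finset.sum_div, Finset.sum_comm, div_div, div_div, mul_comm]
theorem Ex_congr {f g : V → ℝ} (h : ∀ x, f x = g x) : Ex f = Ex g := by
  rw [funext h]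
theorem Ex_le_one {f : V → ℝ} (h : ∀ x, f x ≤ 1) : Ex f ≤ 1 := by
  by_cases hV : Nonempty V
  · calc Ex f ≤ Ex (fun _ : V => (1:ℝ)) := Ex_mono h
      _ = 1 := Ex_const 1
  · have : IsEmpty V := not_nonempty_iff.mp hV
    simp [Ex]
theorem Ex_mul_Ex (f : V → ℝ) (g : W → ℝ) :
    Ex (fun x => Ex (fun y => f x * g y)) = Ex f * Ex g := by
  simp_rw [Ex_mul_left, Ex_mul_right]
theorem Ex_equiv (e : V ≃ W) (f : W → ℝ) : Ex (fun x => f (e x)) = Ex f := by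
  unfold Ex; rw [Equiv.sum_comp e f, Fintype.card_congr e]
theorem Ex_exists_ge [Nonempty V] (f : V → ℝ) : ∃ x, Ex f ≤ f x := by
  by_contra h
  push Not at h
  have h2 : ∑ x, f x < ∑ _x : V, Ex f := Finset.sum_lt_sum_of_nonempty Finset.univ_nonempty
    (fun x _ => h x)
  have hc : (0:ℝ) < Fintype.card V := by exact_mod_cast Fintype.card_pos
  have h3 : ∑ x, f x = Ex f * Fintype.card V := by unfold Ex; field_simp
  rw [h3] at h2
  simp [mul_comm] at h2
/-- if a nonneg average is zero then function is zero; used contrapositively -/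
theorem Ex_pos [Nonempty V] {f : V → ℝ} (h : ∀ x, 0 ≤ f x) (x : V) (hx : 0 < f x) : 0 < Ex f := by
  unfold Ex
  have hc : (0:ℝ) < Fintype.card V := by exact_mod_cast Fintype.card_pos
  refine div_pos (Finset.sum_pos' (fun x _ => h x) ⟨x, Finset.mem_univ x, hx⟩) hc
end Avg

/-- symmetric ternary relation -/
structure SymT {V : Type} (T : V → V → V → Prop) : Prop where
  rot : ∀ {x y z}, T x y z → T y z x
  swap : ∀ {x y z}, T x y z → T y x z

theorem SymT.sw23 {V : Type} {T : V → V → V → Prop} (h : SymT T) {x y z : V} (t : T x y z) :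
    T x z y := h.swap (h.rot (h.rot t))
theorem SymT.rot2 {V : Type} {T : V → V → V → Prop} (h : SymT T) {x y z : V} (t : T x y z) :
    T z x y := h.rot (h.rot t)
theorem SymT.rev {V : Type} {T : V → V → V → Prop} (h : SymT T) {x y z : V} (t : T x y z) :
    T z y x := h.swap (h.rot t)

section Walk
variable {V : Type}

def Step (T : V → V → V → Prop) (p q : V × V) : Prop := p.2 = q.1 ∧ T p.1 p.2 q.2

/-- tight walks of length `m` between ordered pairs -/
def R (T : V → V → V → Prop) : ℕ → V × V → V × V → Prop
  | 0, p, q => p = q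
  | m + 1, p, q => ∃ r, R T m p r ∧ Step T r q

variable {T : V → V → V → Prop}

theorem R_one {p q : V × V} (h : Step T p q) : R T 1 p q := ⟨p, rfl, h⟩

theorem R_add {m n : ℕ} {p q r : V × V} (h1 : R T m p q) (h2 : R T n q r) : R T (m + n) p r := by
  induction n generalizing r with
  | zero => cases h2; exact h1
  | succ n ih =>
    obtain ⟨s, hs, hs2⟩ := h2
    exact ⟨s, ih hs, hs2⟩

theorem R_mono {T' : V → V → V → Prop} (hT : ∀ x y z, T' x y z → T x y z) {m : ℕ} {p q : V × V}
    (h : R T' m p q) : R T m p q := by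
  induction m generalizing q with
  | zero => exact h
  | succ m ih =>
    obtain ⟨s, hs, hs2⟩ := h
    exact ⟨s, ih hs, hs2.1, hT _ _ _ hs2.2⟩

theorem Step_back (hT : SymT T) {p q : V × V} (h : Step T p q) : R T 2 q p := by
  obtain ⟨x, y⟩ := p
  obtain ⟨y', z⟩ := q
  obtain ⟨h1, h2⟩ := h
  simp only at h1 h2
  subst h1
  exact ⟨(z, x), R_one ⟨rfl, hT.rot h2⟩, rfl, hT.rot2 h2⟩

theorem R_rev (hT : SymT T) {m : ℕ} {p q : V × V} (h : R T m p q) : R T (2 * m) q p := by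
  induction m generalizing q with
  | zero => cases h; rfl
  | succ m ih =>
    obtain ⟨s, hs, hs2⟩ := h
    have := R_add (Step_back hT hs2) (ih hs)
    rwa [show 2 + 2 * m = 2 * (m + 1) by ring] at this

def NoClosed (T : V → V → V → Prop) (M : ℕ) : Prop :=
  ∀ m ≤ M, ¬ (3 ∣ m) → ∀ p, ¬ R T m p p

theorem R_pad (hT : SymT T) {m : ℕ} (hm : 0 < m) {p : V × V} (h : R T m p p) (k : ℕ) :
    R T (m + 3 * k) p p := by
  induction k with
  | zero => exact h
  | succ k ih =>
    obtain ⟨m', rfl⟩ : ∃ m', m = m' + 1 := ⟨m - 1, by omega⟩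
    obtain ⟨s, hs, hs2⟩ := h
    have h3 : R T (2 + 1) p p := R_add (Step_back hT hs2) (R_one hs2)
    have := R_add ih h3
    rwa [show m' + 1 + 3 * k + (2 + 1) = m' + 1 + 3 * (k + 1) by ring] at this

theorem noClosed_of (hT : SymT T) {ℓ M : ℕ} (hℓ : ¬ 3 ∣ ℓ) (hM : 2 * M ≤ ℓ)
    (h : ∀ p, ¬ R T ℓ p p) : NoClosed T M := by
  intro m hm h3 p hp
  have hm0 : 0 < m := by
    rcases Nat.eq_zero_or_pos m with h0 | h0
    · subst h0; simp at h3
    · exact h0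
  by_cases hmod : m % 3 = ℓ % 3
  · obtain ⟨k, hk⟩ : ∃ k, ℓ = m + 3 * k := ⟨(ℓ - m) / 3, by omega⟩
    exact h p (hk ▸ R_pad hT hm0 hp k)
  · have hmod2 : (m + m) % 3 = ℓ % 3 := by
      have h4 : m % 3 ≠ 0 := fun h => h3 (Nat.dvd_of_mod_eq_zero h)
      have h5 : ℓ % 3 ≠ 0 := fun h => hℓ (Nat.dvd_of_mod_eq_zero h)
      omega
    obtain ⟨k, hk⟩ : ∃ k, ℓ = (m + m) + 3 * k := ⟨(ℓ - (m + m)) / 3, by omega⟩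
    exact h p (hk ▸ R_pad hT (by omega) (R_add hp hp) k)

theorem R_seq {m : ℕ} {p q : V × V} (h : R T m p q) :
    ∃ w : ℕ → V, w 0 = p.1 ∧ w 1 = p.2 ∧ w m = q.1 ∧ w (m + 1) = q.2 ∧
      ∀ i < m, T (w i) (w (i + 1)) (w (i + 2)) := by
  induction m generalizing q with
  | zero =>
    cases h
    exact ⟨fun i => if i = 0 then p.1 else p.2, by simp⟩
  | succ m ih =>
    obtain ⟨s, hs, hs1, hs2⟩ := h
    obtain ⟨w, h0, h1, h2, h3, h4⟩ := ih hs
    refine ⟨fun i => if i ≤ m + 1 then w i else q.2, by simp [h0], by simp [h1], by simp [h3, hs1],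
      by simp, ?_⟩
    intro i hi
    rcases Nat.lt_or_eq_of_le (Nat.lt_succ_iff.mp hi) with hlt | heq
    · have : i + 1 ≤ m + 1 := by omega
      have h5 : i + 2 ≤ m + 1 := by omega
      simp only [show i ≤ m + 1 by omega, this, h5, if_true]
      exact h4 i hlt
    · subst heq
      simp only [show i ≤ i + 1 by omega, le_refl, if_true, show ¬ (i + 2 ≤ i + 1) by omega, if_false]
      rw [h2, h3]; exact hs2

theorem closed_to_cycle {ℓ : ℕ} (hℓ : 3 ≤ ℓ) {p : V × V} (h : R T ℓ p p) :
    ∃ φ : ZMod ℓ → V, ∀ i, T (φ i) (φ (i + 1)) (φ (i + 2)) := by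
  obtain ⟨w, h0, h1, h2, h3, h4⟩ := R_seq h
  have : NeZero ℓ := ⟨by omega⟩
  refine ⟨fun i => w i.val, fun i => ?_⟩
  have hi := ZMod.val_lt i
  have e1 : w (i + 1 : ZMod ℓ).val = w (i.val + 1) := by
    rw [ZMod.val_add]
    have : (1 : ZMod ℓ).val = 1 := by
      have : Fact (1 < ℓ) := ⟨by omega⟩
      exact ZMod.val_one ℓ
    rw [this]
    rcases Nat.lt_or_ge (i.val + 1) ℓ with hl | hl
    · rw [Nat.mod_eq_of_lt hl]
    · have : i.val + 1 = ℓ := by omega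
      rw [this, Nat.mod_self, h0, h2]
  have e2 : w (i + 2 : ZMod ℓ).val = w (i.val + 2) := by
    rw [ZMod.val_add]
    have : (2 : ZMod ℓ).val = 2 := by
      have := ZMod.val_natCast ℓ 2
      rw [Nat.mod_eq_of_lt (by omega)] at this
      exact_mod_cast this
    rw [this]
    rcases Nat.lt_or_ge (i.val + 2) ℓ with hl | hl
    · rw [Nat.mod_eq_of_lt hl]
    · rcases Nat.lt_or_ge ℓ (i.val + 2) with hg | hg
      · have h6 : i.val + 2 = ℓ + 1 := by omega
        rw [h6, Nat.add_mod_left, Nat.mod_eq_of_lt (by omega), h1, h3]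
      · have : i.val + 2 = ℓ := by omega
        rw [this, Nat.mod_self, h0, h2]
  show T (w i.val) (w (i + 1 : ZMod ℓ).val) (w (i + 2 : ZMod ℓ).val)
  rw [e1, e2]
  exact h4 _ hi
end Walk

end TightCycle
namespace TightCycle

section Clean
variable {V : Type} [Fintype V]

/-- ordered edge density -/
noncomputable def dens (T : V → V → V → Prop) : ℝ := Ex fun x => Ex fun y => Ex fun z => ind (T x y z)

theorem Ex3_rot (f : V → V → V → ℝ) :
    (Ex fun x => Ex fun y => Ex fun z => f x y z) = Ex fun x => Ex fun y => Ex fun z => f y z x := by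
  rw [Ex_congr (fun x => Ex_comm (fun y z => f y z x))]
  rw [Ex_comm (fun x z => Ex fun y => f y z x)]
  rw [Ex_congr (fun z => Ex_comm (fun x y => f y z x))]
  rw [Ex_comm (fun x y => Ex fun z => f x y z)]

theorem exists_clean [Nonempty V] {T : V → V → V → Prop} (hT : SymT T) {δ : ℝ} (hδ : 0 ≤ δ) :
    ∃ T' : V → V → V → Prop, SymT T' ∧ (∀ x y z, T' x y z → T x y z) ∧
      (∀ x y, (∃ z, T' x y z) → δ ≤ Ex fun z => ind (T' x y z)) ∧
      dens T - dens T' ≤ 3 * δ := by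
  classical
  let S := {T' : V → V → V → Prop // SymT T' ∧ ∀ x y z, T' x y z → T x y z}
  let sh : (V → V → V → Prop) → ℝ := fun T' => Ex fun x => Ex fun y => ind (∃ z, T' x y z)
  have hfin : Finite S := inferInstance
  have hne : Nonempty S := ⟨⟨T, hT, fun _ _ _ h => h⟩⟩
  obtain ⟨⟨T', hs, hsub⟩, hmax⟩ := Finite.exists_max (fun A : S => dens A.1 - 3 * δ * sh A.1)
  have hsh1 : sh T ≤ 1 := Ex_le_one fun x => Ex_le_one fun y => ind_le_one _
  have hsh0 : 0 ≤ sh T' := Ex_nonneg fun x => Ex_nonneg fun y => ind_nonneg _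
  refine ⟨T', hs, hsub, ?_, ?_⟩
  · intro p q hpq
    by_contra hlt
    push Not at hlt
    let Bad : V → V → Prop := fun x y => (x = p ∧ y = q) ∨ (x = q ∧ y = p)
    have hBs : ∀ x y, Bad x y → Bad y x := by
      intro x y h
      rcases h with ⟨h1, h2⟩ | ⟨h1, h2⟩
      · exact Or.inr ⟨h2, h1⟩
      · exact Or.inl ⟨h2, h1⟩
    let T1 : V → V → V → Prop := fun x y z => T' x y z ∧ ¬ Bad x y ∧ ¬ Bad y z ∧ ¬ Bad x z
    have hT1 : SymT T1 := by
      constructor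
      · rintro x y z ⟨h1, h2, h3, h4⟩
        exact ⟨hs.rot h1, h3, fun h => h4 (hBs _ _ h), fun h => h2 (hBs _ _ h)⟩
      · rintro x y z ⟨h1, h2, h3, h4⟩
        exact ⟨hs.swap h1, fun h => h2 (hBs _ _ h), h4, h3⟩
    have hm := hmax ⟨T1, hT1, fun x y z h => hsub x y z h.1⟩
    simp only at hm
    -- codegree on bad pairs
    have hcod : ∀ x y, Bad x y → (Ex fun z => ind (T' x y z)) < δ := by
      rintro x y (⟨rfl, rfl⟩ | ⟨rfl, rfl⟩)
      · exact hlt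
      · rw [Ex_congr (fun z => ind_congr ⟨hs.swap, hs.swap⟩ : ∀ z, ind (T' x y z) = ind (T' y x z))]
        exact hlt
    have hact : ∀ x y, Bad x y → ∃ z, T' x y z := by
      rintro x y (⟨rfl, rfl⟩ | ⟨rfl, rfl⟩)
      · exact hpq
      · obtain ⟨z, hz⟩ := hpq
        exact ⟨z, hs.swap hz⟩
    let b : ℝ := Ex fun x => Ex fun y => ind (Bad x y)
    let w : ℝ := Ex fun x => Ex fun y => ind (Bad x y) * Ex fun z => ind (T' x y z)
    have hsh : sh T1 + b ≤ sh T' := by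
      show (Ex fun x => Ex fun y => ind (∃ z, T1 x y z)) + (Ex fun x => Ex fun y => ind (Bad x y)) ≤ _
      rw [← Ex_add]
      refine Ex_mono fun x => ?_
      rw [← Ex_add]
      refine Ex_mono fun y => ?_
      by_cases hB : Bad x y
      · rw [ind_true hB, ind_true (hact x y hB), ind_false]
        · norm_num
        · rintro ⟨z, hz⟩; exact hz.2.1 hB
      · rw [ind_false hB, add_zero]
        exact ind_mono fun ⟨z, hz⟩ => ⟨z, hz.1⟩
    have hd : dens T' ≤ dens T1 + 3 * w := by
      have e1 : w = Ex fun x => Ex fun y => Ex fun z => ind (Bad x y) * ind (T' x y z) := by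
        refine Ex_congr fun x => Ex_congr fun y => ?_
        rw [Ex_mul_left]
      have e2 : w = Ex fun x => Ex fun y => Ex fun z => ind (Bad y z) * ind (T' y z x) := by
        rw [e1, Ex3_rot]
      have e3 : w = Ex fun x => Ex fun y => Ex fun z => ind (Bad z x) * ind (T' z x y) := by
        rw [e2, Ex3_rot]
      have : dens T1 + 3 * w = dens T1 + w + w + w := by ring
      rw [this]
      nth_rewrite 1 [e1]
      nth_rewrite 1 [e2]
      rw [e3]
      unfold dens
      rw [← Ex_add, ← Ex_add, ← Ex_add]
      refine Ex_mono fun x => ?_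
      rw [← Ex_add, ← Ex_add, ← Ex_add]
      refine Ex_mono fun y => ?_
      rw [← Ex_add, ← Ex_add, ← Ex_add]
      refine Ex_mono fun z => ?_
      by_cases ht : T' x y z
      · rw [ind_true ht, ind_true (hs.rot ht), ind_true (hs.rot2 ht)]
        have n1 := ind_nonneg (Bad x y)
        have n2 := ind_nonneg (Bad y z)
        have n3 := ind_nonneg (Bad z x)
        have n4 := ind_nonneg (T1 x y z)
        by_cases h1 : Bad x y
        · rw [ind_true h1]; linarith
        by_cases h2 : Bad y z
        · rw [ind_true h2]; linarith
        by_cases h3 : Bad z x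
        · rw [ind_true h3]; linarith
        have : T1 x y z := ⟨ht, h1, h2, fun h => h3 (hBs _ _ h)⟩
        rw [ind_true this]; linarith
      · rw [ind_false ht]
        have n1 := ind_nonneg (Bad x y)
        have n2 := ind_nonneg (Bad y z)
        have n3 := ind_nonneg (Bad z x)
        have n4 := ind_nonneg (T1 x y z)
        have m2 := ind_nonneg (T' y z x)
        have m3 := ind_nonneg (T' z x y)
        positivity
    have hw : w < δ * b := by
      have : 0 < δ * b - w := by
        show 0 < δ * (Ex fun x => Ex fun y => ind (Bad x y)) - _
        rw [← Ex_mul_left, ← Ex_sub]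
        have key : ∀ x y, 0 ≤ δ * ind (Bad x y) - ind (Bad x y) * Ex fun z => ind (T' x y z) := by
          intro x y
          by_cases hB : Bad x y
          · rw [ind_true hB]; linarith [hcod x y hB]
          · rw [ind_false hB]; simp
        have key2 : ∀ x, 0 ≤ δ * (Ex fun y => ind (Bad x y)) -
            Ex fun y => ind (Bad x y) * Ex fun z => ind (T' x y z) := by
          intro x
          rw [← Ex_mul_left, ← Ex_sub]
          exact Ex_nonneg (key x)
        refine Ex_pos key2 p ?_
        rw [← Ex_mul_left, ← Ex_sub]
        refine Ex_pos (key p) q ?_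
        have hB : Bad p q := Or.inl ⟨rfl, rfl⟩
        rw [ind_true hB]; linarith [hcod p q hB]
      linarith
    nlinarith
  · have := hmax ⟨T, hT, fun _ _ _ h => h⟩
    simp only at this
    nlinarith

theorem ball_bound {T : V → V → V → Prop} (hT : SymT T) {δ : ℝ} (hδ : 0 < δ)
    (hc : ∀ x y, (∃ z, T x y z) → δ ≤ Ex fun z => ind (T x y z)) {J : ℕ} (hJ : 1 < J * δ ^ 2)
    {p q : V × V} {m : ℕ} (h : R T m p q) : ∃ m' ≤ 7 * J, R T m' p q := by
  let Rk : ℕ → V × V → Prop := fun k q => ∃ m ≤ k, R T m p q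
  have Rk_mono : ∀ {k k' : ℕ} {q}, k ≤ k' → Rk k q → Rk k' q :=
    fun hk ⟨m, hm, h⟩ => ⟨m, hm.trans hk, h⟩
  let Cl : ℕ → Prop := fun k => ∀ m q, R T m p q → Rk k q
  let g : ℕ → ℝ := fun j => Ex fun u => Ex fun v => ind (Rk (7 * j) (u, v))
  have main : ∀ j : ℕ, (j * δ ^ 2 ≤ g j) ∨ Cl (7 * j) := by
    intro j
    induction j with
    | zero => left; simp only [Nat.cast_zero, zero_mul]
              exact Ex_nonneg fun _ => Ex_nonneg fun _ => ind_nonneg _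
    | succ j ih =>
      rcases ih with ih | ih
      · by_cases hcl : ∀ q r, Rk (7 * j + 4) q → Step T q r → Rk (7 * j + 4) r
        · right
          have : ∀ m q, R T m p q → Rk (7 * j + 4) q := by
            intro m
            induction m with
            | zero => intro q hq; exact ⟨0, by omega, hq⟩
            | succ m ihm =>
              rintro q ⟨s, hs, hs2⟩
              exact hcl _ _ (ihm s hs) hs2
          exact fun m q h => Rk_mono (by omega) (this m q h)
        · left
          push Not at hcl
          obtain ⟨q, ⟨x, y⟩, ⟨m1, hm1, hq⟩, hstep, hnot⟩ := hcl
          have hxy : R T (m1 + 1) p (x, y) := ⟨q, hq, hstep⟩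
          have hact : ∃ z, T x y z := by
            refine ⟨q.1, ?_⟩
            have h1 := hstep.1
            have h2 := hstep.2
            simp only at h1 h2
            rw [h1] at h2
            exact hT.rot h2
          have hS : δ ^ 2 ≤ Ex fun u => Ex fun v => ind (T x y u ∧ T y u v) := by
            have h1 := hc x y hact
            calc δ ^ 2 = δ * δ := by ring
              _ ≤ (Ex fun z => ind (T x y z)) * δ := by gcongr
              _ = Ex fun z => ind (T x y z) * δ := by rw [Ex_mul_right]
              _ ≤ _ := by
                refine Ex_mono fun u => ?_
                rw [Ex_congr (fun v => ind_and _ _), Ex_mul_left]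
                by_cases hu : T x y u
                · rw [ind_true hu, one_mul, one_mul]
                  exact hc y u ⟨x, hT.rot hu⟩
                · rw [ind_false hu]; simp
          have : g j + δ ^ 2 ≤ g (j + 1) := by
            refine le_trans (add_le_add_right hS _) ?_
            show (Ex fun u => Ex fun v => ind (Rk (7 * j) (u, v))) + _ ≤ _
            rw [← Ex_add]
            refine Ex_mono fun u => ?_
            rw [← Ex_add]
            refine Ex_mono fun v => ?_
            by_cases h1 : Rk (7 * j) (u, v)
            · rw [ind_true h1, ind_true (Rk_mono (by omega) h1)]
              rw [ind_false]
              · norm_num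
              · rintro ⟨t1, t2⟩
                have hw : R T 2 (x, y) (u, v) := ⟨(y, u), R_one ⟨rfl, t1⟩, rfl, t2⟩
                obtain ⟨m2, hm2, hr⟩ := h1
                exact hnot ⟨m2 + 2 * 2, by omega, R_add hr (R_rev hT hw)⟩
            · rw [ind_false h1, zero_add]
              apply ind_mono
              rintro ⟨t1, t2⟩
              have hw : R T 2 (x, y) (u, v) := ⟨(y, u), R_one ⟨rfl, t1⟩, rfl, t2⟩
              exact ⟨m1 + 1 + 2, by omega, R_add hxy hw⟩
          push_cast
          linarith
      · right
        exact fun m q h => Rk_mono (by omega) (ih m q h)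
  rcases main J with h1 | h1
  · exfalso
    have : g J ≤ 1 := Ex_le_one fun _ => Ex_le_one fun _ => ind_le_one _
    linarith
  · exact h1 m q h

theorem exists_color {T : V → V → V → Prop} (hT : SymT T) {K M : ℕ} (hM : 3 * K + 1 ≤ M)
    (hno : NoClosed T M) (hK : ∀ p q m, R T m p q → ∃ m' ≤ K, R T m' p q) :
    ∃ d : V → V → ZMod 3, (∀ x y, d y x = - d x y) ∧ ∀ x y z, T x y z →
      (d x y = 1 ∧ d x z = 1 ∧ d y z = 0) ∨ (d y x = 1 ∧ d y z = 1 ∧ d x z = 0) ∨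
      (d z x = 1 ∧ d z y = 1 ∧ d x y = 0) := by
  classical
  let conn : V × V → V × V → Prop := fun p q => ∃ m, R T m p q
  let st : Setoid (V × V) := ⟨conn, ⟨fun p => ⟨0, rfl⟩, fun ⟨m, h⟩ => ⟨2 * m, R_rev hT h⟩,
    fun ⟨m, h⟩ ⟨n, h'⟩ => ⟨m + n, R_add h h'⟩⟩⟩
  let rep : V × V → V × V := fun p => (Quotient.mk st p).out
  have hrep : ∀ p, ∃ m' ≤ K, R T m' (rep p) p := by
    intro p
    have : conn (rep p) p := Quotient.mk_out (s := st) p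
    obtain ⟨m, hm⟩ := this
    exact hK _ _ _ hm
  choose ln hln1 hln2 using hrep
  let f : V × V → ZMod 3 := fun p => (ln p : ZMod 3)
  have hf : ∀ p q, Step T p q → f q = f p + 1 := by
    intro p q hpq
    have hr : rep q = rep p := by
      have : Quotient.mk st q = Quotient.mk st p :=
        Quotient.sound (show conn q p from ⟨2, Step_back hT hpq⟩)
      show (Quotient.mk st q).out = (Quotient.mk st p).out
      rw [this]
    have h1 := hln2 p
    have h2 := hln2 q
    rw [hr] at h2
    have h3 := R_add (R_add h1 (R_one hpq)) (R_rev hT h2)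
    have b1 := hln1 p
    have b2 := hln1 q
    have h4 : 3 ∣ ln p + 1 + 2 * ln q := by
      by_contra hcon
      exact hno _ (by omega) hcon _ h3
    have h5 : ((ln p + 1 + 2 * ln q : ℕ) : ZMod 3) = 0 := (ZMod.natCast_eq_zero_iff _ 3).2 h4
    push_cast at h5
    show (ln q : ZMod 3) = ln p + 1
    generalize (ln q : ZMod 3) = u at *
    generalize (ln p : ZMod 3) = v at *
    revert u v
    decide
  refine ⟨fun x y => f (x, y) - f (y, x), fun x y => by ring, ?_⟩
  intro x y z h
  have a1 : f (y, z) = f (x, y) + 1 := hf _ _ ⟨rfl, h⟩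
  have a2 : f (z, x) = f (y, z) + 1 := hf _ _ ⟨rfl, hT.rot h⟩
  have b1 : f (x, z) = f (y, x) + 1 := hf _ _ ⟨rfl, hT.swap h⟩
  have b2 : f (z, y) = f (x, z) + 1 := hf _ _ ⟨rfl, hT.rot (hT.swap h)⟩
  simp only [b2, a2, a1, b1]
  generalize f (x, y) = u
  generalize f (y, x) = v
  revert u v
  decide

end Clean
end TightCycle
namespace TightCycle

theorem sqrt3_bounds : (1.73205 : ℝ) < √3 ∧ √3 < 1.73206 ∧ √3 * √3 = 3 := by
  refine ⟨?_, ?_, Real.mul_self_sqrt (by norm_num)⟩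
  · rw [Real.lt_sqrt (by norm_num)]; norm_num
  · rw [Real.sqrt_lt' (by norm_num)]; norm_num

/-- the key one-variable identity -/
theorem key_poly (α : ℝ) : α * (1 - α) ^ 2 =
    (2 * √3 - 3) * (1 - α ^ 3) / 3 - (1 - α) * (2 * √3 / 3) * (α - (√3 - 1) / 2) ^ 2 := by
  have h : √3 ^ 2 = 3 := Real.sq_sqrt (by norm_num)
  have h3 : √3 ^ 3 = 3 * √3 := by rw [pow_succ, h]
  ring_nf
  rw [h3, h]
  ring

theorem num_deg {P O e : ℝ} (hP : 2 * √3 - 3 ≤ P) (he : e ≤ 0.0001) (h1 : 0.04 ≤ O) (h2 : O ≤ 0.625) :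
    O ^ 2 + (1 - O) ^ 2 / 2 + 0.0005 ≤ P - e := by
  obtain ⟨s1, s2, s3⟩ := sqrt3_bounds
  nlinarith [mul_nonneg (sub_nonneg.2 h1) (sub_nonneg.2 h2)]

theorem num_coarse {P α β χ Z : ℝ} (hP : 2 * √3 - 3 ≤ P) (hP1 : P ≤ 1)
    (h0 : 0 ≤ α) (h8 : α ≤ 0.8) (hβ : β = 1 - α - χ) (hβ0 : 0 ≤ β) (hχ0 : 0 ≤ χ) (hχ : χ ≤ 0.00000001)
    (hZ1 : Z ≤ α * (0.375 - β) ^ 2) (hZ2 : 0.375 ≤ β → Z ≤ 0)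
    (h : P / 3 ≤ P * α ^ 3 / 3 + α * β ^ 2 + Z + 0.0017) : 0.3 ≤ α ∧ α ≤ 0.43 := by
  obtain ⟨s1, s2, s3⟩ := sqrt3_bounds
  have hα1 : α ^ 3 ≤ 1 := by
    have : α ^ 3 ≤ 1 ^ 3 := by gcongr; linarith
    simpa using this
  have hPa : (2 * √3 - 3) * (1 - α ^ 3) / 3 ≤ P * (1 - α ^ 3) / 3 := by
    have := mul_le_mul_of_nonneg_right hP (sub_nonneg.2 hα1)
    linarith
  have hb : β ^ 2 ≤ (1 - α) ^ 2 := by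
    apply pow_le_pow_left₀ hβ0; linarith
  have hab : α * β ^ 2 ≤ α * (1 - α) ^ 2 := mul_le_mul_of_nonneg_left hb h0
  by_cases hc : 0.375 ≤ β
  · have hZ := hZ2 hc
    rw [key_poly] at hab
    have h5 : (1 - α) * (2 * √3 / 3) * (α - (√3 - 1) / 2) ^ 2 ≤ 0.0017 := by linarith
    have h6 : 0.375 ≤ 1 - α := by linarith
    have h7 : (0.375 * 1.15) * (α - (√3 - 1) / 2) ^ 2 ≤ 0.0017 := by
      refine le_trans ?_ h5
      gcongr
      linarith
    have h8 : (α - (√3 - 1) / 2) ^ 2 ≤ 0.0628 ^ 2 := by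
      norm_num at h7 ⊢; linarith
    have h9 := abs_le.1 (abs_le_of_sq_le_sq h8 (by norm_num))
    constructor <;> linarith [h9.1, h9.2]
  · exfalso
    push Not at hc
    have hα6 : 0.62 ≤ α := by linarith
    have h9 : (0.375 - β) ^ 2 ≤ (α - 0.625) ^ 2 + 0.00001 := by
      have : 0.375 - β = (α - 0.625) + χ := by rw [hβ]; ring
      rw [this]
      nlinarith
    have h10 : α * (0.375 - β) ^ 2 ≤ α * ((α - 0.625) ^ 2 + 0.00001) :=
      mul_le_mul_of_nonneg_left h9 h0
    have h11 : 0.1547 * (1 - α ^ 3) ≤ (2 * √3 - 3) * (1 - α ^ 3) / 3 := by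
      have : (0.1547 : ℝ) ≤ (2 * √3 - 3) / 3 := by linarith
      have := mul_le_mul_of_nonneg_right this (sub_nonneg.2 hα1)
      linarith
    have h12 : 0.1547 * (1 - α ^ 3) ≤ α * (1 - α) ^ 2 + α * ((α - 0.625) ^ 2 + 0.00001) + 0.0017 := by
      linarith
    have q1 : 0 ≤ (α - 0.62) * (0.8 - α) := mul_nonneg (by linarith) (by linarith)
    nlinarith [mul_nonneg q1 h0]

theorem num_fine {P α β χ S Q n2 D e : ℝ} (hP : 2 * √3 - 3 ≤ P) (h3 : 0.3 ≤ α)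
    (h4 : α ≤ 0.43) (hβ : β = 1 - α - χ) (hβ0 : 0 ≤ β) (hχ0 : 0 ≤ χ) (hχ : χ ≤ 2000 * e)
    (he : e = 0.000000000001) (hS : 0 ≤ S) (hQ : 0 ≤ Q) (hn2 : 0 ≤ n2)
    (hD1 : 2 * β * S - Q ≤ D) (hD2 : α * n2 ≤ D) (hD0 : 0 ≤ D)
    (h : (P - 2 * e) / 3 ≤ P * α ^ 3 / 3 + (α * β ^ 2 - D) + 2 * (0.375 * S - Q) +
      0.04 * (S + n2 + χ) + 3 * χ) :
    D ≤ 0.000001 ∧ |α - (√3 - 1) / 2| ≤ 0.001 := by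
  obtain ⟨s1, s2, s3⟩ := sqrt3_bounds
  have hα1 : α ^ 3 ≤ 1 := by
    have : α ^ 3 ≤ 1 ^ 3 := by gcongr; linarith
    simpa using this
  have hPa : (2 * √3 - 3) * (1 - α ^ 3) / 3 ≤ P * (1 - α ^ 3) / 3 := by
    have := mul_le_mul_of_nonneg_right hP (sub_nonneg.2 hα1)
    linarith
  have hb : β ^ 2 ≤ (1 - α) ^ 2 := by
    apply pow_le_pow_left₀ hβ0; linarith
  have hab : α * β ^ 2 ≤ α * (1 - α) ^ 2 := mul_le_mul_of_nonneg_left hb (by linarith)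
  rw [key_poly] at hab
  have hβ5 : 0.569 ≤ β := by rw [hβ]; linarith
  have d1 : 1.138 * S - Q ≤ D := by nlinarith
  have d2 : 0.3 * n2 ≤ D := by nlinarith
  have m : 0.1 * D + (1 - α) * (2 * √3 / 3) * (α - (√3 - 1) / 2) ^ 2 ≤ 2 * e / 3 + 3.04 * χ := by
    linarith
  have h7 : (0.57 * 1.15) * (α - (√3 - 1) / 2) ^ 2 ≤
      (1 - α) * (2 * √3 / 3) * (α - (√3 - 1) / 2) ^ 2 := by
    gcongr <;> linarith
  have h8 := sq_nonneg (α - (√3 - 1) / 2)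
  constructor
  · linarith
  · apply abs_le_of_sq_le_sq _ (by norm_num)
    linarith

section
variable {V : Type} [Fintype V] [Nonempty V]

theorem Ex3_add (f g : V → V → V → ℝ) :
    (Ex fun x => Ex fun y => Ex fun z => f x y z + g x y z) =
    (Ex fun x => Ex fun y => Ex fun z => f x y z) + Ex fun x => Ex fun y => Ex fun z => g x y z := by
  simp_rw [Ex_add]

theorem Ex3_mono {f g : V → V → V → ℝ} (h : ∀ x y z, f x y z ≤ g x y z) :
    (Ex fun x => Ex fun y => Ex fun z => f x y z) ≤ Ex fun x => Ex fun y => Ex fun z => g x y z :=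
  Ex_mono fun x => Ex_mono fun y => Ex_mono fun z => h x y z

set_option maxHeartbeats 4000000 in
theorem pass1 {T T' : V → V → V → Prop} (hT' : SymT T')
    (hsub : ∀ x y z, T' x y z → T x y z) {P e : ℝ} (hP : 2 * √3 - 3 ≤ P) (hP1 : P ≤ 1)
    (he : e = 0.000000000001)
    (hA : ∀ A : V → Prop, (Ex fun x => Ex fun y => Ex fun z =>
      ind (A x) * ind (A y) * ind (A z) * ind (T x y z)) ≤ P * (Ex fun x => ind (A x)) ^ 3)
    (hdeg : ∀ x, P - e ≤ Ex fun y => Ex fun z => ind (T x y z))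
    (hdens : dens T - dens T' ≤ e)
    (d : V → V → ZMod 3) (hd : ∀ x y, d y x = - d x y)
    (hc : ∀ x y z, T' x y z →
      (d x y = 1 ∧ d x z = 1 ∧ d y z = 0) ∨ (d y x = 1 ∧ d y z = 1 ∧ d x z = 0) ∨
      (d z x = 1 ∧ d z y = 1 ∧ d x y = 0)) :
    ∃ A B : V → Prop, (∀ x, ¬ (A x ∧ B x)) ∧
      1 - 0.000001 ≤ (Ex fun x => ind (A x)) + (Ex fun x => ind (B x)) ∧
      |(Ex fun x => ind (A x)) - (√3 - 1) / 2| ≤ 0.001 ∧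
      (Ex fun z => Ex fun x => Ex fun y => ind (A z) * ind (B x) * ind (B y) * (1 - ind (T z x y)))
        ≤ 0.000001 := by
  classical
  obtain ⟨o, ho⟩ : ∃ o : V → V → ℝ, ∀ x y, o x y = ind (d x y = 1) := ⟨_, fun _ _ => rfl⟩
  obtain ⟨bl, hbl⟩ : ∃ bl : V → V → ℝ, ∀ x y, bl x y = ind (d x y = 0) := ⟨_, fun _ _ => rfl⟩
  have o0 : ∀ x y, 0 ≤ o x y := fun x y => by rw [ho]; exact ind_nonneg _
  have o1 : ∀ x y, o x y ≤ 1 := fun x y => by rw [ho]; exact ind_le_one _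
  have bl0 : ∀ x y, 0 ≤ bl x y := fun x y => by rw [hbl]; exact ind_nonneg _
  have bl1 : ∀ x y, bl x y ≤ 1 := fun x y => by rw [hbl]; exact ind_le_one _
  have hsum : ∀ x y, o x y + o y x + bl x y = 1 := by
    intro x y
    rw [ho, ho, hbl, hd x y]
    generalize d x y = u
    have : u = 0 ∨ u = 1 ∨ u = 2 := by revert u; decide
    rcases this with rfl | rfl | rfl
    · rw [ind_false (by decide), ind_false (by decide), ind_true (by decide)]; norm_num
    · rw [ind_true (by decide), ind_false (by decide), ind_false (by decide)]; norm_num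
    · rw [ind_false (by decide), ind_true (by decide), ind_false (by decide)]; norm_num
  obtain ⟨O, hO⟩ : ∃ O : V → ℝ, ∀ x, O x = Ex fun y => o x y := ⟨_, fun _ => rfl⟩
  obtain ⟨I, hI⟩ : ∃ I : V → ℝ, ∀ x, I x = Ex fun y => o y x := ⟨_, fun _ => rfl⟩
  obtain ⟨Bl, hBl⟩ : ∃ Bl : V → ℝ, ∀ x, Bl x = Ex fun y => bl x y := ⟨_, fun _ => rfl⟩
  have hOIB : ∀ x, O x + I x + Bl x = 1 := by
    intro x
    rw [hO, hI, hBl, ← Ex_add, ← Ex_add, Ex_congr (hsum x), Ex_const]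
  have O0 : ∀ x, 0 ≤ O x := fun x => by rw [hO]; exact Ex_nonneg (o0 x)
  have hdeg' : ∀ x, (Ex fun y => Ex fun z => ind (T' x y z)) ≤ O x ^ 2 + 2 * Bl x * I x := by
    intro x
    have : O x ^ 2 + 2 * Bl x * I x = Ex fun y => Ex fun z =>
        o x y * o x z + o y x * bl x z + bl x y * o z x := by
      simp_rw [Ex_add, Ex_mul_Ex]
      rw [hO, hI, hBl]; ring
    rw [this]
    refine Ex_mono fun y => Ex_mono fun z => ?_
    have p1 := mul_nonneg (o0 x y) (o0 x z)
    have p2 := mul_nonneg (o0 y x) (bl0 x z)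
    have p3 := mul_nonneg (bl0 x y) (o0 z x)
    by_cases ht : T' x y z
    · rw [ind_true ht]
      rcases hc x y z ht with ⟨h1, h2, h3⟩ | ⟨h1, h2, h3⟩ | ⟨h1, h2, h3⟩
      · have e1 : o x y = 1 := by rw [ho]; exact ind_true h1
        have e2 : o x z = 1 := by rw [ho]; exact ind_true h2
        rw [e1, e2] at *; linarith
      · have e1 : o y x = 1 := by rw [ho]; exact ind_true h1
        have e2 : bl x z = 1 := by rw [hbl]; exact ind_true h3
        rw [e1, e2] at *; linarith
      · have e1 : o z x = 1 := by rw [ho]; exact ind_true h1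
        have e2 : bl x y = 1 := by rw [hbl]; exact ind_true h3
        rw [e1, e2] at *; linarith
    · rw [ind_false ht]; linarith
  -- the two sets
  let A : V → Prop := fun x => 0.625 ≤ O x
  let B : V → Prop := fun x => O x ≤ 0.04
  obtain ⟨a, ha⟩ : ∃ a : V → ℝ, ∀ x, a x = ind (A x) := ⟨_, fun _ => rfl⟩
  obtain ⟨b, hb⟩ : ∃ b : V → ℝ, ∀ x, b x = ind (B x) := ⟨_, fun _ => rfl⟩
  obtain ⟨χ, hχ⟩ : ∃ χ : V → ℝ, ∀ x, χ x = 1 - a x - b x := ⟨_, fun _ => rfl⟩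
  have hdisj : ∀ x, ¬ (A x ∧ B x) := by
    rintro x ⟨h1, h2⟩
    have h1' : 0.625 ≤ O x := h1
    have h2' : O x ≤ 0.04 := h2
    linarith
  have tri : ∀ x, (a x = 1 ∧ b x = 0 ∧ χ x = 0 ∧ 0.625 ≤ O x) ∨
      (a x = 0 ∧ b x = 1 ∧ χ x = 0 ∧ O x ≤ 0.04) ∨
      (a x = 0 ∧ b x = 0 ∧ χ x = 1 ∧ 0.04 ≤ O x ∧ O x ≤ 0.625) := by
    intro x
    rw [hχ, ha, hb]
    by_cases h1 : A x
    · left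
      have h2 : ¬ B x := fun h => hdisj x ⟨h1, h⟩
      rw [ind_true h1, ind_false h2]
      exact ⟨rfl, rfl, by norm_num, h1⟩
    · right
      by_cases h2 : B x
      · left
        rw [ind_false h1, ind_true h2]
        exact ⟨rfl, rfl, by norm_num, h2⟩
      · right
        rw [ind_false h1, ind_false h2]
        exact ⟨rfl, rfl, by norm_num, le_of_lt (not_le.1 h2), le_of_lt (not_le.1 h1)⟩
  have a0 : ∀ x, 0 ≤ a x := fun x => by rw [ha]; exact ind_nonneg _
  have b0 : ∀ x, 0 ≤ b x := fun x => by rw [hb]; exact ind_nonneg _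
  have χ0 : ∀ x, 0 ≤ χ x := fun x => by rcases tri x with h | h | h <;> rw [h.2.2.1] <;> norm_num
  have b1 : ∀ x, b x ≤ 1 := fun x => by rw [hb]; exact ind_le_one _
  have a1 : ∀ x, a x ≤ 1 := fun x => by rw [ha]; exact ind_le_one _
  obtain ⟨α, hα⟩ : ∃ α, α = Ex a := ⟨_, rfl⟩
  obtain ⟨β, hβ⟩ : ∃ β, β = Ex b := ⟨_, rfl⟩
  obtain ⟨X, hX⟩ : ∃ X, X = Ex χ := ⟨_, rfl⟩
  have hαβ : β = 1 - α - X := by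
    have : X = 1 - α - β := by
      rw [hX, hα, hβ, Ex_congr hχ, Ex_sub, Ex_sub, Ex_const]
    linarith
  have α0 : 0 ≤ α := by rw [hα]; exact Ex_nonneg a0
  have β0 : 0 ≤ β := by rw [hβ]; exact Ex_nonneg b0
  have X0 : 0 ≤ X := by rw [hX]; exact Ex_nonneg χ0
  have hXe : X ≤ 2000 * e := by
    have : 0.0005 * X ≤ dens T - dens T' := by
      rw [hX, ← Ex_mul_left]
      unfold dens
      rw [← Ex_sub]
      refine Ex_mono fun x => ?_
      have m : (Ex fun y => Ex fun z => ind (T' x y z)) ≤ Ex fun y => Ex fun z => ind (T x y z) :=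
        Ex_mono fun y => Ex_mono fun z => ind_mono (hsub x y z)
      rcases tri x with ⟨_, _, h, _⟩ | ⟨_, _, h, _⟩ | ⟨_, _, h, h1, h2⟩
      · rw [h]; linarith
      · rw [h]; linarith
      · rw [h]
        have := num_deg (e := e) hP (by rw [he]; norm_num) h1 h2
        have h3 := hdeg x
        have h4 := hdeg' x
        have h5 := hOIB x
        nlinarith [sq_nonneg (I x - Bl x)]
    linarith
  have hα8 : α ≤ 0.8 := by
    have h1 : 0.625 * α ≤ Ex O := by
      rw [hα, ← Ex_mul_left]
      refine Ex_mono fun x => ?_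
      rcases tri x with ⟨h, _, _, h1⟩ | ⟨h, _⟩ | ⟨h, _⟩
      · rw [h]; linarith
      · rw [h]; linarith [O0 x]
      · rw [h]; linarith [O0 x]
    have h2 : Ex O = Ex I := by
      rw [Ex_congr hO, Ex_congr hI, Ex_comm]
    have h3 : Ex O + Ex I ≤ 1 := by
      rw [← Ex_add]
      refine Ex_le_one fun x => ?_
      have : 0 ≤ Bl x := by rw [hBl]; exact Ex_nonneg (bl0 x)
      linarith [hOIB x]
    linarith
  -- auxiliary averages
  obtain ⟨s, hs⟩ : ∃ s : V → ℝ, ∀ x, s x = Ex fun y => b y * (1 - o x y) := ⟨_, fun _ => rfl⟩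
  obtain ⟨iA, hiA⟩ : ∃ iA : V → ℝ, ∀ x, iA x = Ex fun z => a z * o z x := ⟨_, fun _ => rfl⟩
  obtain ⟨S, hS⟩ : ∃ S, S = Ex fun x => a x * s x := ⟨_, rfl⟩
  obtain ⟨Q, hQ⟩ : ∃ Q, Q = Ex fun x => a x * s x ^ 2 := ⟨_, rfl⟩
  obtain ⟨n2, hn2⟩ : ∃ n2, n2 = Ex fun x => Ex fun y => b x * b y * (1 - bl x y) := ⟨_, rfl⟩
  obtain ⟨ch, hch⟩ : ∃ ch : V → V → V → ℝ, ∀ z x y, ch z x y =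
    ind (T' z x y ∧ d z x = 1 ∧ d z y = 1 ∧ d x y = 0) := ⟨_, fun _ _ _ => rfl⟩
  have ch0 : ∀ z x y, 0 ≤ ch z x y := fun z x y => by rw [hch]; exact ind_nonneg _
  have ch1 : ∀ z x y, ch z x y ≤ 1 := fun z x y => by rw [hch]; exact ind_le_one _
  have chle : ∀ z x y, ch z x y ≤ o z x * o z y * bl x y := by
    intro z x y
    rw [hch, ho, ho, hbl, ← ind_and, ← ind_and]
    exact ind_mono fun h => ⟨⟨h.2.1, h.2.2.1⟩, h.2.2.2⟩
  have chsym : ∀ z x y, ch z x y = ch z y x := by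
    intro z x y
    rw [hch, hch]
    apply ind_congr
    constructor
    · rintro ⟨h1, h2, h3, h4⟩; exact ⟨hT'.sw23 h1, h3, h2, by rw [hd, h4, neg_zero]⟩
    · rintro ⟨h1, h2, h3, h4⟩; exact ⟨hT'.sw23 h1, h3, h2, by rw [hd, h4, neg_zero]⟩
  have s0 : ∀ x, 0 ≤ s x := fun x => by
    rw [hs]; exact Ex_nonneg fun y => mul_nonneg (b0 y) (by linarith [o1 x y])
  have S0 : 0 ≤ S := by rw [hS]; exact Ex_nonneg fun x => mul_nonneg (a0 x) (s0 x)
  have Q0 : 0 ≤ Q := by rw [hQ]; exact Ex_nonneg fun x => mul_nonneg (a0 x) (sq_nonneg _)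
  have n20 : 0 ≤ n2 := by
    rw [hn2]
    exact Ex_nonneg fun x => Ex_nonneg fun y =>
      mul_nonneg (mul_nonneg (b0 x) (b0 y)) (by linarith [bl1 x y])
  have hsi : ∀ x, s x + iA x ≤ 1 - O x := by
    intro x
    have : 1 - O x = Ex fun y => (1 - o x y) := by rw [Ex_sub, Ex_const, hO]
    rw [this, hs, hiA, ← Ex_add]
    refine Ex_mono fun y => ?_
    have h1 := hsum x y
    have h2 := bl0 x y
    have h3 := o1 x y
    have h4 := o0 y x
    rcases tri y with ⟨h, h', _⟩ | ⟨h, h', _⟩ | ⟨h, h', _⟩ <;> rw [h, h'] <;> linarith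
  have hasiA : ∀ x, a x * (s x * iA x) ≤ 0.375 * (a x * s x) - a x * s x ^ 2 := by
    intro x
    rcases tri x with ⟨h, _, _, h1⟩ | ⟨h, _⟩ | ⟨h, _⟩
    · rw [h]
      have h2 := hsi x
      have h3 := s0 x
      nlinarith
    · rw [h]; simp
    · rw [h]; simp
  -- C and its parts
  obtain ⟨C, hC⟩ : ∃ C, C = Ex fun z => Ex fun x => Ex fun y => ch z x y := ⟨_, rfl⟩
  have hTC : dens T' ≤ 3 * C := by
    have e2 : C = Ex fun x => Ex fun y => Ex fun z => ch y z x := by rw [hC, Ex3_rot]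
    have e3 : C = Ex fun x => Ex fun y => Ex fun z => ch z x y := by rw [e2, Ex3_rot]
    have : 3 * C = C + C + C := by ring
    rw [this]
    nth_rewrite 1 [hC]
    nth_rewrite 1 [e2]
    rw [e3, ← Ex3_add, ← Ex3_add]
    refine Ex3_mono fun x y z => ?_
    have p1 := ch0 x y z
    have p2 := ch0 y z x
    have p3 := ch0 z x y
    by_cases ht : T' x y z
    · rw [ind_true ht]
      rcases hc x y z ht with ⟨h1, h2, h3⟩ | ⟨h1, h2, h3⟩ | ⟨h1, h2, h3⟩
      · have : ch x y z = 1 := by rw [hch]; exact ind_true ⟨ht, h1, h2, h3⟩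
        linarith
      · have : ch y z x = 1 := by
          rw [hch]; exact ind_true ⟨hT'.rot ht, h2, h1, by rw [hd, h3, neg_zero]⟩
        linarith
      · have : ch z x y = 1 := by rw [hch]; exact ind_true ⟨hT'.rot2 ht, h1, h2, h3⟩
        linarith
    · rw [ind_false ht]; linarith
  have hdT : P - e ≤ dens T := by
    unfold dens
    calc P - e = Ex fun _ : V => (P - e) := (Ex_const _).symm
      _ ≤ _ := Ex_mono hdeg
  have hPC : (P - 2 * e) / 3 ≤ C := by linarith
  obtain ⟨C1, hC1⟩ : ∃ C1, C1 = Ex fun z => Ex fun x => Ex fun y => a z * a x * a y * ch z x y :=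
    ⟨_, rfl⟩
  obtain ⟨C2, hC2⟩ : ∃ C2, C2 = Ex fun z => Ex fun x => Ex fun y => a z * b x * b y * ch z x y :=
    ⟨_, rfl⟩
  obtain ⟨C3, hC3⟩ : ∃ C3, C3 = Ex fun z => Ex fun x => Ex fun y => a z * a x * b y * ch z x y :=
    ⟨_, rfl⟩
  obtain ⟨C4, hC4⟩ : ∃ C4, C4 = Ex fun z => Ex fun x => Ex fun y => b z * ch z x y :=
    ⟨_, rfl⟩
  have hC3' : C3 = Ex fun z => Ex fun x => Ex fun y => a z * b x * a y * ch z x y := by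
    rw [hC3]
    refine Ex_congr fun z => ?_
    rw [Ex_comm]
    refine Ex_congr fun x => Ex_congr fun y => ?_
    rw [chsym]; ring
  have hX1 : X = Ex fun z => Ex fun _ : V => Ex fun _ : V => χ z := by simp_rw [Ex_const]; exact hX
  have hX2 : X = Ex fun _ : V => Ex fun x => Ex fun _ : V => χ x := by simp_rw [Ex_const]; exact hX
  have hX3 : X = Ex fun _ : V => Ex fun _ : V => Ex fun y => χ y := by simp_rw [Ex_const]; exact hX
  have hCsum : C ≤ C1 + C2 + C3 + C3 + C4 + X + X + X := by
    nth_rewrite 2 [hC3']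
    nth_rewrite 3 [hX3]
    nth_rewrite 2 [hX2]
    rw [hX1, hC, hC1, hC2, hC3, hC4]
    rw [← Ex3_add, ← Ex3_add, ← Ex3_add, ← Ex3_add, ← Ex3_add, ← Ex3_add, ← Ex3_add]
    refine Ex3_mono fun z x y => ?_
    have p0 := ch0 z x y
    have p1 := ch1 z x y
    rcases tri z with ⟨h1, h2, h3, _⟩ | ⟨h1, h2, h3, _⟩ | ⟨h1, h2, h3, _⟩ <;>
    rcases tri x with ⟨h4, h5, h6, _⟩ | ⟨h4, h5, h6, _⟩ | ⟨h4, h5, h6, _⟩ <;>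
    rcases tri y with ⟨h7, h8, h9, _⟩ | ⟨h7, h8, h9, _⟩ | ⟨h7, h8, h9, _⟩ <;>
    rw [h1, h2, h3, h4, h5, h6, h7, h8, h9] <;> linarith
  have bC1 : 3 * C1 ≤ P * α ^ 3 := by
    have e2 : C1 = Ex fun x => Ex fun y => Ex fun z => a y * a z * a x * ch y z x := by
      rw [hC1, Ex3_rot]
    have e3 : C1 = Ex fun x => Ex fun y => Ex fun z => a z * a x * a y * ch z x y := by
      rw [e2, Ex3_rot]
    have : 3 * C1 = C1 + C1 + C1 := by ring
    have h := hA A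
    simp_rw [← ha] at h
    rw [hα]
    refine le_trans ?_ h
    rw [this]
    nth_rewrite 1 [hC1]
    nth_rewrite 1 [e2]
    rw [e3, ← Ex3_add, ← Ex3_add]
    refine Ex3_mono fun x y z => ?_
    have key : ch x y z + ch y z x + ch z x y ≤ ind (T x y z) := by
      by_cases ht : T' x y z
      · rw [ind_true (hsub _ _ _ ht), hch, hch, hch]
        by_cases h1 : d x y = 1 ∧ d x z = 1 ∧ d y z = 0
        · have k1 : ¬ (d y z = 1) := by rw [h1.2.2]; decide
          have k2 : ¬ (d z x = 1) := by rw [hd x z, h1.2.1]; decide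
          rw [ind_false (p := (T' y z x ∧ _)) (fun h => k1 h.2.1),
            ind_false (p := (T' z x y ∧ _)) (fun h => k2 h.2.1)]
          linarith [ind_le_one (T' x y z ∧ d x y = 1 ∧ d x z = 1 ∧ d y z = 0)]
        · rw [ind_false (p := (T' x y z ∧ _)) (fun h => h1 h.2)]
          by_cases h2 : d y z = 1
          · have k2 : ¬ (d z y = 1) := by rw [hd y z, h2]; decide
            rw [ind_false (p := (T' z x y ∧ _)) (fun h => k2 h.2.2.1)]
            linarith [ind_le_one (T' y z x ∧ d y z = 1 ∧ d y x = 1 ∧ d z x = 0)]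
          · rw [ind_false (p := (T' y z x ∧ _)) (fun h => h2 h.2.1)]
            linarith [ind_le_one (T' z x y ∧ d z x = 1 ∧ d z y = 1 ∧ d x y = 0)]
      · rw [hch, hch, hch, ind_false (p := (T' x y z ∧ _)) (fun h => ht h.1),
          ind_false (p := (T' y z x ∧ _)) (fun h => ht (hT'.rot2 h.1)),
          ind_false (p := (T' z x y ∧ _)) (fun h => ht (hT'.rot h.1))]
        linarith [ind_nonneg (T x y z)]
    have p : 0 ≤ a x * a y * a z := mul_nonneg (mul_nonneg (a0 x) (a0 y)) (a0 z)
    have := mul_le_mul_of_nonneg_left key p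
    linarith
  obtain ⟨D, hD⟩ : ∃ D, D = Ex fun z => Ex fun x => Ex fun y => a z * b x * b y * (1 - ch z x y) :=
    ⟨_, rfl⟩
  have hconst : (Ex fun z => Ex fun x => Ex fun y => a z * b x * b y) = α * β ^ 2 := by
    simp_rw [Ex_mul_left, Ex_mul_right, Ex_mul_left, Ex_mul_right]
    rw [hα, hβ]; ring
  have bC2 : C2 = α * β ^ 2 - D := by
    have : C2 + D = α * β ^ 2 := by
      rw [hC2, hD, ← Ex3_add, ← hconst]
      refine Ex_congr fun z => Ex_congr fun x => Ex_congr fun y => ?_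
      ring
    linarith
  have bC3 : C3 ≤ 0.375 * S - Q := by
    have h1 : C3 ≤ Ex fun x => a x * (s x * iA x) := by
      have : (Ex fun x => a x * (s x * iA x)) = Ex fun z => Ex fun x => Ex fun y =>
          a z * a x * b y * (o z x * (1 - o x y)) := by
        rw [Ex_comm]
        refine Ex_congr fun x => ?_
        rw [hs, hiA, mul_comm (Ex fun y => b y * (1 - o x y)), ← Ex_mul_Ex, ← Ex_mul_left]
        refine Ex_congr fun z => ?_
        rw [← Ex_mul_left]
        refine Ex_congr fun y => ?_
        ring
      rw [this, hC3]
      refine Ex3_mono fun z x y => ?_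
      have p : 0 ≤ a z * a x * b y := mul_nonneg (mul_nonneg (a0 z) (a0 x)) (b0 y)
      refine mul_le_mul_of_nonneg_left ?_ p
      refine (chle z x y).trans ?_
      have q1 := o0 z x
      have q2 := o0 z y
      have q3 := o1 z y
      have q4 := bl0 x y
      have q5 := hsum x y
      have q6 := o0 y x
      calc o z x * o z y * bl x y ≤ o z x * 1 * bl x y := by gcongr
        _ ≤ o z x * (1 - o x y) := by
          rw [mul_one]; exact mul_le_mul_of_nonneg_left (by linarith) q1
    refine h1.trans ?_
    rw [hS, hQ, ← Ex_mul_left, ← Ex_sub]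
    exact Ex_mono hasiA
  have bC4a : C4 ≤ Ex fun z => b z * O z ^ 2 := by
    rw [hC4]
    refine Ex_mono fun z => ?_
    rw [hO, pow_two, ← Ex_mul_Ex, ← Ex_mul_left]
    refine Ex_mono fun x => ?_
    rw [← Ex_mul_left]
    refine Ex_mono fun y => ?_
    refine mul_le_mul_of_nonneg_left ?_ (b0 z)
    refine (chle z x y).trans ?_
    have := mul_nonneg (o0 z x) (o0 z y)
    nlinarith [bl1 x y]
  have bC4c : C4 ≤ 0.0016 := by
    refine bC4a.trans ?_
    calc (Ex fun z => b z * O z ^ 2) ≤ Ex fun _ : V => (0.0016 : ℝ) := by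
          refine Ex_mono fun z => ?_
          rcases tri z with ⟨_, h, _, h1⟩ | ⟨_, h, _, h1⟩ | ⟨_, h, _⟩
          · rw [h]; norm_num
          · rw [h]; nlinarith [O0 z]
          · rw [h]; norm_num
      _ = _ := Ex_const _
  have bC4 : C4 ≤ 0.04 * (S + n2 + X) := by
    have h1 : (Ex fun z => b z * O z ^ 2) ≤ Ex fun z => 0.04 * (b z * O z) := by
      refine Ex_mono fun z => ?_
      rcases tri z with ⟨_, h, _, h1⟩ | ⟨_, h, _, h1⟩ | ⟨_, h, _⟩
      · rw [h]; norm_num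
      · rw [h]; nlinarith [O0 z]
      · rw [h]; norm_num
    refine (bC4a.trans h1).trans ?_
    rw [Ex_mul_left]
    refine mul_le_mul_of_nonneg_left ?_ (by norm_num)
    have hS' : S = Ex fun z => Ex fun y => a y * (b z * (1 - o y z)) := by
      rw [hS, Ex_comm]
      refine Ex_congr fun y => ?_
      rw [hs, ← Ex_mul_left]
    have hX' : X = Ex fun _ : V => Ex fun y => χ y := by rw [Ex_const]; exact hX
    rw [hS', hn2, hX', ← Ex_add, ← Ex_add]
    refine Ex_mono fun z => ?_
    rw [← Ex_add, ← Ex_add, hO, ← Ex_mul_left]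
    refine Ex_mono fun y => ?_
    have q1 := hsum z y
    have q2 := o0 z y
    have q3 := o0 y z
    have q4 := bl0 z y
    have q5 := o1 z y
    rcases tri z with ⟨h1, h2, h3, _⟩ | ⟨h1, h2, h3, _⟩ | ⟨h1, h2, h3, _⟩ <;>
    rcases tri y with ⟨h7, h8, h9, _⟩ | ⟨h7, h8, h9, _⟩ | ⟨h7, h8, h9, _⟩ <;>
    rw [h2, h7, h8, h9] <;> linarith
  -- lower bounds for D
  have hD1 : 2 * β * S - Q ≤ D := by
    have e1 : ∀ z, β - s z = Ex fun x => b x * o z x := by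
      intro z
      rw [hβ, hs, ← Ex_sub]
      exact Ex_congr fun x => by ring
    have : 2 * β * S - Q = Ex fun z => Ex fun x => Ex fun y =>
        a z * (b x * b y - (b x * o z x) * (b y * o z y)) := by
      rw [hS, hQ, ← Ex_mul_left, ← Ex_sub]
      refine Ex_congr fun z => ?_
      simp_rw [Ex_mul_left, Ex_sub, Ex_mul_left, Ex_mul_right]
      rw [← e1, ← hβ]
      ring
    rw [this, hD]
    refine Ex3_mono fun z x y => ?_
    have p : 0 ≤ a z * b x * b y := mul_nonneg (mul_nonneg (a0 z) (b0 x)) (b0 y)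
    have q : ch z x y ≤ o z x * o z y := by
      refine (chle z x y).trans ?_
      have := mul_nonneg (o0 z x) (o0 z y)
      nlinarith [bl1 x y]
    have := mul_le_mul_of_nonneg_left q p
    linarith
  have hD2 : α * n2 ≤ D := by
    have : α * n2 = Ex fun z => Ex fun x => Ex fun y => a z * (b x * b y * (1 - bl x y)) := by
      simp_rw [Ex_mul_left]
      rw [Ex_mul_right, hα, hn2]
    rw [this, hD]
    refine Ex3_mono fun z x y => ?_
    have p : 0 ≤ a z * b x * b y := mul_nonneg (mul_nonneg (a0 z) (b0 x)) (b0 y)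
    have q : ch z x y ≤ bl x y := by
      refine (chle z x y).trans ?_
      have h1 : o z x * o z y ≤ 1 := mul_le_one₀ (o1 z x) (o0 z y) (o1 z y)
      nlinarith [bl0 x y]
    have := mul_le_mul_of_nonneg_left q p
    linarith
  have D0 : 0 ≤ D := by
    rw [hD]
    exact Ex_nonneg fun z => Ex_nonneg fun x => Ex_nonneg fun y =>
      mul_nonneg (mul_nonneg (mul_nonneg (a0 z) (b0 x)) (b0 y)) (by linarith [ch1 z x y])
  have hcoarse : 0.3 ≤ α ∧ α ≤ 0.43 := by
    refine num_coarse (Z := 2 * (0.375 - β) * S - Q) hP hP1 α0 hα8 hαβ β0 X0 ?_ ?_ ?_ ?_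
    · rw [he] at hXe; linarith
    · have : 2 * (0.375 - β) * S - Q = Ex fun x => a x * (2 * (0.375 - β) * s x - s x ^ 2) := by
        rw [hS, hQ, ← Ex_mul_left, ← Ex_sub]
        exact Ex_congr fun x => by ring
      rw [this, hα, ← Ex_mul_right]
      refine Ex_mono fun x => ?_
      refine mul_le_mul_of_nonneg_left ?_ (a0 x)
      nlinarith [sq_nonneg (s x - (0.375 - β))]
    · intro h
      nlinarith
    · rw [he] at hXe hPC
      linarith
  obtain ⟨r1, r2⟩ := num_fine (S := S) (Q := Q) (n2 := n2) (D := D) hP hcoarse.1 hcoarse.2 hαβ β0 X0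
    hXe he S0 Q0 n20 hD1 hD2 D0 (by linarith)
  refine ⟨A, B, hdisj, ?_, ?_, ?_⟩
  · simp_rw [← ha, ← hb]
    show 1 - 0.000001 ≤ Ex a + Ex b
    rw [he] at hXe
    rw [← hα, ← hβ]; linarith
  · simp_rw [← ha]
    show |Ex a - _| ≤ _
    rw [← hα]; exact r2
  · simp_rw [← ha, ← hb]
    refine le_trans ?_ r1
    rw [hD]
    refine Ex3_mono fun z x y => ?_
    refine mul_le_mul_of_nonneg_left ?_ (mul_nonneg (mul_nonneg (a0 z) (b0 x)) (b0 y))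
    have : ch z x y ≤ ind (T z x y) := by
      rw [hch]; exact ind_mono fun h => hsub _ _ _ h.1
    linarith
end
end TightCycle
namespace TightCycle
section
variable {V : Type} [Fintype V]

/-- `p` has type `j` at level `k`: it reaches many pairs of `B` in `m ≤ k` steps, `m ≡ 1 - j`. -/
def Typ (T : V → V → V → Prop) (B : V → Prop) (k : ℕ) (j : ZMod 3) (p : V × V) : Prop :=
  ∃ m ≤ k, (m : ZMod 3) + j = 1 ∧
    0.1 ≤ Ex fun u => Ex fun v => ind (B u) * ind (B v) * ind (R T m p (u, v))

variable {T : V → V → V → Prop} {B : V → Prop}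

theorem Typ.mono {k k' : ℕ} (h : k ≤ k') {j : ZMod 3} {p : V × V} (t : Typ T B k j p) :
    Typ T B k' j p := by
  obtain ⟨m, hm, h1, h2⟩ := t
  exact ⟨m, hm.trans h, h1, h2⟩

theorem Typ.walk {k n : ℕ} {j : ZMod 3} {p q : V × V} (t : Typ T B k j q) (h : R T n p q) :
    Typ T B (k + n) (j - n) p := by
  obtain ⟨m, hm, h1, h2⟩ := t
  refine ⟨n + m, by omega, ?_, ?_⟩
  · rw [← h1]; push_cast; ring
  · refine h2.trans (Ex_mono fun u => Ex_mono fun v => ?_)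
    refine mul_le_mul_of_nonneg_left ?_ (mul_nonneg (ind_nonneg _) (ind_nonneg _))
    exact ind_mono fun h' => R_add h h'

theorem Typ.back {k : ℕ} {j : ZMod 3} {x y z : V} (t : Typ T B k j (y, z)) (h : T x y z) :
    Typ T B (k + 1) (j - 1) (x, y) := by
  have := t.walk (R_one (T := T) (p := (x, y)) (q := (y, z)) ⟨rfl, h⟩)
  simpa using this

theorem Typ.fwd (hT : SymT T) {k : ℕ} {j : ZMod 3} {x y z : V} (t : Typ T B k j (x, y))
    (h : T x y z) : Typ T B (k + 2) (j + 1) (y, z) := by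
  have := t.walk (Step_back hT (p := (x, y)) (q := (y, z)) ⟨rfl, h⟩)
  have e : j - ((2 : ℕ) : ZMod 3) = j + 1 := by
    have : ∀ j : ZMod 3, j - 2 = j + 1 := by decide
    exact this j
  rwa [e] at this

theorem Typ.unique [Nonempty V] (hT : SymT T) {A : V → Prop} {k M : ℕ} (hM : NoClosed T M)
    (hk : 3 * k + 3 ≤ M)
    (hα : 0.36 ≤ Ex fun x => ind (A x))
    (hD : (Ex fun z => Ex fun x => Ex fun y => ind (A z) * ind (B x) * ind (B y) *
      (1 - ind (T z x y))) ≤ 0.000001) {j j' : ZMod 3} {p : V × V}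
    (t : Typ T B k j p) (t' : Typ T B k j' p) : j = j' := by
  obtain ⟨m1, hm1, e1, h1⟩ := t
  obtain ⟨m2, hm2, e2, h2⟩ := t'
  by_contra hne
  obtain ⟨u1, hu1⟩ : ∃ u1 : V → V → ℝ, ∀ u v, u1 u v =
    ind (B u) * ind (B v) * ind (R T m1 p (u, v)) := ⟨_, fun _ _ => rfl⟩
  obtain ⟨u2, hu2⟩ : ∃ u2 : V → V → ℝ, ∀ u v, u2 u v =
    ind (B u) * ind (B v) * ind (R T m2 p (u, v)) := ⟨_, fun _ _ => rfl⟩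
  obtain ⟨m, hm⟩ : ∃ m : V → V → V → ℝ, ∀ z x y, m z x y =
    ind (A z) * ind (B x) * ind (B y) * (1 - ind (T z x y)) := ⟨_, fun _ _ _ => rfl⟩
  simp_rw [← hu1] at h1
  simp_rw [← hu2] at h2
  simp_rw [← hm] at hD
  have m0 : ∀ z x y, 0 ≤ m z x y := fun z x y => by
    rw [hm]
    exact mul_nonneg (mul_nonneg (mul_nonneg (ind_nonneg _) (ind_nonneg _)) (ind_nonneg _))
      (by linarith [ind_le_one (T z x y)])
  have key : ∀ a b1 b2 b3 b4, ind (A a) * (u1 b1 b2 * u2 b3 b4) ≤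
      m a b1 b2 + m a b2 b3 + m a b3 b4 := by
    intro a b1 b2 b3 b4
    have q1 := m0 a b1 b2
    have q2 := m0 a b2 b3
    have q3 := m0 a b3 b4
    by_cases c0 : A a; swap
    · rw [ind_false c0]; linarith
    by_cases c1 : B b1; swap
    · rw [hu1, ind_false c1]; linarith
    by_cases c2 : B b2; swap
    · rw [hu1, ind_false c2]; linarith
    by_cases c3 : B b3; swap
    · rw [hu2, ind_false c3]; linarith
    by_cases c4 : B b4; swap
    · rw [hu2, ind_false c4]; linarith
    by_cases r1 : R T m1 p (b1, b2); swap
    · rw [hu1, ind_false r1]; linarith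
    by_cases r2 : R T m2 p (b3, b4); swap
    · rw [hu2, ind_false r2]; linarith
    have big : 1 ≤ m a b1 b2 + m a b2 b3 + m a b3 b4 := by
      by_cases t1 : T a b1 b2; swap
      · have : m a b1 b2 = 1 := by
          rw [hm, ind_true c0, ind_true c1, ind_true c2, ind_false t1]; norm_num
        linarith
      by_cases t2 : T a b2 b3; swap
      · have : m a b2 b3 = 1 := by
          rw [hm, ind_true c0, ind_true c2, ind_true c3, ind_false t2]; norm_num
        linarith
      by_cases t3 : T a b3 b4; swap
      · have : m a b3 b4 = 1 := by
          rw [hm, ind_true c0, ind_true c3, ind_true c4, ind_false t3]; norm_num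
        linarith
      exfalso
      have w1 : R T 1 (b1, b2) (b2, a) := R_one ⟨rfl, hT.rot t1⟩
      have w2 : R T 1 (b2, a) (a, b3) := R_one ⟨rfl, hT.swap t2⟩
      have w3 : R T 1 (a, b3) (b3, b4) := R_one ⟨rfl, t3⟩
      have w := R_add (R_add (R_add (R_add r1 w1) w2) w3) (R_rev hT r2)
      refine hM _ (by omega) ?_ p w
      intro hdiv
      apply hne
      have := (ZMod.natCast_eq_zero_iff (m1 + 1 + 1 + 1 + 2 * m2) 3).2 hdiv
      push_cast at this
      generalize (m1 : ZMod 3) = x at *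
      generalize (m2 : ZMod 3) = y at *
      revert this e1 e2
      clear hne
      revert x y j j'
      decide
    rw [hu1, hu2, ind_true c0, ind_true c1, ind_true c2, ind_true c3, ind_true c4, ind_true r1,
      ind_true r2]
    linarith
  have tot : (Ex fun a => Ex fun b1 => Ex fun b2 => Ex fun b3 => Ex fun b4 =>
      ind (A a) * (u1 b1 b2 * u2 b3 b4)) ≤ Ex fun a => Ex fun b1 => Ex fun b2 => Ex fun b3 =>
      Ex fun b4 => m a b1 b2 + m a b2 b3 + m a b3 b4 :=
    Ex_mono fun a => Ex_mono fun b1 => Ex_mono fun b2 => Ex_mono fun b3 => Ex_mono fun b4 =>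
      key a b1 b2 b3 b4
  simp_rw [Ex_add, Ex_const, Ex_mul_left, Ex_mul_right] at tot
  have : 0.36 * (0.1 * 0.1) ≤ (Ex fun x => ind (A x)) * ((Ex fun x => Ex fun y => u1 x y) *
    (Ex fun x => Ex fun y => u2 x y)) := by gcongr
  linarith

variable (T B) in
def Dom (k : ℕ) (x y : V) : Prop := Typ T B k 0 (x, y) ∧ Typ T B k 2 (y, x)
variable (T B) in
def Blue (k : ℕ) (x y : V) : Prop := Typ T B k 1 (x, y) ∧ Typ T B k 1 (y, x)

theorem Dom.step (hT : SymT T) {k : ℕ} {x y z : V} (h : T x y z) (d : Dom T B k x y) :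
    Dom T B (k + 4) x z ∧ Blue T B (k + 4) y z := by
  obtain ⟨d1, d2⟩ := d
  have a1 : Typ T B (k + 2) 1 (y, z) := d1.fwd hT h
  have a2 : Typ T B (k + 4) 2 (z, x) := a1.fwd hT (hT.rot h)
  have a3 : Typ T B (k + 2) 0 (x, z) := d2.fwd hT (hT.swap h)
  have a4 : Typ T B (k + 4) 1 (z, y) := a3.fwd hT (hT.sw23 h)
  exact ⟨⟨a3.mono (by omega), a2⟩, ⟨a1.mono (by omega), a4⟩⟩

theorem Blue.step (hT : SymT T) {k : ℕ} {x y z : V} (h : T x y z) (d : Blue T B k x y) :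
    Dom T B (k + 4) z x ∧ Dom T B (k + 4) z y := by
  obtain ⟨d1, d2⟩ := d
  have a1 : Typ T B (k + 2) 2 (y, z) := d1.fwd hT h
  have a2 : Typ T B (k + 4) 0 (z, x) := a1.fwd hT (hT.rot h)
  have a3 : Typ T B (k + 2) 2 (x, z) := d2.fwd hT (hT.swap h)
  have a4 : Typ T B (k + 4) 0 (z, y) := a3.fwd hT (hT.sw23 h)
  exact ⟨⟨a2, a3.mono (by omega)⟩, ⟨a4, a1.mono (by omega)⟩⟩

theorem exists_sys [Nonempty V] (hT : SymT T) {A : V → Prop} (hM : NoClosed T 60)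
    (hα : 0.36 ≤ Ex fun x => ind (A x)) (hβ : 0.63 ≤ Ex fun x => ind (B x))
    (hD : (Ex fun z => Ex fun x => Ex fun y => ind (A z) * ind (B x) * ind (B y) *
      (1 - ind (T z x y))) ≤ 0.000001) :
    ∃ dom blue : ℕ → V → V → Prop,
      (∀ k k' x y, k ≤ k' → dom k x y → dom k' x y) ∧
      (∀ k k' x y, k ≤ k' → blue k x y → blue k' x y) ∧
      (∀ k x y, blue k x y → blue k y x) ∧
      (∀ k x y z, T x y z → dom k x y → dom (k + 4) x z ∧ blue (k + 4) y z) ∧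
      (∀ k x y z, T x y z → blue k x y → dom (k + 4) z x ∧ dom (k + 4) z y) ∧
      (∀ k x y, k ≤ 16 → dom k x y → ¬ blue k x y) ∧
      (Ex fun a => Ex fun b => ind (A a) * ind (B b) * ind (¬ dom 4 a b)) ≤ 0.00005 ∧
      (Ex fun b => Ex fun b' => ind (B b) * ind (B b') * ind (¬ blue 4 b b')) ≤ 0.00005 := by
  refine ⟨Dom T B, Blue T B, ?_, ?_, ?_, ?_, ?_, ?_, ?_⟩
  · intro k k' x y h d; exact ⟨d.1.mono h, d.2.mono h⟩
  · intro k k' x y h d; exact ⟨d.1.mono h, d.2.mono h⟩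
  · intro k x y d; exact ⟨d.2, d.1⟩
  · intro k x y z h d; exact d.step hT h
  · intro k x y z h d; exact d.step hT h
  · intro k x y hk d b
    have := Typ.unique hT hM (by omega) hα hD d.1 b.1
    exact absurd this (by decide)
  obtain ⟨a, ha⟩ : ∃ a : V → ℝ, ∀ x, a x = ind (A x) := ⟨_, fun _ => rfl⟩
  obtain ⟨b, hb⟩ : ∃ b : V → ℝ, ∀ x, b x = ind (B x) := ⟨_, fun _ => rfl⟩
  have a0 : ∀ x, 0 ≤ a x := fun x => by rw [ha]; exact ind_nonneg _
  have b0 : ∀ x, 0 ≤ b x := fun x => by rw [hb]; exact ind_nonneg _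
  have a1 : ∀ x, a x ≤ 1 := fun x => by rw [ha]; exact ind_le_one _
  have b1 : ∀ x, b x ≤ 1 := fun x => by rw [hb]; exact ind_le_one _
  simp_rw [← ha] at hα
  simp_rw [← hb] at hβ
  simp_rw [← ha, ← hb] at hD
  simp_rw [← ha, ← hb]
  obtain ⟨m, hm⟩ : ∃ m : V → V → V → ℝ, ∀ z x y, m z x y =
    a z * b x * b y * (1 - ind (T z x y)) := ⟨_, fun _ _ _ => rfl⟩
  simp_rw [← hm] at hD
  have m0 : ∀ z x y, 0 ≤ m z x y := fun z x y => by
    rw [hm]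
    exact mul_nonneg (mul_nonneg (mul_nonneg (a0 _) (b0 _)) (b0 _))
      (by linarith [ind_le_one (T z x y)])
  obtain ⟨w1, hw1⟩ : ∃ w : V → V → ℝ, ∀ x y, w x y = ind (¬ Typ T B 2 2 (x, y)) :=
    ⟨_, fun _ _ => rfl⟩
  obtain ⟨w2, hw2⟩ : ∃ w : V → V → ℝ, ∀ x y, w x y = ind (¬ Typ T B 3 1 (x, y)) :=
    ⟨_, fun _ _ => rfl⟩
  obtain ⟨w3, hw3⟩ : ∃ w : V → V → ℝ, ∀ x y, w x y = ind (¬ Typ T B 4 0 (x, y)) :=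
    ⟨_, fun _ _ => rfl⟩
  have w10 : ∀ x y, 0 ≤ w1 x y := fun x y => by rw [hw1]; exact ind_nonneg _
  have w20 : ∀ x y, 0 ≤ w2 x y := fun x y => by rw [hw2]; exact ind_nonneg _
  have w30 : ∀ x y, 0 ≤ w3 x y := fun x y => by rw [hw3]; exact ind_nonneg _
  have s1 : 0.29 * (Ex fun x => Ex fun y => a x * b y * w1 y x) ≤ 0.000002 := by
    have key : ∀ x y, 0.29 * (a x * b y * w1 y x) ≤ Ex fun u => Ex fun v => m x y u + m x u v := by
      intro x y
      have nn : 0 ≤ Ex fun u => Ex fun v => m x y u + m x u v :=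
        Ex_nonneg fun u => Ex_nonneg fun v => add_nonneg (m0 _ _ _) (m0 _ _ _)
      by_cases c1 : A x; swap
      · have : a x = 0 := by rw [ha]; exact ind_false c1
        rw [this]; linarith
      by_cases c2 : B y; swap
      · have : b y = 0 := by rw [hb]; exact ind_false c2
        rw [this]; linarith
      by_cases c3 : Typ T B 2 2 (y, x)
      · have : w1 y x = 0 := by rw [hw1]; exact ind_false (not_not.2 c3)
        rw [this]; linarith
      have c4 : (Ex fun u => Ex fun v => b u * b v * ind (R T 2 (y, x) (u, v))) < 0.1 := by
        by_contra hcon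
        push Not at hcon
        refine c3 ⟨2, le_refl _, by decide, ?_⟩
        simp_rw [← hb]; exact hcon
      have ax : a x = 1 := by rw [ha]; exact ind_true c1
      have bY : b y = 1 := by rw [hb]; exact ind_true c2
      have wy : w1 y x = 1 := by rw [hw1]; exact ind_true c3
      have c5 : (Ex fun u => Ex fun v => b u * b v) ≤
          Ex fun u => Ex fun v => b u * b v * ind (R T 2 (y, x) (u, v)) + (m x y u + m x u v) := by
        refine Ex_mono fun u => Ex_mono fun v => ?_
        rw [hm, hm, ax, bY]
        have p := b0 u
        have q := b0 v
        have pq := mul_nonneg p q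
        by_cases t1 : T x y u
        · by_cases t2 : T x u v
          · have : R T 2 (y, x) (u, v) := R_add (m := 1) (n := 1)
              (R_one (q := (x, u)) ⟨rfl, hT.swap t1⟩) (R_one ⟨rfl, t2⟩)
            rw [ind_true this, ind_true t1, ind_true t2]; linarith
          · rw [ind_true t1, ind_false t2]
            have := mul_nonneg pq (ind_nonneg (R T 2 (y, x) (u, v)))
            linarith
        · rw [ind_false t1]
          have e1 := mul_nonneg pq (ind_nonneg (R T 2 (y, x) (u, v)))
          have e2 := mul_nonneg pq (sub_nonneg.2 (ind_le_one (T x u v)))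
          have e3 := mul_le_mul_of_nonneg_left (b1 v) p
          linarith
      rw [Ex_mul_Ex] at c5
      simp_rw [Ex_add] at c5 ⊢
      have : 0.63 * 0.63 ≤ Ex b * Ex b := by gcongr <;> assumption
      change Ex b * Ex b ≤ _ at c5
      rw [ax, bY, wy]
      linarith
    rw [← Ex_mul_left]
    have := Ex_mono fun x => Ex_mono (key x)
    simp_rw [Ex_add, Ex_const] at this
    simp_rw [← Ex_mul_left]
    linarith
  have s2 : 0.36 * (Ex fun x => Ex fun y => b x * b y * w2 x y) ≤
      0.000001 + Ex fun x => Ex fun y => a x * b y * w1 y x := by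
    have key : ∀ z x y, a z * (b x * b y * w2 x y) ≤ m z x y + a z * b y * w1 y z := by
      intro z x y
      have p := mul_nonneg (a0 z) (b0 y)
      have q := mul_nonneg p (w10 y z)
      by_cases t : T z x y
      · have e : w2 x y ≤ w1 y z := by
          rw [hw1, hw2]
          exact ind_mono fun h h' => h (h'.back (hT.rot t))
        have e2 := mul_le_mul_of_nonneg_left e p
        have e3 := mul_le_mul_of_nonneg_left (b1 x) (mul_nonneg p (w20 x y))
        have := m0 z x y
        linarith
      · rw [hm, ind_false t]
        have e : w2 x y ≤ 1 := by rw [hw2]; exact ind_le_one _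
        have e3 := mul_le_mul_of_nonneg_left e (mul_nonneg p (b0 x))
        linarith
    have := Ex3_mono key
    simp_rw [Ex_add, Ex_const, Ex_mul_left, Ex_mul_right] at this
    have nn : 0 ≤ Ex fun x => Ex fun y => b x * b y * w2 x y :=
      Ex_nonneg fun x => Ex_nonneg fun y => mul_nonneg (mul_nonneg (b0 _) (b0 _)) (w20 _ _)
    have e1 := mul_le_mul_of_nonneg_right hα nn
    simp_rw [mul_assoc, Ex_mul_left] at *
    linarith
  have s3 : 0.63 * (Ex fun x => Ex fun y => a x * b y * w3 x y) ≤
      0.000001 + Ex fun x => Ex fun y => b x * b y * w2 x y := by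
    have key : ∀ z x y, a z * b x * w3 z x * b y ≤ m z x y + b x * b y * w2 x y := by
      intro z x y
      have p := mul_nonneg (b0 x) (b0 y)
      have q := mul_nonneg p (w20 x y)
      by_cases t : T z x y
      · have e : w3 z x ≤ w2 x y := by
          rw [hw3, hw2]
          exact ind_mono fun h h' => h (h'.back t)
        have e2 := mul_le_mul_of_nonneg_left e p
        have e3 := mul_le_mul_of_nonneg_left (a1 z) (mul_nonneg p (w30 z x))
        have := m0 z x y
        linarith
      · rw [hm, ind_false t]
        have e : w3 z x ≤ 1 := by rw [hw3]; exact ind_le_one _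
        have e3 := mul_le_mul_of_nonneg_left e (mul_nonneg p (a0 z))
        linarith
    have := Ex3_mono key
    simp_rw [Ex_add, Ex_const, Ex_mul_left, Ex_mul_right] at this
    have nn : 0 ≤ Ex fun x => Ex fun y => a x * b y * w3 x y :=
      Ex_nonneg fun x => Ex_nonneg fun y => mul_nonneg (mul_nonneg (a0 _) (b0 _)) (w30 _ _)
    have e1 := mul_le_mul_of_nonneg_left hβ nn
    simp_rw [mul_assoc, Ex_mul_left] at *
    linarith
  constructor
  · have : (Ex fun x => Ex fun y => a x * b y * ind (¬ Dom T B 4 x y)) ≤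
        Ex fun x => Ex fun y => a x * b y * w3 x y + a x * b y * w1 y x := by
      refine Ex_mono fun x => Ex_mono fun y => ?_
      rw [← mul_add]
      refine mul_le_mul_of_nonneg_left ?_ (mul_nonneg (a0 x) (b0 y))
      rw [hw3, hw1]
      by_cases t1 : Typ T B 4 0 (x, y)
      · by_cases t2 : Typ T B 2 2 (y, x)
        · rw [ind_false (p := ¬ Dom T B 4 x y) (not_not.2 ⟨t1, t2.mono (by norm_num)⟩)]
          linarith [ind_nonneg (¬ Typ T B 4 0 (x, y)), ind_nonneg (¬ Typ T B 2 2 (y, x))]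
        · rw [ind_true t2]
          linarith [ind_nonneg (¬ Typ T B 4 0 (x, y)), ind_le_one (¬ Dom T B 4 x y)]
      · rw [ind_true t1]
        linarith [ind_nonneg (¬ Typ T B 2 2 (y, x)), ind_le_one (¬ Dom T B 4 x y)]
    simp_rw [Ex_add] at this
    linarith
  · have : (Ex fun x => Ex fun y => b x * b y * ind (¬ Blue T B 4 x y)) ≤
        Ex fun x => Ex fun y => b x * b y * w2 x y + b x * b y * w2 y x := by
      refine Ex_mono fun x => Ex_mono fun y => ?_
      rw [← mul_add]
      refine mul_le_mul_of_nonneg_left ?_ (mul_nonneg (b0 x) (b0 y))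
      rw [hw2, hw2]
      by_cases t1 : Typ T B 3 1 (x, y)
      · by_cases t2 : Typ T B 3 1 (y, x)
        · rw [ind_false (p := ¬ Blue T B 4 x y)
            (not_not.2 ⟨t1.mono (by norm_num), t2.mono (by norm_num)⟩)]
          linarith [ind_nonneg (¬ Typ T B 3 1 (x, y)), ind_nonneg (¬ Typ T B 3 1 (y, x))]
        · rw [ind_true t2]
          linarith [ind_nonneg (¬ Typ T B 3 1 (x, y)), ind_le_one (¬ Blue T B 4 x y)]
      · rw [ind_true t1]
        linarith [ind_nonneg (¬ Typ T B 3 1 (y, x)), ind_le_one (¬ Blue T B 4 x y)]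
    simp_rw [Ex_add] at this
    have e : (Ex fun x => Ex fun y => b x * b y * w2 y x) =
        Ex fun x => Ex fun y => b x * b y * w2 x y := by
      rw [Ex_comm]
      refine Ex_congr fun x => Ex_congr fun y => ?_
      ring
    linarith
end
end TightCycle
namespace TightCycle

theorem num_vertex {α β a2 b1 b2 : ℝ} (hα1 : 0.365 ≤ α) (hα2 : α ≤ 0.3671) (hβ1 : 0.6328 ≤ β)
    (hβ2 : β ≤ 0.635) (h1 : 0 ≤ a2) (h2 : a2 ≤ α) (h3 : 0 ≤ b1) (h5 : b1 + b2 ≤ β)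
    (h : 0.4639 ≤ b1 ^ 2 + 2 * a2 * b2 + α ^ 2 - a2 ^ 2) :
    (b1 < 0.02 ∧ α - 0.03 ≤ a2 ∧ β - 0.03 ≤ b2) ∨ (0.02 ≤ b1 ∧ β - 0.1 ≤ b1) := by
  by_cases c : b1 < 0.02
  · left
    refine ⟨c, ?_, ?_⟩
    · by_contra hc; push Not at hc
      have e1 : a2 * b2 ≤ a2 * β := mul_le_mul_of_nonneg_left (by linarith) h1
      have e2 : 0.03 * 0.5 ≤ (α - a2) * (2 * β - α - a2) := by
        apply mul_le_mul <;> linarith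
      have e3 : b1 ^ 2 ≤ 0.0004 := by nlinarith
      have e4 : α * β ≤ 0.3671 * 0.635 := by gcongr
      nlinarith
    · by_contra hc; push Not at hc
      have e1 : a2 * b2 ≤ a2 * (β - 0.03) := mul_le_mul_of_nonneg_left (by linarith) h1
      have e2 : 0 ≤ (α - a2) * (2 * (β - 0.03) - α - a2) := by
        apply mul_nonneg <;> linarith
      have e3 : b1 ^ 2 ≤ 0.0004 := by nlinarith
      have e4 : α * (β - 0.03) ≤ 0.3671 * 0.605 := by
        apply mul_le_mul <;> linarith
      nlinarith
  · right
    push Not at c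
    refine ⟨c, ?_⟩
    by_contra hc; push Not at hc
    have e1 : a2 * b2 ≤ a2 * (β - b1) := mul_le_mul_of_nonneg_left (by linarith) h1
    by_cases c2 : b1 ≤ 0.1
    · have e2 : 0 ≤ (α - a2) * (2 * (β - b1) - α - a2) := by
        apply mul_nonneg <;> linarith
      have e4 : α * β ≤ 0.3671 * 0.635 := by gcongr
      have e5 : 0.365 * b1 ≤ α * b1 := mul_le_mul_of_nonneg_right hα1 h3
      have e6 : b1 ^ 2 ≤ 0.12 * b1 - 0.002 := by nlinarith
      nlinarith
    · push Not at c2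
      have e2 := sq_nonneg (a2 - (β - b1))
      have e3 : 0 ≤ (b1 - 0.1) * (β - 0.1 - b1) := by apply mul_nonneg <;> linarith
      have e4 : α ^ 2 ≤ 0.3671 ^ 2 := by gcongr
      have e5 : β ^ 2 ≤ 0.635 ^ 2 := by gcongr
      nlinarith

section
variable {V : Type} [Fintype V] [Nonempty V]

theorem Ex2_prod_le {f : V → V → ℝ} {g : V → ℝ} {r : ℝ} (hf : ∀ x y, 0 ≤ f x y)
    (hg : ∀ y, g y ≤ r) :
    (Ex fun x => Ex fun y => f x y * g y) ≤ r * Ex fun x => Ex fun y => f x y := by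
  rw [← Ex_mul_left]
  refine Ex_mono fun x => ?_
  rw [← Ex_mul_left]
  refine Ex_mono fun y => ?_
  rw [mul_comm r]
  exact mul_le_mul_of_nonneg_left (hg y) (hf x y)

theorem Ex2_prod_le' {f : V → V → ℝ} {g : V → ℝ} {r : ℝ} (hf : ∀ x y, 0 ≤ f x y)
    (hg : ∀ y, g y ≤ r) :
    (Ex fun x => Ex fun y => f x y * g x) ≤ r * Ex fun x => Ex fun y => f x y := by
  rw [← Ex_mul_left]
  refine Ex_mono fun x => ?_
  rw [← Ex_mul_left]
  refine Ex_mono fun y => ?_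
  rw [mul_comm r]
  exact mul_le_mul_of_nonneg_left (hg x) (hf x y)

set_option maxHeartbeats 1000000 in
theorem final_count {T : V → V → V → Prop} (hT : SymT T) {P : ℝ}
    (hA : ∀ A : V → Prop, (Ex fun x => Ex fun y => Ex fun z =>
      ind (A x) * ind (A y) * ind (A z) * ind (T x y z)) ≤ P * (Ex fun x => ind (A x)) ^ 3)
    {dom blue : ℕ → V → V → Prop}
    (md : ∀ k k' x y, k ≤ k' → dom k x y → dom k' x y)
    (mb : ∀ k k' x y, k ≤ k' → blue k x y → blue k' x y)
    (sb : ∀ k x y, blue k x y → blue k y x)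
    (r1 : ∀ k x y z, T x y z → dom k x y → dom (k + 4) x z ∧ blue (k + 4) y z)
    (r2 : ∀ k x y z, T x y z → blue k x y → dom (k + 4) z x ∧ dom (k + 4) z y)
    (r3 : ∀ k x y, k ≤ 16 → dom k x y → ¬ blue k x y)
    {a b : V → ℝ} {A : V → Prop} (ha : ∀ x, a x = ind (A x)) (hb : ∀ x, b x = 1 - a x)
    (hα1 : 0.36 ≤ Ex a) (hα2 : Ex a ≤ 0.37)
    (q1 : ∀ x, (Ex fun y => b x * b y * ind (¬ blue 8 x y)) ≤ 0.031)
    (q2 : ∀ y, (Ex fun x => a x * b y * ind (¬ dom 8 x y)) ≤ 0.031)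
    (q3 : ∀ x, (Ex fun y => a x * b y * ind (¬ dom 8 x y)) ≤ 0.101) :
    dens T ≤ P * (Ex a) ^ 3 + 3 * (Ex a) * (1 - Ex a) ^ 2 := by
  have a0 : ∀ x, 0 ≤ a x := fun x => by rw [ha]; exact ind_nonneg _
  have a1 : ∀ x, a x ≤ 1 := fun x => by rw [ha]; exact ind_le_one _
  have b0 : ∀ x, 0 ≤ b x := fun x => by rw [hb]; linarith [a1 x]
  have b1 : ∀ x, b x ≤ 1 := fun x => by rw [hb]; linarith [a0 x]
  have di : ∀ x, (a x = 1 ∧ b x = 0) ∨ (a x = 0 ∧ b x = 1) := by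
    intro x
    rw [hb, ha]
    by_cases h : A x
    · left; rw [ind_true h]; norm_num
    · right; rw [ind_false h]; norm_num
  obtain ⟨α, hα⟩ : ∃ α, α = Ex a := ⟨_, rfl⟩
  obtain ⟨β, hβ⟩ : ∃ β, β = Ex b := ⟨_, rfl⟩
  have hαβ : β = 1 - α := by
    rw [hβ, hα, Ex_congr hb, Ex_sub, Ex_const]
  obtain ⟨t, ht⟩ : ∃ t : V → V → V → ℝ, ∀ x y z, t x y z = ind (T x y z) := ⟨_, fun _ _ _ => rfl⟩
  have t0 : ∀ x y z, 0 ≤ t x y z := fun x y z => by rw [ht]; exact ind_nonneg _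
  have t1 : ∀ x y z, t x y z ≤ 1 := fun x y z => by rw [ht]; exact ind_le_one _
  have trot : ∀ x y z, t y z x = t x y z := fun x y z => by
    rw [ht, ht]; exact ind_congr ⟨fun h => hT.rot2 h, fun h => hT.rot h⟩
  have tsw : ∀ x y z, t x z y = t x y z := fun x y z => by
    rw [ht, ht]; exact ind_congr ⟨fun h => hT.sw23 h, fun h => hT.sw23 h⟩
  obtain ⟨p1, hp1⟩ : ∃ p : V → V → ℝ, ∀ x y, p x y = a x * b y * ind (¬ dom 12 x y) :=
    ⟨_, fun _ _ => rfl⟩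
  obtain ⟨p2, hp2⟩ : ∃ p : V → V → ℝ, ∀ x y, p x y = b x * b y * ind (¬ blue 12 x y) :=
    ⟨_, fun _ _ => rfl⟩
  obtain ⟨n8, hn8⟩ : ∃ p : V → V → ℝ, ∀ x y, p x y = b x * b y * ind (¬ blue 8 x y) :=
    ⟨_, fun _ _ => rfl⟩
  obtain ⟨m8, hm8⟩ : ∃ p : V → V → ℝ, ∀ x y, p x y = a x * b y * ind (¬ dom 8 x y) :=
    ⟨_, fun _ _ => rfl⟩
  simp_rw [← hn8] at q1
  simp_rw [← hm8] at q2 q3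
  have p10 : ∀ x y, 0 ≤ p1 x y := fun x y => by
    rw [hp1]; exact mul_nonneg (mul_nonneg (a0 _) (b0 _)) (ind_nonneg _)
  have p20 : ∀ x y, 0 ≤ p2 x y := fun x y => by
    rw [hp2]; exact mul_nonneg (mul_nonneg (b0 _) (b0 _)) (ind_nonneg _)
  have n80 : ∀ x y, 0 ≤ n8 x y := fun x y => by
    rw [hn8]; exact mul_nonneg (mul_nonneg (b0 _) (b0 _)) (ind_nonneg _)
  have m80 : ∀ x y, 0 ≤ m8 x y := fun x y => by
    rw [hm8]; exact mul_nonneg (mul_nonneg (a0 _) (b0 _)) (ind_nonneg _)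
  have p1m : ∀ x y, p1 x y ≤ m8 x y := fun x y => by
    rw [hp1, hm8]
    exact mul_le_mul_of_nonneg_left (ind_mono fun h h' => h (md _ _ _ _ (by norm_num) h'))
      (mul_nonneg (a0 _) (b0 _))
  have p2n : ∀ x y, p2 x y ≤ n8 x y := fun x y => by
    rw [hp2, hn8]
    exact mul_le_mul_of_nonneg_left (ind_mono fun h h' => h (mb _ _ _ _ (by norm_num) h'))
      (mul_nonneg (b0 _) (b0 _))
  have p2s : ∀ x y, p2 x y = p2 y x := fun x y => by
    rw [hp2, hp2, ind_congr (p := ¬ blue 12 x y) (q := ¬ blue 12 y x)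
      (not_congr ⟨sb _ _ _, sb _ _ _⟩)]
    ring
  have q1' : ∀ x, (Ex fun y => p2 x y) ≤ 0.031 := fun x => (Ex_mono (p2n x)).trans (q1 x)
  have q3' : ∀ x, (Ex fun y => p1 x y) ≤ 0.101 := fun x => (Ex_mono (p1m x)).trans (q3 x)
  obtain ⟨E1, hE1⟩ : ∃ E, E = Ex fun x => Ex fun y => p1 x y := ⟨_, rfl⟩
  obtain ⟨E2, hE2⟩ : ∃ E, E = Ex fun x => Ex fun y => p2 x y := ⟨_, rfl⟩
  have E10 : 0 ≤ E1 := by rw [hE1]; exact Ex_nonneg fun x => Ex_nonneg fun y => p10 x y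
  have E20 : 0 ≤ E2 := by rw [hE2]; exact Ex_nonneg fun x => Ex_nonneg fun y => p20 x y
  obtain ⟨N1, hN1⟩ : ∃ N, N = Ex fun x => Ex fun y => Ex fun z => a x * a y * a z * t x y z :=
    ⟨_, rfl⟩
  obtain ⟨N2, hN2⟩ : ∃ N, N = Ex fun x => Ex fun y => Ex fun z => a x * a y * b z * t x y z :=
    ⟨_, rfl⟩
  obtain ⟨N3, hN3⟩ : ∃ N, N = Ex fun x => Ex fun y => Ex fun z => a x * b y * b z * t x y z :=
    ⟨_, rfl⟩
  obtain ⟨N4, hN4⟩ : ∃ N, N = Ex fun x => Ex fun y => Ex fun z => b x * b y * b z * t x y z :=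
    ⟨_, rfl⟩
  obtain ⟨D, hD⟩ : ∃ N, N = Ex fun x => Ex fun y => Ex fun z => a x * b y * b z * (1 - t x y z) :=
    ⟨_, rfl⟩
  have hdens : dens T = N1 + 3 * N2 + 3 * N3 + N4 := by
    have e1 : N2 = Ex fun x => Ex fun y => Ex fun z => a y * a z * b x * t x y z := by
      rw [hN2, Ex3_rot]; simp_rw [trot]
    have e2 : N2 = Ex fun x => Ex fun y => Ex fun z => a z * a x * b y * t x y z := by
      rw [e1, Ex3_rot]; simp_rw [trot]
    have e3 : N3 = Ex fun x => Ex fun y => Ex fun z => a y * b z * b x * t x y z := by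
      rw [hN3, Ex3_rot]; simp_rw [trot]
    have e4 : N3 = Ex fun x => Ex fun y => Ex fun z => a z * b x * b y * t x y z := by
      rw [e3, Ex3_rot]; simp_rw [trot]
    have : N1 + 3 * N2 + 3 * N3 + N4 = N1 + N2 + N2 + N2 + N3 + N3 + N3 + N4 := by ring
    rw [this]
    nth_rewrite 2 [e1]
    nth_rewrite 2 [e2]
    nth_rewrite 2 [e3]
    nth_rewrite 2 [e4]
    rw [hN1, hN2, hN3, hN4]
    rw [← Ex3_add, ← Ex3_add, ← Ex3_add, ← Ex3_add, ← Ex3_add, ← Ex3_add, ← Ex3_add]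
    unfold dens
    refine Ex_congr fun x => Ex_congr fun y => Ex_congr fun z => ?_
    rw [← ht, hb, hb, hb]
    ring
  have c1 : N1 ≤ P * α ^ 3 := by
    have := hA A
    simp_rw [← ha, ← ht] at this
    rw [hN1, hα]; exact this
  have c2 : N2 ≤ 2 * α * E1 := by
    have key : ∀ x y z, a x * a y * b z * t x y z ≤ p1 x z * a y + a x * p1 y z := by
      intro x y z
      have k1 := mul_nonneg (p10 x z) (a0 y)
      have k2 := mul_nonneg (a0 x) (p10 y z)
      have k3 : 0 ≤ a x * a y * b z := mul_nonneg (mul_nonneg (a0 x) (a0 y)) (b0 z)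
      by_cases h : T x y z; swap
      · rw [ht, ind_false h]; linarith
      rw [ht, ind_true h]
      by_cases h1 : dom 12 x z
      · have h2 : ¬ dom 12 y z := by
          intro h3
          have h4 := (r1 _ _ _ _ (hT.sw23 h) h1).2
          exact r3 16 y z (by norm_num) (md _ _ _ _ (by norm_num) h3) (sb _ _ _ h4)
        rw [hp1 y z, ind_true h2]
        linarith
      · rw [hp1 x z, ind_true h1]
        linarith
    have := Ex3_mono key
    rw [← hN2, Ex3_add] at this
    have e1 : (Ex fun x => Ex fun y => Ex fun z => p1 x z * a y) = E1 * α := by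
      rw [hE1, hα, ← Ex_mul_right]
      refine Ex_congr fun x => ?_
      rw [Ex_comm, ← Ex_mul_Ex]
    have e2 : (Ex fun x => Ex fun y => Ex fun z => a x * p1 y z) = α * E1 := by
      simp_rw [Ex_mul_left]
      rw [Ex_mul_right, hE1, hα]
    linarith
  have c3 : N3 = α * β ^ 2 - D := by
    have : N3 + D = α * β ^ 2 := by
      rw [hN3, hD, ← Ex3_add]
      calc _ = Ex fun x => Ex fun y => Ex fun z => a x * b y * b z := by
            refine Ex_congr fun z => Ex_congr fun x => Ex_congr fun y => ?_
            ring
        _ = _ := by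
          simp_rw [Ex_mul_left, Ex_mul_right, Ex_mul_left, Ex_mul_right]
          rw [hα, hβ]; ring
    linarith
  have c4 : N4 ≤ 3 * 0.031 * E2 := by
    have key : ∀ x y z, b x * b y * b z * t x y z ≤
        p2 x y * p2 x z + p2 x y * p2 y z + p2 x z * p2 z y := by
      intro x y z
      have k1 := mul_nonneg (p20 x y) (p20 x z)
      have k2 := mul_nonneg (p20 x y) (p20 y z)
      have k3 := mul_nonneg (p20 x z) (p20 z y)
      have tri : ∀ x y z, T x y z → b x * b y * b z = 1 → blue 12 x y →
          p2 x z = 1 ∧ p2 z y = 1 := by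
        intro x y z h hb1 hbl
        obtain ⟨d1, d2⟩ := r2 _ _ _ _ h hbl
        have f1 : ¬ blue 12 x z := fun h' => r3 16 z x (by norm_num) d1
          (sb _ _ _ (mb _ _ _ _ (by norm_num) h'))
        have f2 : ¬ blue 12 z y := fun h' => r3 16 z y (by norm_num) d2
          (mb _ _ _ _ (by norm_num) h')
        rw [hp2, hp2, ind_true f1, ind_true f2]
        rcases di x with ⟨_, e1⟩ | ⟨_, e1⟩ <;> rcases di y with ⟨_, e2⟩ | ⟨_, e2⟩ <;>
        rcases di z with ⟨_, e3⟩ | ⟨_, e3⟩ <;> rw [e1, e2, e3] at hb1 <;> norm_num at hb1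
        rw [e1, e2, e3]; norm_num
      by_cases h : T x y z; swap
      · rw [ht, ind_false h]; linarith
      rw [ht, ind_true h]
      have hbb : b x * b y * b z = 1 ∨ b x * b y * b z = 0 := by
        rcases di x with ⟨_, e1⟩ | ⟨_, e1⟩ <;> rcases di y with ⟨_, e2⟩ | ⟨_, e2⟩ <;>
        rcases di z with ⟨_, e3⟩ | ⟨_, e3⟩ <;> rw [e1, e2, e3] <;> norm_num
      rcases hbb with hbb | hbb; swap
      · rw [hbb]; linarith
      rw [hbb]
      by_cases h1 : blue 12 x y
      · obtain ⟨f1, f2⟩ := tri x y z h hbb h1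
        simp only [f1, f2] at k1 k2 k3 ⊢; linarith
      by_cases h2 : blue 12 x z
      · obtain ⟨f1, f2⟩ := tri x z y (hT.sw23 h) (by rw [← hbb]; ring) h2
        simp only [f1, f2] at k1 k2 k3 ⊢; linarith
      have g : b x = 1 ∧ b y = 1 ∧ b z = 1 := by
        rcases di x with ⟨_, e1⟩ | ⟨_, e1⟩ <;> rcases di y with ⟨_, e2⟩ | ⟨_, e2⟩ <;>
        rcases di z with ⟨_, e3⟩ | ⟨_, e3⟩ <;> rw [e1, e2, e3] at hbb <;> norm_num at hbb
        exact ⟨e1, e2, e3⟩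
      have f1 : p2 x y = 1 := by rw [hp2, g.1, g.2.1, ind_true h1]; norm_num
      have f2 : p2 x z = 1 := by rw [hp2, g.1, g.2.2, ind_true h2]; norm_num
      simp only [f1, f2] at k1 k2 k3 ⊢; linarith
    have tot := Ex3_mono key
    rw [← hN4, Ex3_add, Ex3_add] at tot
    have e1 : (Ex fun x => Ex fun y => Ex fun z => p2 x y * p2 x z) ≤ 0.031 * E2 := by
      simp_rw [Ex_mul_left]
      rw [hE2]
      exact Ex2_prod_le' p20 q1'
    have e2 : (Ex fun x => Ex fun y => Ex fun z => p2 x y * p2 y z) ≤ 0.031 * E2 := by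
      simp_rw [Ex_mul_left]
      rw [hE2]
      exact Ex2_prod_le p20 q1'
    have e3 : (Ex fun x => Ex fun y => Ex fun z => p2 x z * p2 z y) ≤ 0.031 * E2 := by
      refine le_trans (le_of_eq ?_) e2
      exact Ex_congr fun x => Ex_comm _
    linarith
  have c5 : 1.08 * E1 ≤ D := by
    have key : ∀ x y z, p1 x y * b z + b y * p1 x z ≤ a x * b y * b z * (1 - t x y z) +
        p1 x y * p1 x z + p1 x y * n8 y z + p1 x z * n8 z y := by
      intro x y z
      have k1 := mul_nonneg (p10 x y) (p10 x z)
      have k2 := mul_nonneg (p10 x y) (n80 y z)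
      have k3 := mul_nonneg (p10 x z) (n80 z y)
      have k4 : 0 ≤ a x * b y * b z * (1 - t x y z) :=
        mul_nonneg (mul_nonneg (mul_nonneg (a0 _) (b0 _)) (b0 _)) (by linarith [t1 x y z])
      rcases di x with ⟨e1, _⟩ | ⟨e1, _⟩; swap
      · have z1 : p1 x y = 0 := by rw [hp1, e1]; ring
        have z2 : p1 x z = 0 := by rw [hp1, e1]; ring
        rw [z1, z2] at *; linarith
      rcases di y with ⟨_, e2⟩ | ⟨_, e2⟩
      · have z1 : p1 x y = 0 := by rw [hp1, e2]; ring
        rw [z1, e2] at *; linarith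
      rcases di z with ⟨_, e3⟩ | ⟨_, e3⟩
      · have z1 : p1 x z = 0 := by rw [hp1, e3]; ring
        rw [z1, e3] at *; linarith
      by_cases h : T x y z
      · have u1 : p1 x y ≤ p1 x y * n8 y z := by
          by_cases h8 : blue 8 y z
          · have : dom 12 x y := (r2 _ _ _ _ (hT.rot h) h8).1
            have : p1 x y = 0 := by rw [hp1, ind_false (not_not.2 this)]; ring
            rw [this]; linarith
          · have : n8 y z = 1 := by rw [hn8, e2, e3, ind_true h8]; norm_num
            rw [this]; linarith
        have u2 : p1 x z ≤ p1 x z * n8 z y := by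
          by_cases h8 : blue 8 z y
          · have : dom 12 x z := (r2 _ _ _ _ (hT.rot (hT.sw23 h)) h8).1
            have : p1 x z = 0 := by rw [hp1, ind_false (not_not.2 this)]; ring
            rw [this]; linarith
          · have : n8 z y = 1 := by rw [hn8, e2, e3, ind_true h8]; norm_num
            rw [this]; linarith
        rw [e2, e3] at k4 ⊢; linarith
      · have e4 : t x y z = 0 := by rw [ht, ind_false h]
        rw [e1, e2, e3, e4]
        have u1 : p1 x y ≤ 1 := by rw [hp1, e1, e2]; linarith [ind_le_one (¬ dom 12 x y)]
        have u2 : p1 x z ≤ 1 := by rw [hp1, e1, e3]; linarith [ind_le_one (¬ dom 12 x z)]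
        nlinarith [mul_nonneg (sub_nonneg.2 u1) (sub_nonneg.2 u2)]
    have tot := Ex3_mono key
    rw [Ex3_add, Ex3_add, Ex3_add, Ex3_add, ← hD] at tot
    have e1 : (Ex fun x => Ex fun y => Ex fun z => p1 x y * p1 x z) ≤ 0.101 * E1 := by
      simp_rw [Ex_mul_left]
      rw [hE1]
      exact Ex2_prod_le' p10 q3'
    have e2 : (Ex fun x => Ex fun y => Ex fun z => p1 x y * n8 y z) ≤ 0.031 * E1 := by
      simp_rw [Ex_mul_left]
      rw [hE1]
      exact Ex2_prod_le p10 q1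
    have e3 : (Ex fun x => Ex fun y => Ex fun z => p1 x z * n8 z y) ≤ 0.031 * E1 := by
      refine le_trans (le_of_eq ?_) e2
      exact Ex_congr fun x => Ex_comm _
    have e4 : (Ex fun x => Ex fun y => Ex fun z => p1 x y * b z) = E1 * β := by
      simp_rw [Ex_mul_left, Ex_mul_right]
      rw [hE1, hβ]
    have e5 : (Ex fun x => Ex fun y => Ex fun z => b y * p1 x z) = E1 * β := by
      rw [← e4]
      refine Ex_congr fun x => ?_
      rw [Ex_comm]
      exact Ex_congr fun y => Ex_congr fun z => mul_comm _ _
    have : 0.63 * E1 ≤ E1 * β := by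
      rw [mul_comm]
      refine mul_le_mul_of_nonneg_left ?_ E10
      rw [hαβ, hα]; linarith
    linarith
  have c6 : 0.329 * E2 ≤ D := by
    have key : ∀ x y z, a x * p2 y z ≤ a x * b y * b z * (1 - t x y z) + p2 y z * m8 x y := by
      intro x y z
      have k2 := mul_nonneg (p20 y z) (m80 x y)
      have k4 : 0 ≤ a x * b y * b z * (1 - t x y z) :=
        mul_nonneg (mul_nonneg (mul_nonneg (a0 _) (b0 _)) (b0 _)) (by linarith [t1 x y z])
      rcases di x with ⟨e1, _⟩ | ⟨e1, _⟩; swap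
      · rw [e1] at *; linarith
      rcases di y with ⟨_, e2⟩ | ⟨_, e2⟩
      · have z1 : p2 y z = 0 := by rw [hp2, e2]; ring
        rw [z1] at *; linarith
      by_cases h : T x y z
      · by_cases h8 : dom 8 x y
        · have : blue 12 y z := (r1 _ _ _ _ h h8).2
          have : p2 y z = 0 := by rw [hp2, ind_false (not_not.2 this)]; ring
          rw [this]; linarith
        · have : m8 x y = 1 := by rw [hm8, e1, e2, ind_true h8]; norm_num
          rw [this]; rw [e1] at k4 ⊢; linarith
      · rw [hp2 y z] at k2
        rw [ht, ind_false h, hp2 y z]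
        have := mul_le_mul_of_nonneg_left (ind_le_one (¬ blue 12 y z)) (mul_nonneg (b0 y) (b0 z))
        rw [e1]
        linarith
    have tot := Ex3_mono key
    rw [Ex3_add, ← hD] at tot
    have e4 : (Ex fun x => Ex fun y => Ex fun z => a x * p2 y z) = α * E2 := by
      simp_rw [Ex_mul_left]
      rw [Ex_mul_right, hE2, hα]
    have e2 : (Ex fun x => Ex fun y => Ex fun z => p2 y z * m8 x y) ≤ 0.031 * E2 := by
      rw [Ex3_rot, Ex3_rot]
      simp_rw [Ex_mul_left]
      rw [hE2]
      exact Ex2_prod_le' p20 q2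
    rw [e4] at tot
    have : 0.36 * E2 ≤ α * E2 := by
      refine mul_le_mul_of_nonneg_right ?_ E20
      rw [hα]; exact hα1
    linarith
  have : 2 * α * E1 ≤ 0.74 * E1 := by
    refine mul_le_mul_of_nonneg_right ?_ E10
    rw [hα]; linarith
  rw [hdens, ← hα, ← hαβ]
  linarith
end
end TightCycle
namespace TightCycle
section
variable {V : Type} [Fintype V] [Nonempty V]

set_option maxHeartbeats 1000000 in
theorem pass2 {T : V → V → V → Prop} (hT : SymT T) (hM : NoClosed T 60)
    {P e : ℝ} (hP : 2 * √3 - 3 ≤ P) (he : e = 0.000000000001)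
    (hA : ∀ A : V → Prop, (Ex fun x => Ex fun y => Ex fun z =>
      ind (A x) * ind (A y) * ind (A z) * ind (T x y z)) ≤ P * (Ex fun x => ind (A x)) ^ 3)
    (hdeg : ∀ x, P - e ≤ Ex fun y => Ex fun z => ind (T x y z))
    {A B : V → Prop} (hdisj : ∀ x, ¬ (A x ∧ B x))
    (hsum : 1 - 0.000001 ≤ (Ex fun x => ind (A x)) + (Ex fun x => ind (B x)))
    (hAα : |(Ex fun x => ind (A x)) - (√3 - 1) / 2| ≤ 0.001)
    (hD : (Ex fun z => Ex fun x => Ex fun y => ind (A z) * ind (B x) * ind (B y) *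
      (1 - ind (T z x y))) ≤ 0.000001) :
    ∃ α : ℝ, 0 ≤ α ∧ α ≤ 0.5 ∧ dens T ≤ P * α ^ 3 + 3 * α * (1 - α) ^ 2 := by
  obtain ⟨sq1, sq2, sq3⟩ := sqrt3_bounds
  obtain ⟨a, ha⟩ : ∃ a : V → ℝ, ∀ x, a x = ind (A x) := ⟨_, fun _ => rfl⟩
  obtain ⟨b, hb⟩ : ∃ b : V → ℝ, ∀ x, b x = ind (B x) := ⟨_, fun _ => rfl⟩
  obtain ⟨χ, hχ⟩ : ∃ χ : V → ℝ, ∀ x, χ x = 1 - a x - b x := ⟨_, fun _ => rfl⟩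
  obtain ⟨α, hα⟩ : ∃ α, α = Ex a := ⟨_, rfl⟩
  obtain ⟨β, hβ⟩ : ∃ β, β = Ex b := ⟨_, rfl⟩
  have hα' : (Ex fun x => ind (A x)) = α := by rw [hα]; exact Ex_congr fun x => (ha x).symm
  have hβ' : (Ex fun x => ind (B x)) = β := by rw [hβ]; exact Ex_congr fun x => (hb x).symm
  rw [hα', hβ'] at hsum
  rw [hα'] at hAα
  have tri : ∀ x, (a x = 1 ∧ b x = 0 ∧ χ x = 0) ∨ (a x = 0 ∧ b x = 1 ∧ χ x = 0) ∨
      (a x = 0 ∧ b x = 0 ∧ χ x = 1) := by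
    intro x
    rw [hχ, ha, hb]
    by_cases h1 : A x
    · left
      rw [ind_true h1, ind_false fun h => hdisj x ⟨h1, h⟩]; norm_num
    · right
      by_cases h2 : B x
      · left; rw [ind_false h1, ind_true h2]; norm_num
      · right; rw [ind_false h1, ind_false h2]; norm_num
  have a0 : ∀ x, 0 ≤ a x := fun x => by rw [ha]; exact ind_nonneg _
  have b0 : ∀ x, 0 ≤ b x := fun x => by rw [hb]; exact ind_nonneg _
  have a1 : ∀ x, a x ≤ 1 := fun x => by rw [ha]; exact ind_le_one _
  have b1 : ∀ x, b x ≤ 1 := fun x => by rw [hb]; exact ind_le_one _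
  have χ0 : ∀ x, 0 ≤ χ x := fun x => by rcases tri x with h | h | h <;> rw [h.2.2] <;> norm_num
  obtain ⟨X, hX⟩ : ∃ X, X = Ex χ := ⟨_, rfl⟩
  have hXe : X = 1 - α - β := by
    rw [hX, hα, hβ, Ex_congr hχ, Ex_sub, Ex_sub, Ex_const]
  have X0 : 0 ≤ X := by rw [hX]; exact Ex_nonneg χ0
  have hab := abs_le.1 hAα
  have g1 : 0.365 ≤ α := by linarith [hab.1]
  have g2 : α ≤ 0.3671 := by linarith [hab.2]
  have g3 : 0.6328 ≤ β := by linarith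
  have g4 : β ≤ 0.635 := by linarith
  obtain ⟨dom, blue, md, mb, sb, r1, r2, r3, k1, k2⟩ := exists_sys hT hM (by rw [hα']; linarith)
    (by rw [hβ']; linarith) hD
  simp_rw [← ha, ← hb] at k1
  simp_rw [← hb] at k2
  obtain ⟨f1, hf1⟩ : ∃ f : V → V → ℝ, ∀ x y, f x y = a x * b y * ind (¬ dom 4 x y) :=
    ⟨_, fun _ _ => rfl⟩
  obtain ⟨f2, hf2⟩ : ∃ f : V → V → ℝ, ∀ x y, f x y = b x * b y * ind (¬ blue 4 x y) :=
    ⟨_, fun _ _ => rfl⟩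
  simp_rw [← hf1] at k1
  simp_rw [← hf2] at k2
  have f10 : ∀ x y, 0 ≤ f1 x y := fun x y => by
    rw [hf1]; exact mul_nonneg (mul_nonneg (a0 _) (b0 _)) (ind_nonneg _)
  have f20 : ∀ x y, 0 ≤ f2 x y := fun x y => by
    rw [hf2]; exact mul_nonneg (mul_nonneg (b0 _) (b0 _)) (ind_nonneg _)
  obtain ⟨d1, hd1⟩ : ∃ f : V → V → ℝ, ∀ x y, f x y = b y * ind (dom 8 x y) :=
    ⟨_, fun _ _ => rfl⟩
  obtain ⟨d2, hd2⟩ : ∃ f : V → V → ℝ, ∀ x y, f x y = b y * ind (blue 8 x y) :=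
    ⟨_, fun _ _ => rfl⟩
  obtain ⟨c2, hc2⟩ : ∃ f : V → V → ℝ, ∀ x y, f x y = a y * ind (dom 8 y x) :=
    ⟨_, fun _ _ => rfl⟩
  have d10 : ∀ x y, 0 ≤ d1 x y := fun x y => by
    rw [hd1]; exact mul_nonneg (b0 _) (ind_nonneg _)
  have d20 : ∀ x y, 0 ≤ d2 x y := fun x y => by
    rw [hd2]; exact mul_nonneg (b0 _) (ind_nonneg _)
  have c20 : ∀ x y, 0 ≤ c2 x y := fun x y => by
    rw [hc2]; exact mul_nonneg (a0 _) (ind_nonneg _)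
  have c2a : ∀ x y, c2 x y ≤ a y := fun x y => by
    rw [hc2]
    have := mul_le_mul_of_nonneg_left (ind_le_one (dom 8 y x)) (a0 y)
    linarith
  -- the vertex dichotomy
  have degb : ∀ x, (Ex fun y => Ex fun z => ind (T x y z)) ≤
      Ex (d1 x) ^ 2 + 2 * Ex (c2 x) * Ex (d2 x) + α ^ 2 - Ex (c2 x) ^ 2 + 0.000152 := by
    intro x
    have key : ∀ y z, ind (T x y z) ≤ (d1 x y * d1 x z + c2 x y * d2 x z + d2 x y * c2 x z +
        a y * a z - c2 x y * c2 x z) + (f2 y z + f1 y z + f1 z y + χ y + χ z) := by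
      intro y z
      have n1 := mul_nonneg (d10 x y) (d10 x z)
      have n2 := mul_nonneg (c20 x y) (d20 x z)
      have n3 := mul_nonneg (d20 x y) (c20 x z)
      have n4 : c2 x y * c2 x z ≤ a y * a z := mul_le_mul (c2a x y) (c2a x z) (c20 _ _) (a0 _)
      have n5 := f20 y z
      have n6 := f10 y z
      have n7 := f10 z y
      have n8 := χ0 y
      have n9 := χ0 z
      by_cases t : T x y z; swap
      · rw [ind_false t]; linarith
      rw [ind_true t]
      rcases tri y with ⟨u1, u2, u3⟩ | ⟨u1, u2, u3⟩ | ⟨u1, u2, u3⟩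
      · rcases tri z with ⟨v1, v2, v3⟩ | ⟨v1, v2, v3⟩ | ⟨v1, v2, v3⟩
        · have : c2 x y * c2 x z = 0 := by
            by_cases w1 : dom 8 y x
            · by_cases w2 : dom 8 z x
              · exfalso
                have := (r1 _ _ _ _ (hT.swap t) w1).2
                exact r3 12 z x (by norm_num) (md _ _ _ _ (by norm_num) w2) (sb _ _ _ this)
              · rw [hc2 x z, ind_false w2]; ring
            · rw [hc2 x y, ind_false w1]; ring
          rw [u1, v1]; linarith
        · by_cases w : dom 4 y z
          · obtain ⟨q1, q2⟩ := r1 _ _ _ _ (hT.rot t) w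
            have e1 : c2 x y = 1 := by rw [hc2, ind_true q1, u1]; norm_num
            have e2 : d2 x z = 1 := by rw [hd2, ind_true (sb _ _ _ q2), v2]; norm_num
            simp only [e1, e2] at n2 n4 ⊢; linarith
          · have : f1 y z = 1 := by rw [hf1, ind_true w, u1, v2]; norm_num
            linarith
        · linarith
      · rcases tri z with ⟨v1, v2, v3⟩ | ⟨v1, v2, v3⟩ | ⟨v1, v2, v3⟩
        · by_cases w : dom 4 z y
          · obtain ⟨q1, q2⟩ := r1 _ _ _ _ (hT.rev t) w
            have e1 : c2 x z = 1 := by rw [hc2, ind_true q1, v1]; norm_num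
            have e2 : d2 x y = 1 := by rw [hd2, ind_true (sb _ _ _ q2), u2]; norm_num
            rw [e1, e2] at n3 ⊢; rw [e1] at n4; linarith
          · have : f1 z y = 1 := by rw [hf1, ind_true w, u2, v1]; norm_num
            linarith
        · by_cases w : blue 4 y z
          · obtain ⟨q1, q2⟩ := r2 _ _ _ _ (hT.rot t) w
            have e1 : d1 x y = 1 := by rw [hd1, ind_true q1, u2]; norm_num
            have e2 : d1 x z = 1 := by rw [hd1, ind_true q2, v2]; norm_num
            rw [e1, e2] at n1 ⊢; linarith
          · have : f2 y z = 1 := by rw [hf2, ind_true w, u2, v2]; norm_num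
            linarith
        · linarith
      · linarith
    have tot := Ex_mono fun y => Ex_mono (key y)
    simp_rw [Ex_add, Ex_sub, Ex_add] at tot
    rw [Ex_mul_Ex, Ex_mul_Ex, Ex_mul_Ex, Ex_mul_Ex, Ex_mul_Ex, Ex_comm (fun y z => f1 z y)] at tot
    simp_rw [Ex_const] at tot
    change _ ≤ Ex (d1 x) * Ex (d1 x) + Ex (c2 x) * Ex (d2 x) + Ex (d2 x) * Ex (c2 x) + Ex a * Ex a -
      Ex (c2 x) * Ex (c2 x) + (_ + _ + _ + Ex χ + Ex χ) at tot
    rw [← hα, ← hX] at tot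
    linarith
  have dich : ∀ x, (Ex (d1 x) < 0.02 ∧ α - 0.03 ≤ Ex (c2 x) ∧ β - 0.03 ≤ Ex (d2 x)) ∨
      (0.02 ≤ Ex (d1 x) ∧ β - 0.1 ≤ Ex (d1 x)) := by
    intro x
    refine num_vertex g1 g2 g3 g4 (Ex_nonneg (c20 x)) ?_ (Ex_nonneg (d10 x)) ?_ ?_
    · rw [hα]; exact Ex_mono (c2a x)
    · rw [hβ, ← Ex_add]
      refine Ex_mono fun y => ?_
      rw [hd1, hd2]
      by_cases w : dom 8 x y
      · rw [ind_true w, ind_false (r3 8 x y (by norm_num) w)]; linarith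
      · rw [ind_false w]
        have := mul_le_mul_of_nonneg_left (ind_le_one (blue 8 x y)) (b0 y)
        linarith
    · have := degb x
      have := hdeg x
      rw [he] at this
      linarith
  -- new partition
  obtain ⟨A', hA'⟩ : ∃ A' : V → Prop, ∀ x, A' x ↔ 0.02 ≤ Ex (d1 x) := ⟨_, fun _ => Iff.rfl⟩
  obtain ⟨a', ha'⟩ : ∃ a' : V → ℝ, ∀ x, a' x = ind (A' x) := ⟨_, fun _ => rfl⟩
  obtain ⟨b', hb'⟩ : ∃ b' : V → ℝ, ∀ x, b' x = 1 - a' x := ⟨_, fun _ => rfl⟩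
  have di : ∀ x, (a' x = 1 ∧ b' x = 0 ∧ β - 0.1 ≤ Ex (d1 x)) ∨
      (a' x = 0 ∧ b' x = 1 ∧ Ex (d1 x) < 0.02 ∧ α - 0.03 ≤ Ex (c2 x) ∧ β - 0.03 ≤ Ex (d2 x)) := by
    intro x
    rw [hb', ha']
    rcases dich x with h | h
    · right
      rw [ind_false (p := A' x) (by rw [hA']; exact not_le.2 h.1)]
      exact ⟨rfl, by norm_num, h⟩
    · left
      rw [ind_true (p := A' x) (by rw [hA']; exact h.1)]
      exact ⟨rfl, by norm_num, h.2⟩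
  have a'0 : ∀ x, 0 ≤ a' x := fun x => by rw [ha']; exact ind_nonneg _
  have a'1 : ∀ x, a' x ≤ 1 := fun x => by rw [ha']; exact ind_le_one _
  have b'0 : ∀ x, 0 ≤ b' x := fun x => by rw [hb']; linarith [a'1 x]
  have b'1 : ∀ x, b' x ≤ 1 := fun x => by rw [hb']; linarith [a'0 x]
  have v1 : (Ex fun x => a x * b' x) ≤ 0.0001 := by
    have : (Ex fun x => 0.6 * (a x * b' x)) ≤ Ex fun x => Ex fun y => f1 x y := by
      refine Ex_mono fun x => ?_
      rcases tri x with ⟨u1, _⟩ | ⟨u1, _⟩ | ⟨u1, _⟩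
      · rcases di x with ⟨_, w, _⟩ | ⟨_, w, w1, _⟩
        · rw [w]
          have := Ex_nonneg (f10 x)
          linarith
        · have : β - Ex (d1 x) ≤ Ex fun y => f1 x y := by
            rw [hβ, ← Ex_sub]
            refine Ex_mono fun y => ?_
            rw [hd1, hf1, u1, ind_not]
            have : ind (dom 4 x y) ≤ ind (dom 8 x y) := ind_mono (md _ _ _ _ (by norm_num))
            have := mul_le_mul_of_nonneg_left this (b0 y)
            linarith
          rw [u1, w]
          linarith
      · rw [u1]; have := Ex_nonneg (f10 x); linarith
      · rw [u1]; have := Ex_nonneg (f10 x); linarith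
    rw [Ex_mul_left] at this
    linarith
  have v2 : (Ex fun x => b x * a' x) ≤ 0.0001 := by
    have : (Ex fun x => 0.5 * (b x * a' x)) ≤ Ex fun x => Ex fun y => f2 x y := by
      refine Ex_mono fun x => ?_
      have nn := Ex_nonneg (f20 x)
      by_cases u : b x = 1
      · rcases di x with ⟨w, _, w1⟩ | ⟨w, _⟩
        · have : Ex (d1 x) ≤ Ex fun y => f2 x y := by
            refine Ex_mono fun y => ?_
            rw [hd1, hf2, u]
            have : ind (dom 8 x y) ≤ ind (¬ blue 4 x y) := ind_mono fun h h' =>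
              r3 8 x y (by norm_num) h (mb _ _ _ _ (by norm_num) h')
            have := mul_le_mul_of_nonneg_left this (b0 y)
            linarith
          rw [u, w]
          linarith
        · rw [w]; linarith
      · have : b x = 0 := by
          rcases tri x with ⟨_, h, _⟩ | ⟨_, h, _⟩ | ⟨_, h, _⟩
          · exact h
          · exact absurd h u
          · exact h
        rw [this]; linarith
    rw [Ex_mul_left] at this
    linarith
  have ba : ∀ y, b' y ≤ b y + a y * b' y + χ y := by
    intro y
    have := b'1 y
    have := b'0 y
    rcases tri y with ⟨h1, h2, h3⟩ | ⟨h1, h2, h3⟩ | ⟨h1, h2, h3⟩ <;> rw [h1, h2, h3] <;> linarith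
  have ab : ∀ y, a' y ≤ a y + b y * a' y + χ y := by
    intro y
    have := a'1 y
    have := a'0 y
    rcases tri y with ⟨h1, h2, h3⟩ | ⟨h1, h2, h3⟩ | ⟨h1, h2, h3⟩ <;> rw [h1, h2, h3] <;> linarith
  have ab2 : ∀ y, a y ≤ a' y + a y * b' y := by
    intro y
    rw [hb']
    rcases tri y with ⟨h1, h2, h3⟩ | ⟨h1, h2, h3⟩ | ⟨h1, h2, h3⟩ <;> rw [h1] <;> linarith [a'0 y]
  have w1 : 0.36 ≤ Ex a' := by
    have := Ex_mono ab2
    rw [Ex_add] at this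
    change Ex a ≤ Ex a' + _ at this
    linarith
  have w2 : Ex a' ≤ 0.37 := by
    have := Ex_mono ab
    rw [Ex_add, Ex_add] at this
    change Ex a' ≤ Ex a + _ + Ex χ at this
    linarith
  refine ⟨Ex a', by linarith, by linarith, ?_⟩
  refine final_count hT hA md mb sb r1 r2 r3 ha' hb' w1 w2 ?_ ?_ ?_
  · intro x
    rcases di x with ⟨_, w, _⟩ | ⟨_, w, _, _, w3⟩
    · simp_rw [w, zero_mul]; rw [Ex_const]; norm_num
    · have key : ∀ y, b' x * b' y * ind (¬ blue 8 x y) ≤ (b y - d2 x y) + (a y * b' y + χ y) := by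
        intro y
        rw [w, hd2, ind_not]
        have := mul_le_mul_of_nonneg_right (ba y) (sub_nonneg.2 (ind_le_one (blue 8 x y)))
        have := mul_nonneg (add_nonneg (mul_nonneg (a0 y) (b'0 y)) (χ0 y)) (ind_nonneg (blue 8 x y))
        linarith
      have := Ex_mono key
      rw [Ex_add, Ex_sub, Ex_add] at this
      change _ ≤ Ex b - Ex (d2 x) + (_ + Ex χ) at this
      linarith
  · intro x
    rcases di x with ⟨_, w, _⟩ | ⟨_, w, _, w3, _⟩
    · simp_rw [w, mul_zero, zero_mul]; rw [Ex_const]; norm_num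
    · have key : ∀ y, a' y * b' x * ind (¬ dom 8 y x) ≤ (a y - c2 x y) + (b y * a' y + χ y) := by
        intro y
        rw [w, hc2, ind_not]
        have := mul_le_mul_of_nonneg_right (ab y) (sub_nonneg.2 (ind_le_one (dom 8 y x)))
        have := mul_nonneg (add_nonneg (mul_nonneg (b0 y) (a'0 y)) (χ0 y)) (ind_nonneg (dom 8 y x))
        linarith
      have := Ex_mono key
      rw [Ex_add, Ex_sub, Ex_add] at this
      change _ ≤ Ex a - Ex (c2 x) + (_ + Ex χ) at this
      linarith
  · intro x
    rcases di x with ⟨w, _, w3⟩ | ⟨w, _⟩; swap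
    · simp_rw [w, zero_mul]; rw [Ex_const]; norm_num
    · have key : ∀ y, a' x * b' y * ind (¬ dom 8 x y) ≤ (b y - d1 x y) + (a y * b' y + χ y) := by
        intro y
        rw [w, hd1, ind_not]
        have := mul_le_mul_of_nonneg_right (ba y) (sub_nonneg.2 (ind_le_one (dom 8 x y)))
        have := mul_nonneg (add_nonneg (mul_nonneg (a0 y) (b'0 y)) (χ0 y)) (ind_nonneg (dom 8 x y))
        linarith
      have := Ex_mono key
      rw [Ex_add, Ex_sub, Ex_add] at this
      change _ ≤ Ex b - Ex (d1 x) + (_ + Ex χ) at this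
      linarith
end
end TightCycle
namespace TightCycle

theorem R_pull {V W : Type} {T : V → V → V → Prop} (φ : W → V) {m : ℕ} {p q : W × W}
    (h : R (fun x y z => T (φ x) (φ y) (φ z)) m p q) :
    R T m (φ p.1, φ p.2) (φ q.1, φ q.2) := by
  induction m generalizing q with
  | zero => cases h; rfl
  | succ m ih =>
    obtain ⟨r, hr, h1, h2⟩ := h
    exact ⟨_, ih hr, by simp [h1], h2⟩

theorem SymT.pull {V W : Type} {T : V → V → V → Prop} (h : SymT T) (φ : W → V) :
    SymT (fun x y z => T (φ x) (φ y) (φ z)) := ⟨fun t => h.rot t, fun t => h.swap t⟩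

theorem Ex_prod_fst {V : Type} [Fintype V] (t : ℕ) (ht : 0 < t) (f : V → ℝ) :
    (Ex fun p : V × Fin t => f p.1) = Ex f := by
  unfold Ex
  rw [Fintype.sum_prod_type]
  simp only [Finset.sum_const, Finset.card_univ, Fintype.card_fin, Fintype.card_prod, nsmul_eq_mul]
  rw [← Finset.mul_sum]
  have : (t : ℝ) ≠ 0 := by positivity
  push_cast
  rw [mul_comm (Fintype.card V : ℝ), mul_div_mul_left _ _ this]

theorem Ex_sub_type {V : Type} [Fintype V] (A : V → Prop) [Fintype {x // A x}] (f : V → ℝ) :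
    (Ex fun x => ind (A x) * f x) = (Ex fun x => ind (A x)) * Ex fun x : {x // A x} => f x.1 := by
  classical
  unfold Ex
  have h : ∀ g : V → ℝ, ∑ x, ind (A x) * g x = ∑ x : {x // A x}, g x.1 := by
    intro g
    rw [← Finset.sum_subtype (Finset.univ.filter A) (by simp) g, Finset.sum_filter]
    refine Finset.sum_congr rfl fun x _ => ?_
    unfold ind; split_ifs <;> simp
  have h1 : ∑ x, ind (A x) = (Fintype.card {x // A x} : ℝ) := by
    have := h (fun _ => 1)
    simpa using this
  rw [h, h1]
  by_cases hc : (Fintype.card {x // A x} : ℝ) = 0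
  · have : IsEmpty {x // A x} := Fintype.card_eq_zero_iff.mp (by exact_mod_cast hc)
    simp
  · field_simp

theorem Ex_eq_point {V : Type} [Fintype V] (x : V) (f : V → ℝ) :
    (Ex fun a => ind (a = x) * f a) = f x / Fintype.card V := by
  classical
  unfold Ex
  congr 1
  rw [Finset.sum_eq_single x]
  · rw [ind_true rfl, one_mul]
  · intro b _ hb; rw [ind_false hb, zero_mul]
  · simp

theorem clone_ineq {V : Type} [Fintype V] [Nonempty V] {T : V → V → V → Prop} (hT : SymT T)
    (x y : V) : ∃ φ : V → V, dens T + 3 / Fintype.card V * ((Ex fun b => Ex fun c => ind (T y b c)) -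
      (Ex fun b => Ex fun c => ind (T x b c)) - 3 / Fintype.card V) ≤
      dens (fun a b c => T (φ a) (φ b) (φ c)) := by
  classical
  refine ⟨Function.update id x y, ?_⟩
  set φ : V → V := Function.update id x y with hφ
  have φx : φ x = y := by simp [hφ]
  have φn : ∀ a, a ≠ x → φ a = a := fun a h => by simp [hφ, h]
  obtain ⟨i, hi⟩ : ∃ i : V → ℝ, ∀ a, i a = ind (a = x) := ⟨_, fun _ => rfl⟩
  obtain ⟨g, hg⟩ : ∃ g : V → V → V → ℝ, ∀ a b c, g a b c = ind (T a b c) := ⟨_, fun _ _ _ => rfl⟩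
  have g0 : ∀ a b c, 0 ≤ g a b c := fun a b c => by rw [hg]; exact ind_nonneg _
  have g1 : ∀ a b c, g a b c ≤ 1 := fun a b c => by rw [hg]; exact ind_le_one _
  have grot : ∀ a b c, g b c a = g a b c := fun a b c => by
    rw [hg, hg]; exact ind_congr ⟨fun t => hT.rot2 t, fun t => hT.rot t⟩
  have key : ∀ a b c, g a b c +
      (i a * (g y b c - g x b c - 3 * i b) + (i b * (g y c a - g x c a - 3 * i c) +
        i c * (g y a b - g x a b - 3 * i a))) ≤ ind (T (φ a) (φ b) (φ c)) := by
    intro a b c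
    rw [← hg]
    have e1 := g0 (φ a) (φ b) (φ c)
    have q1 := g1 y b c
    have q2 := g1 y c a
    have q3 := g1 y a b
    have z1 := g0 x b c
    have z2 := g0 x c a
    have z3 := g0 x a b
    have w1 := grot a b c
    have w2 := grot b c a
    have w3 := grot c a b
    by_cases ha : a = x <;> by_cases hb : b = x <;> by_cases hc : c = x <;>
      simp only [hi, ind_true, ind_false, ha, hb, hc, φx, φn, ne_eq, not_false_eq_true] at * <;>
      nlinarith [grot y b c, grot b c y, grot a y c, grot a b y, grot y a b, grot y c a]
  have hsum : (Ex fun a => Ex fun b => Ex fun c => g a b c +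
      (i a * (g y b c - g x b c - 3 * i b) + (i b * (g y c a - g x c a - 3 * i c) +
        i c * (g y a b - g x a b - 3 * i a)))) ≤ dens (fun a b c => T (φ a) (φ b) (φ c)) := by
    unfold dens
    exact Ex_mono fun a => Ex_mono fun b => Ex_mono fun c => key a b c
  have r1 : (Ex fun a => Ex fun b => Ex fun c => i a * (g y b c - g x b c - 3 * i b)) =
      1 / Fintype.card V * ((Ex fun b => Ex fun c => ind (T y b c)) -
      (Ex fun b => Ex fun c => ind (T x b c)) - 3 / Fintype.card V) := by
    have : ∀ a, (Ex fun b => Ex fun c => i a * (g y b c - g x b c - 3 * i b)) = ind (a = x) *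
        ((Ex fun b => Ex fun c => ind (T y b c)) -
      (Ex fun b => Ex fun c => ind (T x b c)) - 3 / Fintype.card V) := by
      intro a
      have h3 : Ex i = 1 / Fintype.card V := by
        have := Ex_eq_point x (fun _ => (1:ℝ))
        rw [← this]; exact Ex_congr fun a => by rw [hi, mul_one]
      simp only [Ex_mul_left, Ex_sub, Ex_const, hi, hg]
      rw [← Ex_congr hi, h3]; ring
    rw [Ex_congr this, Ex_eq_point x (fun _ => _)]; ring
  have r2 : (Ex fun a => Ex fun b => Ex fun c => i b * (g y c a - g x c a - 3 * i c)) =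
      Ex fun a => Ex fun b => Ex fun c => i a * (g y b c - g x b c - 3 * i b) :=
    (Ex3_rot (fun a b c => i a * (g y b c - g x b c - 3 * i b))).symm
  have r3 : (Ex fun a => Ex fun b => Ex fun c => i c * (g y a b - g x a b - 3 * i a)) =
      Ex fun a => Ex fun b => Ex fun c => i a * (g y b c - g x b c - 3 * i b) := by
    rw [← r2]
    exact (Ex3_rot (fun a b c => i b * (g y c a - g x c a - 3 * i c))).symm
  have r0 : (Ex fun a => Ex fun b => Ex fun c => g a b c) = dens T := by simp only [hg, dens]
  rw [Ex3_add, Ex3_add, Ex3_add, r2, r3, r1, r0] at hsum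
  refine le_trans (le_of_eq ?_) hsum
  ring

end TightCycle
namespace TightCycle

/-- densities of structures without a closed tight walk of length `ℓ` -/
def denSet (ℓ : ℕ) : Set ℝ := {r | ∃ (V : Type) (_ : Fintype V) (_ : Nonempty V)
  (T : V → V → V → Prop), SymT T ∧ (∀ p, ¬ R T ℓ p p) ∧ r = dens T}

theorem denSet_le (ℓ : ℕ) : ∀ r ∈ denSet ℓ, r ≤ 1 := by
  rintro r ⟨V, _, _, T, _, _, rfl⟩
  exact Ex_le_one fun _ => Ex_le_one fun _ => Ex_le_one fun _ => ind_le_one _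

theorem extremal : ∃ L : ℕ, ∀ ℓ : ℕ, L ≤ ℓ → ¬ (3 ∣ ℓ) → ∀ (V : Type) [Fintype V] [Nonempty V]
    (T : V → V → V → Prop), SymT T → (∀ p, ¬ R T ℓ p p) → dens T ≤ 2 * √3 - 3 := by
  classical
  obtain ⟨e, he⟩ : ∃ e : ℝ, e = 0.000000000001 := ⟨_, rfl⟩
  have he0 : 0 < e := by rw [he]; norm_num
  obtain ⟨J, hJ⟩ : ∃ J : ℕ, 1 < J * (e / 3) ^ 2 := by
    obtain ⟨J, hJ⟩ := exists_nat_gt (1 / (e / 3) ^ 2)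
    exact ⟨J, by rwa [div_lt_iff₀ (by positivity)] at hJ⟩
  refine ⟨2 * (3 * (7 * J) + 61), fun ℓ hL h3 => ?_⟩
  obtain ⟨P, hPdef⟩ : ∃ P, P = sSup (denSet ℓ) := ⟨_, rfl⟩
  have hbdd : BddAbove (denSet ℓ) := ⟨1, denSet_le ℓ⟩
  have hle : ∀ (V : Type) [Fintype V] [Nonempty V]
    (T : V → V → V → Prop), SymT T → (∀ p, ¬ R T ℓ p p) → dens T ≤ P := by
    intro V _ _ T h1 h2
    rw [hPdef]
    exact le_csSup hbdd ⟨V, _, inferInstance, T, h1, h2, rfl⟩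
  suffices hPc : P ≤ 2 * √3 - 3 from fun V _ _ T h1 h2 => (hle V T h1 h2).trans hPc
  by_contra hlt
  push Not at hlt
  have hne : (denSet ℓ).Nonempty := by
    by_contra h
    rw [Set.not_nonempty_iff_eq_empty] at h
    rw [h, Real.sSup_empty] at hPdef
    have := sqrt3_bounds.1
    linarith
  have hP1 : P ≤ 1 := by rw [hPdef]; exact csSup_le hne (denSet_le ℓ)
  obtain ⟨γ, hγ0, hγ1, hγ2⟩ : ∃ γ : ℝ, 0 < γ ∧ γ ≤ e / 2 ∧ γ ≤ (P - (2 * √3 - 3)) / 2 :=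
    ⟨min (e / 2) ((P - (2 * √3 - 3)) / 2), lt_min (by linarith) (by linarith), min_le_left _ _,
      min_le_right _ _⟩
  obtain ⟨r, hr, hrγ⟩ := exists_lt_of_lt_csSup hne (show P - γ < sSup (denSet ℓ) by
    rw [← hPdef]; linarith)
  obtain ⟨V0, _, _, T0, hs0, hn0, rfl⟩ := hr
  obtain ⟨t, ht⟩ := exists_nat_gt (6 / e)
  have ht0' : (0:ℝ) < t := lt_trans (by positivity) ht
  have ht0 : 0 < t := by exact_mod_cast ht0'
  have : Nonempty (Fin t) := ⟨⟨0, ht0⟩⟩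
  let V := V0 × Fin t
  have hcard : 6 / e ≤ (Fintype.card V : ℝ) := by
    have h1 : 1 ≤ Fintype.card V0 := Fintype.card_pos
    have h2 : (1:ℝ) ≤ Fintype.card V0 := by exact_mod_cast h1
    have : (Fintype.card V : ℝ) = Fintype.card V0 * t := by simp [V]
    rw [this]; nlinarith
  have hc0 : (0:ℝ) < Fintype.card V := lt_of_lt_of_le (by positivity) hcard
  let T1 : V → V → V → Prop := fun x y z => T0 x.1 y.1 z.1
  have hT1d : dens T1 = dens T0 := by
    unfold dens
    refine Eq.trans (Ex_congr fun x => ?_)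
      (Ex_prod_fst t ht0 (fun x => Ex fun y => Ex fun z => ind (T0 x y z)))
    refine Eq.trans (Ex_congr fun y => ?_)
      (Ex_prod_fst t ht0 (fun y => Ex fun z => ind (T0 x.1 y z)))
    exact Ex_prod_fst t ht0 (fun z => ind (T0 x.1 y.1 z))
  let S := {T : V → V → V → Prop // SymT T ∧ ∀ p, ¬ R T ℓ p p}
  have hfin : Finite S := inferInstance
  have hS : Nonempty S := ⟨⟨T1, hs0.pull _, fun p hp => hn0 _ (R_pull _ hp)⟩⟩
  obtain ⟨⟨T, hT, hno⟩, hmax⟩ := Finite.exists_max (fun A : S => dens A.1)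
  have hTP : P - γ < dens T := by
    have := hmax ⟨T1, hs0.pull _, fun p hp => hn0 _ (R_pull _ hp)⟩
    simp only at this
    rw [hT1d] at this; linarith
  have hdeg : ∀ x, P - e ≤ Ex fun y => Ex fun z => ind (T x y z) := by
    intro x
    obtain ⟨y, hy⟩ := Ex_exists_ge (fun x => Ex fun y => Ex fun z => ind (T x y z))
    obtain ⟨φ, hφ⟩ := clone_ineq hT x y
    have := hmax ⟨_, hT.pull φ, fun p hp => hno _ (R_pull _ hp)⟩
    simp only at this
    have h4 := le_trans hφ this
    have h5 : 3 / (Fintype.card V : ℝ) * ((Ex fun b => Ex fun c => ind (T y b c)) -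
      (Ex fun b => Ex fun c => ind (T x b c)) - 3 / Fintype.card V) ≤ 0 := by linarith
    have h6 : (0:ℝ) < 3 / (Fintype.card V : ℝ) := by positivity
    have h7 := nonpos_of_mul_nonpos_right h5 h6
    have h8 : 3 / (Fintype.card V : ℝ) ≤ e / 2 := by
      rw [div_le_iff₀ hc0]
      rw [div_le_iff₀ he0] at hcard
      linarith
    have h9 : dens T ≤ Ex fun b => Ex fun c => ind (T y b c) := hy
    linarith
  have hA : ∀ A : V → Prop, (Ex fun x => Ex fun y => Ex fun z =>
      ind (A x) * ind (A y) * ind (A z) * ind (T x y z)) ≤ P * (Ex fun x => ind (A x)) ^ 3 := by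
    intro A
    obtain ⟨α, hα⟩ : ∃ α, α = Ex fun x => ind (A x) := ⟨_, rfl⟩
    have hα0 : 0 ≤ α := by rw [hα]; exact Ex_nonneg fun _ => ind_nonneg _
    have h1 : (Ex fun x => Ex fun y => Ex fun z =>
      ind (A x) * ind (A y) * ind (A z) * ind (T x y z)) =
        α ^ 3 * dens (fun x y z : {x // A x} => T x.1 y.1 z.1) := by
      have : ∀ x y z, ind (A x) * ind (A y) * ind (A z) * ind (T x y z) =
        ind (A x) * (ind (A y) * (ind (A z) * ind (T x y z))) := fun x y z => by ring
      simp only [this, Ex_mul_left, Ex_sub_type A, ← hα]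
      unfold dens; ring
    rw [h1, ← hα]
    by_cases hne : Nonempty {x // A x}
    · have := hle {x // A x} (fun x y z => T x.1 y.1 z.1) (hT.pull _)
        (fun p hp => hno _ (R_pull _ hp))
      rw [mul_comm]
      gcongr
    · have : α = 0 := by
        rw [hα]
        have : ∀ x, ind (A x) = 0 := fun x => ind_false fun h => hne ⟨x, h⟩
        simp [this, Ex]
      rw [this]; simp
  have hNC : NoClosed T (3 * (7 * J) + 61) := noClosed_of hT h3 hL hno
  obtain ⟨T', hT', hsub, hcl, hdd⟩ := exists_clean hT (show 0 ≤ e / 3 by positivity)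
  have hNC' : NoClosed T' (3 * (7 * J) + 61) := fun m hm h p hp => hNC m hm h p (R_mono hsub hp)
  obtain ⟨d, hd, hdc⟩ := exists_color hT' (K := 7 * J) (by omega) hNC'
    (fun p q m h => ball_bound hT' (by positivity) hcl hJ h)
  obtain ⟨A, B, b1, b2, b3, b4⟩ := pass1 hT' hsub hlt.le hP1 he hA hdeg (by linarith) d hd hdc
  obtain ⟨α, a1, a2, a3⟩ := pass2 hT (fun m hm => hNC m (by omega)) hlt.le he hA hdeg b1 b2 b3 b4
  have hk := key_poly α
  have hk2 : 0 ≤ (1 - α) * (2 * √3 / 3) * (α - (√3 - 1) / 2) ^ 2 := by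
    have : 0 ≤ 1 - α := by linarith
    positivity
  have hα3 : α ^ 3 ≤ 1 / 8 := by
    calc α ^ 3 ≤ 0.5 ^ 3 := by gcongr
      _ = 1 / 8 := by norm_num
  nlinarith [mul_nonneg (sub_nonneg.2 hlt.le) (sub_nonneg.2 hα3)]

end TightCycle
namespace TightCycle

theorem Ex_pair {V W : Type} [Fintype V] [Fintype W] (f : V → W → ℝ) :
    (Ex fun p : V × W => f p.1 p.2) = Ex fun v => Ex fun w => f v w := by
  unfold Ex
  rw [Fintype.sum_prod_type, Fintype.card_prod, ← Finset.sum_div, div_div]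
  push_cast
  rw [mul_comm]

section Upd
variable {V : Type} [Fintype V] [Nonempty V] {I : Type} [Fintype I] [DecidableEq I]

/-- the involution exchanging a coordinate -/
def swapEquiv (j : I) : ((I → V) × V) ≃ ((I → V) × V) where
  toFun p := (Function.update p.1 j p.2, p.1 j)
  invFun p := (Function.update p.1 j p.2, p.1 j)
  left_inv p := by simp
  right_inv p := by simp

theorem Ex_upd (j : I) (F : (I → V) → ℝ) :
    Ex F = Ex fun v : I → V => Ex fun w : V => F (Function.update v j w) := by
  have h1 : Ex F = Ex fun p : (I → V) × V => F p.1 := by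
    rw [Ex_pair (fun v _ => F v)]
    exact Ex_congr fun v => (Ex_const (F v)).symm
  rw [h1, ← Ex_equiv (swapEquiv j) (fun p => F p.1)]
  exact Ex_pair (fun v w => F (Function.update v j w))

theorem Ex_three (i j k : I) (hij : i ≠ j) (hjk : j ≠ k) (hik : i ≠ k) (g : V → V → V → ℝ) :
    (Ex fun v : I → V => g (v i) (v j) (v k)) = Ex fun x => Ex fun y => Ex fun z => g x y z := by
  rw [Ex_upd k]
  simp only [Function.update_self, Function.update_of_ne hik, Function.update_of_ne hjk]
  rw [Ex_upd j]
  simp only [Function.update_self, Function.update_of_ne hij]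
  rw [Ex_upd i]
  simp only [Function.update_self]
  rw [Ex_const]

theorem Ex_sq_le {W : Type} [Fintype W] [Nonempty W] (m : W → ℝ) :
    (Ex m) ^ 2 ≤ Ex fun v => m v * m v := by
  have h : 0 ≤ Ex fun v => (m v - Ex m) * (m v - Ex m) := Ex_nonneg fun v => mul_self_nonneg _
  have e : (Ex fun v => (m v - Ex m) * (m v - Ex m)) =
      (Ex fun v => m v * m v) - 2 * Ex m * Ex m + Ex m * Ex m := by
    have : ∀ v, (m v - Ex m) * (m v - Ex m) = m v * m v - 2 * Ex m * m v + Ex m * Ex m :=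
      fun v => by ring
    rw [Ex_congr this, Ex_add, Ex_sub, Ex_mul_left, Ex_const]
  rw [e] at h
  nlinarith

theorem Ex_upd_sq (j : I) (W : (I → V) → ℝ) :
    (Ex W) ^ 2 ≤ Ex fun v : I → V => Ex fun w : V => W v * W (Function.update v j w) := by
  obtain ⟨m, hm⟩ : ∃ m : (I → V) → ℝ, ∀ v, m v = Ex fun w => W (Function.update v j w) :=
    ⟨_, fun _ => rfl⟩
  have hmu : ∀ v w, m (Function.update v j w) = m v := by
    intro v w; rw [hm, hm]; simp
  have h1 : Ex m = Ex W := by rw [Ex_upd j W]; exact Ex_congr hm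
  have h2 : (Ex fun v : I → V => Ex fun w : V => W v * W (Function.update v j w)) =
      Ex fun v => m v * m v := by
    have : ∀ v, (Ex fun w : V => W v * W (Function.update v j w)) = W v * m v := by
      intro v; rw [Ex_mul_left, hm]
    rw [Ex_congr this, Ex_upd j]
    refine Ex_congr fun v => ?_
    simp only [hmu]
    rw [Ex_mul_right, ← hm]
  rw [h2, ← h1]
  exact Ex_sq_le m

theorem Ex_option (F : (Option I → V) → ℝ) :
    Ex F = Ex fun v : I → V => Ex fun w : V => F (fun o => o.elim w v) := by
  rw [← Ex_pair (fun v w => F (fun o => o.elim w v))]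
  rw [← Ex_equiv ((Equiv.piOptionEquivProd (β := fun _ : Option I => V)).trans
    (Equiv.prodComm _ _)) (fun p => F (fun o => o.elim p.2 p.1))]
  refine Ex_congr fun u => ?_
  congr 1
  funext o
  cases o <;> rfl

end Upd

theorem blowup {Z : Type} [Fintype Z] [DecidableEq Z] (s1 s2 : Z → Z) (k : ℕ) :
    ∀ (I : Type) [Fintype I] [DecidableEq I] (φ : Z → I) (κ : ℝ), 0 < κ →
      (Finset.univ.filter fun p : Z × Z => φ p.1 = φ p.2).card ≤ k →
      ∃ n₀ : ℕ, ∀ (V : Type) [Fintype V] [Nonempty V] (T : V → V → V → Prop),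
        n₀ ≤ Fintype.card V → (∀ x y z, T x y z → x ≠ y ∧ y ≠ z ∧ x ≠ z) →
        (κ ≤ Ex fun v : I → V => ind (∀ i, T (v (φ i)) (v (φ (s1 i))) (v (φ (s2 i))))) →
        ∃ c : Z → V, Function.Injective c ∧ ∀ i, T (c i) (c (s1 i)) (c (s2 i)) := by
  classical
  induction k with
  | zero =>
    intro I _ _ φ κ hκ hk
    have he : IsEmpty Z := ⟨fun z => by
      have : (z, z) ∈ (Finset.univ.filter fun p : Z × Z => φ p.1 = φ p.2) := by simp
      rw [Finset.card_eq_zero.mp (Nat.le_zero.mp hk)] at this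
      simp at this⟩
    exact ⟨0, fun V _ _ T _ _ _ => ⟨fun z => he.elim z, fun z => he.elim z, fun z => he.elim z⟩⟩
  | succ k ih =>
    intro I _ _ φ κ hκ hk
    by_cases hφ : Function.Injective φ
    · obtain ⟨n₀, hn⟩ := exists_nat_gt (((Fintype.card I : ℝ) * Fintype.card I) / κ)
      refine ⟨n₀, fun V _ _ T hV hirr hW => ?_⟩
      by_contra hcon
      have hc0 : (0:ℝ) < Fintype.card V := by exact_mod_cast Fintype.card_pos
      have h1 : ∀ v : I → V, ind (∀ i, T (v (φ i)) (v (φ (s1 i))) (v (φ (s2 i)))) ≤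
          ∑ i, ∑ j, ind (i ≠ j ∧ v i = v j) := by
        intro v
        by_cases hh : ∀ i, T (v (φ i)) (v (φ (s1 i))) (v (φ (s2 i)))
        · have hni : ¬ Function.Injective v := fun hv =>
            hcon ⟨fun z => v (φ z), hv.comp hφ, hh⟩
          rw [Function.Injective] at hni
          push Not at hni
          obtain ⟨a, b, hab, hne⟩ := hni
          calc ind _ ≤ 1 := ind_le_one _
            _ = ind (a ≠ b ∧ v a = v b) := (ind_true ⟨hne, hab⟩).symm
            _ ≤ ∑ j, ind (a ≠ j ∧ v a = v j) := Finset.single_le_sum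
                (f := fun j => ind (a ≠ j ∧ v a = v j)) (fun _ _ => ind_nonneg _)
                (Finset.mem_univ b)
            _ ≤ _ := Finset.single_le_sum
                (f := fun i => ∑ j, ind (i ≠ j ∧ v i = v j))
                (fun _ _ => Finset.sum_nonneg fun _ _ => ind_nonneg _) (Finset.mem_univ a)
        · rw [ind_false hh]
          exact Finset.sum_nonneg fun _ _ => Finset.sum_nonneg fun _ _ => ind_nonneg _
      have h2 : ∀ i j : I, (Ex fun v : I → V => ind (i ≠ j ∧ v i = v j)) ≤ 1 / Fintype.card V := by
        intro i j
        by_cases hij : i = j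
        · have : ∀ v : I → V, ind (i ≠ j ∧ v i = v j) = 0 := fun v => ind_false (by simp [hij])
          rw [Ex_congr this, Ex_const]; positivity
        · rw [Ex_upd j]
          simp only [Function.update_self, Function.update_of_ne hij]
          have : ∀ v : I → V, (Ex fun w => ind (i ≠ j ∧ v i = w)) = 1 / Fintype.card V := by
            intro v
            rw [← Ex_eq_point (v i) (fun _ => (1:ℝ))]
            refine Ex_congr fun w => ?_
            rw [mul_one]
            exact ind_congr ⟨fun h => h.2.symm, fun h => ⟨hij, h.symm⟩⟩
          rw [Ex_congr this, Ex_const]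
      have hsumEx : ∀ {J : Type} [Fintype J] (f : J → (I → V) → ℝ),
          (Ex fun v => ∑ i, f i v) = ∑ i, Ex (f i) := by
        intro J _ f
        unfold Ex
        rw [Finset.sum_comm, Finset.sum_div]
      have h3 := hW.trans (Ex_mono h1)
      rw [hsumEx] at h3
      have h4 : κ ≤ ∑ i : I, ∑ j : I, 1 / (Fintype.card V : ℝ) := by
        refine h3.trans (Finset.sum_le_sum fun i _ => ?_)
        rw [hsumEx]
        exact Finset.sum_le_sum fun j _ => h2 i j
      simp only [Finset.sum_const, Finset.card_univ, nsmul_eq_mul] at h4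
      rw [div_lt_iff₀ hκ] at hn
      have hV' : (n₀ : ℝ) ≤ Fintype.card V := by exact_mod_cast hV
      have h5 : κ * Fintype.card V ≤ (Fintype.card I : ℝ) * Fintype.card I := by
        have := mul_le_mul_of_nonneg_right h4 hc0.le
        refine this.trans (le_of_eq ?_)
        field_simp
      nlinarith
    · rw [Function.Injective] at hφ
      push Not at hφ
      obtain ⟨a, b, hab, hne⟩ := hφ
      obtain ⟨ψ, hψ⟩ : ∃ ψ : Z → Option I, ∀ z, ψ z = if z = a then none else some (φ z) :=
        ⟨_, fun _ => rfl⟩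
      have hcard : (Finset.univ.filter fun p : Z × Z => ψ p.1 = ψ p.2).card ≤ k := by
        refine Nat.le_of_lt_succ (lt_of_lt_of_le (Finset.card_lt_card ?_) hk)
        rw [Finset.ssubset_iff_of_subset]
        · refine ⟨(a, b), by simp [hab], ?_⟩
          simp [hψ, hne.symm]
        · intro ⟨x, y⟩
          simp only [Finset.mem_filter, Finset.mem_univ, true_and, hψ]
          by_cases hx : x = a <;> by_cases hy : y = a <;> simp [hx, hy]
      obtain ⟨n₀, hn⟩ := ih (Option I) ψ (κ ^ 2) (by positivity) hcard
      refine ⟨n₀, fun V _ _ T hV hirr hW => hn V T hV hirr ?_⟩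
      rw [Ex_option]
      have h1 := Ex_upd_sq (φ a)
        (fun v : I → V => ind (∀ i, T (v (φ i)) (v (φ (s1 i))) (v (φ (s2 i)))))
      refine le_trans (pow_le_pow_left₀ hκ.le hW 2) (h1.trans ?_)
      refine Ex_mono fun v => Ex_mono fun w => ?_
      rw [← ind_and]
      refine ind_mono ?_
      rintro ⟨q1, q2⟩ i
      obtain ⟨d1, d2, d3⟩ := hirr _ _ _ (q1 i)
      have n1 : φ i ≠ φ (s1 i) := fun h => d1 (by rw [h])
      have n2 : φ (s1 i) ≠ φ (s2 i) := fun h => d2 (by rw [h])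
      have n3 : φ i ≠ φ (s2 i) := fun h => d3 (by rw [h])
      have ua : (ψ a).elim w v = w := by simp [hψ]
      have un : ∀ z, z ≠ a → (ψ z).elim w v = v (φ z) := fun z hz => by simp [hψ, hz]
      have t2 := q2 i
      beta_reduce
      by_cases c1 : i = a
      · rw [c1] at n1 n3 t2
        have m1 : s1 a ≠ a := fun h => n1 (by rw [h])
        have m2 : s2 a ≠ a := fun h => n3 (by rw [h])
        rw [c1]
        rw [Function.update_self, Function.update_of_ne n1.symm, Function.update_of_ne n3.symm] at t2
        rw [ua, un _ m1, un _ m2]; exact t2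
      · by_cases c2 : s1 i = a
        · rw [c2] at n1 n2 t2
          have m2 : s2 i ≠ a := fun h => n2 (by rw [h])
          rw [c2]
          rw [Function.update_self, Function.update_of_ne n1, Function.update_of_ne n2.symm] at t2
          rw [ua, un _ c1, un _ m2]; exact t2
        · by_cases c3 : s2 i = a
          · rw [c3] at n2 n3 t2
            rw [c3]
            rw [Function.update_self, Function.update_of_ne n2, Function.update_of_ne n3] at t2
            rw [ua, un _ c1, un _ c2]; exact t2
          · rw [un _ c1, un _ c2, un _ c3]; exact q1 i

end TightCycle
namespace TightCycle

theorem sample {V : Type} [Fintype V] [Nonempty V] (N : ℕ) (hN : 0 < N) (T : V → V → V → Prop) :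
    dens T - 3 / N ≤ Ex fun v : Fin N → V => dens (fun i j k => T (v i) (v j) (v k)) := by
  classical
  have : Nonempty (Fin N) := ⟨⟨0, hN⟩⟩
  have hN0 : (0:ℝ) < N := by exact_mod_cast hN
  have hd0 : 0 ≤ dens T := Ex_nonneg fun _ => Ex_nonneg fun _ => Ex_nonneg fun _ => ind_nonneg _
  have hd1 : dens T ≤ 1 := Ex_le_one fun _ => Ex_le_one fun _ => Ex_le_one fun _ => ind_le_one _
  have h1 : (Ex fun v : Fin N → V => dens (fun i j k => T (v i) (v j) (v k))) =
      Ex fun i => Ex fun j => Ex fun k => Ex fun v : Fin N → V => ind (T (v i) (v j) (v k)) := by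
    unfold dens
    rw [Ex_comm]
    refine Ex_congr fun i => ?_
    rw [Ex_comm]
    refine Ex_congr fun j => ?_
    rw [Ex_comm]
  have h2 : ∀ i j k : Fin N, dens T - ind (j = i) - ind (k = j) - ind (k = i) ≤
      Ex fun v : Fin N → V => ind (T (v i) (v j) (v k)) := by
    intro i j k
    have hnn : 0 ≤ Ex fun v : Fin N → V => ind (T (v i) (v j) (v k)) :=
      Ex_nonneg fun _ => ind_nonneg _
    have p1 := ind_nonneg (j = i)
    have p2 := ind_nonneg (k = j)
    have p3 := ind_nonneg (k = i)
    by_cases c1 : j = i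
    · rw [ind_true c1]; linarith
    by_cases c2 : k = j
    · rw [ind_true c2]; linarith
    by_cases c3 : k = i
    · rw [ind_true c3]; linarith
    rw [Ex_three i j k (Ne.symm c1) (Ne.symm c2) (Ne.symm c3) (fun x y z => ind (T x y z))]
    have : dens T = Ex fun x => Ex fun y => Ex fun z => ind (T x y z) := rfl
    linarith
  have h3 : ∀ i : Fin N, (Ex fun j => ind (j = i)) = 1 / N := by
    intro i
    have := Ex_eq_point i (fun _ => (1:ℝ))
    simpa using this
  rw [h1]
  refine le_trans (le_of_eq ?_) (Ex_mono fun i => Ex_mono fun j => Ex_mono fun k => h2 i j k)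
  simp only [Ex_sub, Ex_const, h3]
  ring

theorem supersat {c ε : ℝ} (hc : 0 ≤ c) (hε : 0 < ε) {ℓ : ℕ} (hℓ : 3 ≤ ℓ)
    (hex : ∀ (V : Type) [Fintype V] [Nonempty V]
    (T : V → V → V → Prop), SymT T → (∀ p, ¬ R T ℓ p p) → dens T ≤ c) :
    ∃ n₀ : ℕ, ∀ (V : Type) [Fintype V] [Nonempty V] (T : V → V → V → Prop),
        n₀ ≤ Fintype.card V → SymT T → (∀ x y z, T x y z → x ≠ y ∧ y ≠ z ∧ x ≠ z) →
        c + ε ≤ dens T →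
        ∃ f : ZMod ℓ → V, Function.Injective f ∧ ∀ i, T (f i) (f (i + 1)) (f (i + 2)) := by
  classical
  have : NeZero ℓ := ⟨by omega⟩
  obtain ⟨N, hN⟩ := exists_nat_gt (6 / ε)
  have hN0' : (0:ℝ) < N := lt_trans (by positivity) hN
  have hN0 : 0 < N := by exact_mod_cast hN0'
  have hFN : Nonempty (Fin N) := ⟨⟨0, hN0⟩⟩
  have h3N : 3 / (N:ℝ) ≤ ε / 2 := by
    rw [div_lt_iff₀ hε] at hN
    rw [div_le_iff₀ hN0']; linarith
  obtain ⟨K, hK⟩ : ∃ K : ℝ, K = Fintype.card (ZMod ℓ → Fin N) := ⟨_, rfl⟩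
  have hK0 : 0 < K := by rw [hK]; exact_mod_cast Fintype.card_pos
  have hb := fun φ : ZMod ℓ → Fin N => blowup (fun i : ZMod ℓ => i + 1) (fun i => i + 2) _
    (Fin N) φ (ε / 2 / K) (by positivity) le_rfl
  choose n₀ hn₀ using hb
  refine ⟨Finset.univ.sup n₀, fun V _ _ T hV hT hirr hd => ?_⟩
  have h1 : ∀ v : Fin N → V, dens (fun i j k => T (v i) (v j) (v k)) - c ≤
      K * Ex fun φ : ZMod ℓ → Fin N => ind (∀ i, T (v (φ i)) (v (φ (i + 1))) (v (φ (i + 2)))) := by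
    intro v
    have hKE : ∀ f : (ZMod ℓ → Fin N) → ℝ, K * Ex f = ∑ φ, f φ := by
      intro f
      unfold Ex
      rw [← hK]; field_simp
    rw [hKE]
    by_cases hp : ∀ p, ¬ R (fun i j k => T (v i) (v j) (v k)) ℓ p p
    · have := hex (Fin N) (fun i j k => T (v i) (v j) (v k)) (hT.pull v) hp
      have h0 : 0 ≤ ∑ φ : ZMod ℓ → Fin N, ind (∀ i, T (v (φ i)) (v (φ (i + 1))) (v (φ (i + 2)))) :=
        Finset.sum_nonneg fun _ _ => ind_nonneg _
      linarith
    · push Not at hp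
      obtain ⟨p, hp⟩ := hp
      obtain ⟨φ, hφ⟩ := closed_to_cycle hℓ hp
      have h0 : dens (fun i j k => T (v i) (v j) (v k)) ≤ 1 :=
        Ex_le_one fun _ => Ex_le_one fun _ => Ex_le_one fun _ => ind_le_one _
      have := Finset.single_le_sum
        (f := fun φ : ZMod ℓ → Fin N => ind (∀ i, T (v (φ i)) (v (φ (i + 1))) (v (φ (i + 2)))))
        (fun _ _ => ind_nonneg _) (Finset.mem_univ φ)
      simp only [ind_true hφ] at this
      linarith
  have h2 := Ex_mono h1
  rw [Ex_sub, Ex_const, Ex_mul_left, Ex_comm] at h2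
  have h3 := sample N hN0 T
  obtain ⟨φ, hφ⟩ := Ex_exists_ge (fun φ : ZMod ℓ → Fin N => Ex fun v : Fin N → V =>
    ind (∀ i, T (v (φ i)) (v (φ (i + 1))) (v (φ (i + 2)))))
  refine hn₀ φ V T ((Finset.le_sup (Finset.mem_univ φ)).trans hV) hirr (le_trans ?_ hφ)
  rw [div_le_iff₀ hK0, mul_comm]
  linarith

theorem dens_ge {n : ℕ} (hn : 0 < n) (H : Finset (Finset (Fin n))) (hH : ∀ e ∈ H, e.card = 3) :
    6 * (H.card : ℝ) / (n:ℝ) ^ 3 ≤ dens (fun x y z : Fin n => ({x, y, z} : Finset (Fin n)) ∈ H) := by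
  classical
  have hn0 : (0:ℝ) < n := by exact_mod_cast hn
  obtain ⟨S, hS⟩ : ∃ S : Finset (Fin n × Fin n × Fin n),
    S = Finset.univ.filter fun p => ({p.1, p.2.1, p.2.2} : Finset (Fin n)) ∈ H := ⟨_, rfl⟩
  have h1 : dens (fun x y z : Fin n => ({x, y, z} : Finset (Fin n)) ∈ H) = S.card / (n:ℝ) ^ 3 := by
    unfold dens
    simp only [← Ex_pair (fun y z => ind (({_, y, z} : Finset (Fin n)) ∈ H))]
    rw [← Ex_pair (fun x (p : Fin n × Fin n) => ind (({x, p.1, p.2} : Finset (Fin n)) ∈ H))]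
    unfold Ex
    have h0 : (∑ p : Fin n × Fin n × Fin n, ind (({p.1, p.2.1, p.2.2} : Finset (Fin n)) ∈ H)) =
        (S.card : ℝ) := by
      rw [hS, Finset.card_filter]
      push_cast
      refine Finset.sum_congr rfl fun p _ => ?_
      by_cases hp : ({p.1, p.2.1, p.2.2} : Finset (Fin n)) ∈ H
      · rw [ind_true hp, if_pos hp]
      · rw [ind_false hp, if_neg hp]
    rw [h0]
    simp only [Fintype.card_prod, Fintype.card_fin]
    push_cast
    congr 1; ring
  have h2 : H.card * 6 ≤ S.card := by
    rw [Finset.card_eq_sum_card_fiberwise (s := S) (t := H)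
      (f := fun p => ({p.1, p.2.1, p.2.2} : Finset (Fin n)))
      (fun p hp => by
        have hp' : p ∈ S := hp
        rw [hS] at hp'
        exact (Finset.mem_filter.mp hp').2)]
    rw [← smul_eq_mul]
    refine Finset.card_nsmul_le_sum _ _ _ fun e he => ?_
    obtain ⟨a, b, c, hab, hac, hbc, rfl⟩ := Finset.card_eq_three.mp (hH e he)
    have hsub : ({(a, b, c), (a, c, b), (b, a, c), (b, c, a), (c, a, b), (c, b, a)} :
        Finset (Fin n × Fin n × Fin n)) ⊆
        S.filter fun p => ({p.1, p.2.1, p.2.2} : Finset (Fin n)) = {a, b, c} := by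
      intro p hp
      have hpe : ({p.1, p.2.1, p.2.2} : Finset (Fin n)) = {a, b, c} := by
        simp only [Finset.mem_insert, Finset.mem_singleton] at hp
        rcases hp with rfl | rfl | rfl | rfl | rfl | rfl <;>
          (ext x; simp only [Finset.mem_insert, Finset.mem_singleton]; try tauto)
      rw [Finset.mem_filter, hS, Finset.mem_filter]
      exact ⟨⟨Finset.mem_univ _, by rw [hpe]; exact he⟩, hpe⟩
    refine le_trans (le_of_eq ?_) (Finset.card_le_card hsub)
    symm
    simp [Finset.card_insert_of_notMem, hab, hac, hbc, hab.symm, hac.symm, hbc.symm]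
  rw [h1]
  gcongr
  have : ((H.card * 6 : ℕ) : ℝ) ≤ S.card := by exact_mod_cast h2
  push_cast at this
  linarith

theorem choose3 (n : ℕ) : 6 * ((n.choose 3 : ℕ) : ℝ) = n * (n - 1) * (n - 2) := by
  induction n with
  | zero => simp
  | succ n ih =>
    rw [Nat.choose_succ_succ, Nat.cast_add, mul_add, ih, Nat.cast_choose_two]
    push_cast; ring

end TightCycle

/-- There exists `L` such that for every `ℓ ≥ L` not divisible by `3` and every `ε > 0`,
every sufficiently large 3-uniform hypergraph on `n` vertices with at least
`(2√3 − 3 + ε)·(n choose 3)` edges contains a copy of the tight cycle `C_ℓ³`. -/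
theorem turan_density_tight_cycle_upper :
    ∃ L : ℕ, ∀ ℓ : ℕ, L ≤ ℓ → ¬ (3 ∣ ℓ) → ∀ ε : ℝ, 0 < ε →
      ∃ n₀ : ℕ, ∀ n : ℕ, n₀ ≤ n → ∀ H : Finset (Finset (Fin n)),
        (∀ e ∈ H, e.card = 3) →
        (H.card : ℝ) ≥ (2 * Real.sqrt 3 - 3 + ε) * (n.choose 3) →
        HasTightCycleCopy H ℓ := by
  obtain ⟨L, hL⟩ := TightCycle.extremal
  refine ⟨max L 3, fun ℓ hℓ h3 ε hε => ?_⟩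
  have hc : (0:ℝ) ≤ 2 * √3 - 3 := by
    have := TightCycle.sqrt3_bounds.1
    linarith
  obtain ⟨c, hcd⟩ : ∃ c : ℝ, c = 2 * √3 - 3 := ⟨_, rfl⟩
  rw [← hcd] at hc ⊢
  obtain ⟨n₁, h1⟩ := TightCycle.supersat (c := c) (ε := ε / 2) hc (by positivity)
    (le_trans (le_max_right _ _) hℓ) (fun V _ _ T a b => by
      rw [hcd]; exact hL ℓ (le_trans (le_max_left _ _) hℓ) h3 V T a b)
  obtain ⟨n₂, h2⟩ := exists_nat_gt (6 * (c + ε) / ε)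
  refine ⟨max n₁ (n₂ + 1), fun n hn H hH hcard => ?_⟩
  have hn1 : n₁ ≤ n := le_trans (le_max_left _ _) hn
  have hn2 : n₂ + 1 ≤ n := le_trans (le_max_right _ _) hn
  have hn0 : 0 < n := by omega
  have hn0' : (0:ℝ) < n := by exact_mod_cast hn0
  have hne : Nonempty (Fin n) := ⟨⟨0, hn0⟩⟩
  have hd := TightCycle.dens_ge hn0 H hH
  have hdens : c + ε / 2 ≤ 6 * (H.card : ℝ) / (n:ℝ) ^ 3 := by
    rw [le_div_iff₀ (by positivity)]
    have h6 := TightCycle.choose3 n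
    have hn2' : (n₂ : ℝ) ≤ n := by exact_mod_cast (by omega : n₂ ≤ n)
    rw [div_lt_iff₀ hε] at h2
    have h7 : 6 * (c + ε) ≤ n * ε := by nlinarith
    have h8 : (c + ε) * (n * (n - 1) * (n - 2)) ≤ 6 * (H.card : ℝ) := by
      rw [← h6]; linarith
    refine le_trans ?_ h8
    have h9 : 0 ≤ (n:ℝ) ^ 2 * (n * ε - 6 * (c + ε)) := mul_nonneg (by positivity) (by linarith)
    have h10 : 0 ≤ (c + ε) * n := by positivity
    nlinarith
  obtain ⟨f, hf, hf2⟩ := h1 (Fin n) (fun x y z => ({x, y, z} : Finset (Fin n)) ∈ H)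
    (by rw [Fintype.card_fin]; exact hn1)
    ⟨fun {x y z} t => by
        have : ({y, z, x} : Finset (Fin n)) = {x, y, z} := by
          ext a; simp only [Finset.mem_insert, Finset.mem_singleton]; tauto
        rw [this]; exact t,
      fun {x y z} t => by
        have : ({y, x, z} : Finset (Fin n)) = {x, y, z} := by
          ext a; simp only [Finset.mem_insert, Finset.mem_singleton]; tauto
        rw [this]; exact t⟩
    (fun x y z t => by
      have h := hH _ t
      refine ⟨?_, ?_, ?_⟩
      · rintro rfl
        have : ({x, x, z} : Finset (Fin n)).card ≤ 2 := by
          rw [Finset.insert_eq_of_mem (by simp)]; exact Finset.card_le_two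
        omega
      · rintro rfl
        have : ({x, y, y} : Finset (Fin n)).card ≤ 2 := by
          rw [Finset.pair_eq_singleton]; exact Finset.card_le_two
        omega
      · rintro rfl
        have : ({x, y, x} : Finset (Fin n)).card ≤ 2 := by
          rw [Finset.insert_eq_of_mem (by simp)]; exact Finset.card_le_two
        omega)
    (hdens.trans hd)
  exact ⟨f, hf, hf2⟩
end

section
/- For every ε > 0 there exists n₀ such that for every n ≥ n₀ there exists a 3-uniform hypergraph H on n vertices with e(H) ≥ (2√3 − 3 − ε)·(n choose 3) that contains no pseudocycle of length ℓ for any ℓ ≥ 3 with ℓ not divisible by 3; in particular, H contains no copy of the tight cycle C_ℓ³ for any ℓ ≥ 4 with ℓ not divisible by 3. -/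
/-- `H` has a pseudocycle of length `ℓ`: a sequence of vertices indexed by `ZMod ℓ`
such that every three cyclically consecutive vertices form an edge of `H`. -/
def HasPseudocycle {V : Type} [DecidableEq V] (H : Finset (Finset V)) (ℓ : ℕ) : Prop :=
  ∃ v : ZMod ℓ → V, ∀ i : ZMod ℓ, ({v i, v (i + 1), v (i + 2)} : Finset V) ∈ H
/-- `e` consists of two vertices of the same level and one vertex of a higher level. -/
def LevelEdge {V : Type} [DecidableEq V] (f : V → ℕ) (e : Finset V) : Prop :=
  ∃ x y z, e = {x, y, z} ∧ x ≠ y ∧ f x = f y ∧ f x < f z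

lemma LevelEdge.card {V : Type} [DecidableEq V] {f : V → ℕ} {e : Finset V}
    (h : LevelEdge f e) : e.card = 3 := by
  obtain ⟨x, y, z, rfl, hxy, h1, h2⟩ := h
  rw [Finset.card_eq_three]
  refine ⟨x, y, z, hxy, ?_, ?_, rfl⟩
  · rintro rfl; omega
  · rintro rfl; omega

lemma LevelEdge.cases {V : Type} [DecidableEq V] {f : V → ℕ} {p q r : V}
    (h : LevelEdge f {p, q, r}) :
    (f p = f q ∧ f p < f r) ∨ (f p = f r ∧ f p < f q) ∨ (f q = f r ∧ f q < f p) := by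
  obtain ⟨x, y, z, he, hxy, h1, h2⟩ := h
  have hx : x ∈ ({p, q, r} : Finset V) := by rw [he]; simp
  have hy : y ∈ ({p, q, r} : Finset V) := by rw [he]; simp
  have hz : z ∈ ({p, q, r} : Finset V) := by rw [he]; simp
  simp only [Finset.mem_insert, Finset.mem_singleton] at hx hy hz
  rcases hx with rfl | rfl | rfl <;> rcases hy with rfl | rfl | rfl <;>
    rcases hz with rfl | rfl | rfl <;> first | omega | exact absurd rfl hxy

lemma no_pattern (ℓ : ℕ) (h3 : ¬ 3 ∣ ℓ) (g : ZMod ℓ → ℕ)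
    (T : ∀ i, (g i = g (i+1) ∧ g i < g (i+2)) ∨ (g i = g (i+2) ∧ g i < g (i+1)) ∨
      (g (i+1) = g (i+2) ∧ g (i+1) < g i)) : False := by
  have T1 : ∀ i, (g (i+1) = g (i+2) ∧ g (i+1) < g (i+3)) ∨ (g (i+1) = g (i+3) ∧ g (i+1) < g (i+2)) ∨
      (g (i+2) = g (i+3) ∧ g (i+2) < g (i+1)) := by
    intro i
    have := T (i+1)
    rw [show i + 1 + 1 = i + 2 by ring, show i + 1 + 2 = i + 3 by ring] at this
    exact this
  have T2 : ∀ i, (g (i+2) = g (i+3) ∧ g (i+2) < g (i+4)) ∨ (g (i+2) = g (i+4) ∧ g (i+2) < g (i+3)) ∨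
      (g (i+3) = g (i+4) ∧ g (i+3) < g (i+2)) := by
    intro i
    have := T (i+2)
    rw [show i + 2 + 1 = i + 3 by ring, show i + 2 + 2 = i + 4 by ring] at this
    exact this
  have step : ∀ i, g (i+1) < g i → g (i+3+1) < g (i+3) := by
    intro i hi
    rw [show i + 3 + 1 = i + 4 by ring]
    have := T i
    have := T1 i
    have := T2 i
    omega
  have steps : ∀ (k : ℕ) (i), g (i+1) < g i → g (i+3*k+1) < g (i+3*k) := by
    intro k
    induction k with
    | zero => intro i hi; simpa using hi
    | succ k ih =>
      intro i hi
      have := step _ (ih i hi)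
      rw [show i + 3 * (k:ZMod ℓ) + 3 = i + 3 * ((k+1 : ℕ) : ZMod ℓ) by push_cast; ring] at this
      exact this
  have hk : ∃ k : ℕ, (3 * k : ZMod ℓ) = 1 := by
    have hℓ : ℓ ≠ 0 := by rintro rfl; simp at h3
    have : NeZero ℓ := ⟨hℓ⟩
    have hc : Nat.Coprime 3 ℓ := (Nat.Prime.coprime_iff_not_dvd Nat.prime_three).2 h3
    refine ⟨((3 : ZMod ℓ)⁻¹).val, ?_⟩
    rw [ZMod.natCast_zmod_val]
    exact_mod_cast ZMod.coe_mul_inv_eq_one 3 hc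
  obtain ⟨k, hk⟩ := hk
  have key : ∀ i, ¬ g (i+1) < g i := by
    intro i hi
    have := steps k i hi
    rw [hk, show i + 1 + 1 = i + 2 by ring] at this
    have := T i
    omega
  have a0 := key 0
  have a1 := key (0+1)
  have a2 := key (0+2)
  rw [show (0:ZMod ℓ) + 1 + 1 = 0 + 2 by ring] at a1
  rw [show (0:ZMod ℓ) + 2 + 1 = 0 + 3 by ring] at a2
  have := T 0
  have := T1 0
  omega

/-- One step of the iterated construction. -/
lemma level_step {V : Type} [DecidableEq V] (A B : Finset V) (hAB : Disjoint A B)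
    (f : V → ℕ) (H : Finset (Finset V)) (hH : ∀ e ∈ H, e ⊆ B ∧ LevelEdge f e) :
    ∃ (f' : V → ℕ) (H' : Finset (Finset V)), (∀ e ∈ H', e ⊆ A ∪ B ∧ LevelEdge f' e) ∧
      H'.card = A.card.choose 2 * B.card + H.card := by
  have hd : ∀ x ∈ A, x ∉ B := fun x hx hx' => Finset.disjoint_left.1 hAB hx hx'
  let E := (A.powersetCard 2 ×ˢ B).image (fun p => insert p.2 p.1)
  have hE : E.card = A.card.choose 2 * B.card := by
    rw [Finset.card_image_of_injOn, Finset.card_product, Finset.card_powersetCard]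
    rintro ⟨p, b⟩ hp ⟨q, c⟩ hq h
    simp only [Finset.coe_product, Set.mem_prod, Finset.mem_coe, Finset.mem_powersetCard] at hp hq
    simp only at h
    have e1 : b = c := by
      have : b ∈ insert c q := by rw [← h]; simp
      rcases Finset.mem_insert.1 this with h | h
      · exact h
      · exact absurd hp.2 (hd _ (hq.1.1 h))
    subst e1
    have e2 : p = q := by
      have hbp : b ∉ p := fun h => hd _ (hp.1.1 h) hp.2
      have hbq : b ∉ q := fun h => hd _ (hq.1.1 h) hp.2
      rw [← Finset.erase_insert hbp, h, Finset.erase_insert hbq]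
    rw [e2]
  have hEA : ∀ e ∈ E, ∃ x y z, e = {x, y, z} ∧ x ≠ y ∧ x ∈ A ∧ y ∈ A ∧ z ∈ B := by
    intro e he
    simp only [E, Finset.mem_image, Finset.mem_product, Finset.mem_powersetCard] at he
    obtain ⟨⟨p, b⟩, ⟨⟨hp, hc⟩, hb⟩, rfl⟩ := he
    obtain ⟨x, y, hxy, rfl⟩ := Finset.card_eq_two.1 hc
    refine ⟨x, y, b, ?_, hxy, hp (by simp), hp (by simp), hb⟩
    ext t
    simp only [Finset.mem_insert, Finset.mem_singleton]
    tauto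
  refine ⟨fun x => if x ∈ A then 0 else f x + 1, E ∪ H, ?_, ?_⟩
  · intro e he
    rcases Finset.mem_union.1 he with he | he
    · obtain ⟨x, y, z, rfl, hxy, hx, hy, hz⟩ := hEA e he
      have hzA : z ∉ A := fun h => hd _ h hz
      refine ⟨?_, x, y, z, rfl, hxy, by simp [hx, hy], by simp [hx, hzA]⟩
      intro t ht
      simp only [Finset.mem_insert, Finset.mem_singleton] at ht
      rcases ht with rfl | rfl | rfl <;> simp [hx, hy, hz]
    · obtain ⟨hs, x, y, z, rfl, hxy, h1, h2⟩ := hH e he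
      have hx : x ∉ A := fun h => hd _ h (hs (by simp))
      have hy : y ∉ A := fun h => hd _ h (hs (by simp))
      have hz : z ∉ A := fun h => hd _ h (hs (by simp))
      exact ⟨hs.trans Finset.subset_union_right, x, y, z, rfl, hxy, by simp [hx, hy, h1],
        by simp [hx, hz, h2]⟩
  · rw [Finset.card_union_of_disjoint, hE]
    rw [Finset.disjoint_left]
    intro e he he'
    obtain ⟨x, y, z, rfl, hxy, hx, hy, hz⟩ := hEA e he
    exact hd x hx ((hH _ he').1 (by simp))

lemma level_exists {V : Type} [DecidableEq V] : ∀ (n : ℕ) (S : Finset V), S.card = n →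
    ∃ (f : V → ℕ) (H : Finset (Finset V)), (∀ e ∈ H, e ⊆ S ∧ LevelEdge f e) ∧
      (2 * Real.sqrt 3 - 3) * (n:ℝ)^3 / 6 - (n:ℝ)^2 ≤ H.card := by
  intro n
  induction n using Nat.strong_induction_on with
  | _ n ih =>
  intro S hS
  have hr : Real.sqrt 3 ^ 2 = 3 := Real.sq_sqrt (by norm_num)
  have hr1 : (1.732:ℝ) < Real.sqrt 3 := Real.lt_sqrt_of_sq_lt (by norm_num)
  have hr2 : Real.sqrt 3 < 1.733 := by
    rw [Real.sqrt_lt' (by norm_num)]; norm_num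
  set r := Real.sqrt 3
  obtain ⟨b, hb⟩ : ∃ b, b = (r - 1) / 2 := ⟨_, rfl⟩
  have hb0 : (0.366:ℝ) ≤ b := by rw [hb]; linarith
  have hb1 : b ≤ 0.3665 := by rw [hb]; linarith
  have hn0 : (0:ℝ) ≤ n := Nat.cast_nonneg n
  by_cases hbn : b * n < 1
  · refine ⟨fun _ => 0, ∅, by simp, ?_⟩
    have : (n:ℝ) < 3 := by nlinarith
    have : (2 * r - 3) * (n:ℝ) ≤ 6 := by nlinarith
    have := mul_le_mul_of_nonneg_right this (sq_nonneg (n:ℝ))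
    simp only [Finset.card_empty, Nat.cast_zero]
    nlinarith
  push Not at hbn
  have hnpos : 0 < n := by
    rcases Nat.eq_zero_or_pos n with rfl | h
    · norm_num at hbn
    · exact h
  have hn1 : (0:ℝ) < n := by exact_mod_cast hnpos
  obtain ⟨m, hm⟩ : ∃ m, m = ⌊b * n⌋₊ := ⟨_, rfl⟩
  have hm1 : (m:ℝ) ≤ b * n := by rw [hm]; exact Nat.floor_le (by positivity)
  have hm2 : b * n - 1 ≤ m := by rw [hm]; exact (Nat.sub_one_lt_floor _).le
  have hmn : m < n := by
    have : (m:ℝ) < n := by nlinarith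
    exact_mod_cast this
  obtain ⟨B, hBS, hBc⟩ := Finset.exists_subset_card_eq (s := S) (n := m) (by omega)
  obtain ⟨f, H, hH, hc⟩ := ih m hmn B hBc
  obtain ⟨f', H', hH', hc'⟩ := level_step (S \ B) B Finset.sdiff_disjoint f H hH
  refine ⟨f', H', ?_, ?_⟩
  · rw [Finset.sdiff_union_of_subset hBS] at hH'
    exact hH'
  rw [hc', Finset.card_sdiff_of_subset hBS, hS, hBc]
  push_cast
  rw [Nat.cast_choose_two, Nat.cast_sub hmn.le]
  have hm0 : (0:ℝ) ≤ m := Nat.cast_nonneg m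
  generalize (n:ℝ) = x at hn0 hbn hn1 hm1 hm2 ⊢
  generalize (m:ℝ) = y at hm0 hm1 hm2 hc ⊢
  have hrb : r = 2 * b + 1 := by rw [hb]; ring
  have hbb : b ^ 2 = 1/2 - b := by rw [hb]; nlinarith
  rw [hrb] at hc ⊢
  -- lower bounds
  have k1 : (b*x)^3 - 3 * (b*x)^2 ≤ y^3 := by
    have : (b*x-1)^3 ≤ y^3 := pow_le_pow_left₀ (by linarith) hm2 3
    nlinarith
  have k2 : y^2 ≤ (b*x)^2 := pow_le_pow_left₀ hm0 hm1 2
  have k3 : ((1-b)*x) * ((1-b)*x - 1) * (b*x-1) ≤ (x - y) * (x - y - 1) * y := by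
    have h1 : (1-b)*x ≤ x - y := by linarith
    have h2 : 0 ≤ (1-b)*x - 1 := by nlinarith
    have h3 : 0 ≤ (1-b)*x := by linarith
    have h4 : 0 ≤ b*x - 1 := by linarith
    have : ((1-b)*x) * ((1-b)*x - 1) ≤ (x - y) * (x - y - 1) :=
      mul_le_mul h1 (by linarith) h2 (by linarith)
    exact mul_le_mul this hm2 h4 (by nlinarith)
  have k4 : (2*(2*b+1)-3) * ((b*x)^3 - 3*(b*x)^2) ≤ (2*(2*b+1)-3) * y^3 :=
    mul_le_mul_of_nonneg_left k1 (by linarith)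
  have hx3 : (2*(2*b+1)-3) * x^3 = 3 * (1-b)^2 * b * x^3 + (2*(2*b+1)-3) * (b*x)^3 := by
    have : (2*(2*b+1)-3) = 3 * (1-b)^2 * b + (2*(2*b+1)-3) * b^3 := by
      linear_combination (-4*b^2 + 2*b + 2) * hbb
    linear_combination x^3 * this
  have hco : 0 ≤ 1 - b^2 - (1-b)/2 - (2*(2*b+1)-3) * b^2 / 2 := by
    rw [hbb]; nlinarith
  have h5 := mul_nonneg hco (sq_nonneg x)
  have h6 : 0 ≤ (1-b) * x := mul_nonneg (by linarith) hn0
  nlinarith [h5, h6, hx3, k4, k3, k2, hc]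

/-- For every `ε > 0` and all sufficiently large `n` there is a 3-uniform hypergraph on
`n` vertices with at least `(2√3 − 3 − ε)·(n choose 3)` edges containing no pseudocycle of
length `ℓ` for any `ℓ ≥ 3` with `3 ∤ ℓ`; in particular it contains no copy of the tight
cycle `C_ℓ³` for any `ℓ ≥ 4` with `3 ∤ ℓ`. -/
theorem turan_density_tight_cycle_lower :
    ∀ ε : ℝ, 0 < ε → ∃ n₀ : ℕ, ∀ n : ℕ, n₀ ≤ n →
      ∃ H : Finset (Finset (Fin n)),
        (∀ e ∈ H, e.card = 3) ∧
        (H.card : ℝ) ≥ (2 * Real.sqrt 3 - 3 - ε) * (n.choose 3) ∧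
        (∀ ℓ : ℕ, 3 ≤ ℓ → ¬ (3 ∣ ℓ) → ¬ HasPseudocycle H ℓ) ∧
        (∀ ℓ : ℕ, 4 ≤ ℓ → ¬ (3 ∣ ℓ) → ¬ HasTightCycleCopy H ℓ) := by
  intro ε hε
  obtain ⟨N, hN⟩ := exists_nat_gt (24 / ε)
  refine ⟨N + 4, fun n hn => ?_⟩
  obtain ⟨f, H, hH, hc⟩ := level_exists n (Finset.univ : Finset (Fin n)) (by simp)
  have hP : ∀ ℓ : ℕ, ¬ (3 ∣ ℓ) → ¬ HasPseudocycle H ℓ := by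
    rintro ℓ hℓ ⟨v, hv⟩
    exact no_pattern ℓ hℓ (fun i => f (v i)) (fun i => (hH _ (hv i)).2.cases)
  refine ⟨H, fun e he => (hH e he).2.card, ?_, fun ℓ _ hℓ => hP ℓ hℓ, ?_⟩
  · have hr1 : (1.732:ℝ) < Real.sqrt 3 := Real.lt_sqrt_of_sq_lt (by norm_num)
    have hch : ((n.choose 3 : ℕ) : ℝ) = (n:ℝ) * (n - 1) * (n - 2) / 6 := by
      have h6 : n.choose 3 * 6 = n * (n-1) * (n-2) := by
        have := Nat.descFactorial_eq_factorial_mul_choose n 3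
        simp [Nat.descFactorial, Nat.factorial] at this
        linarith
      have h6' : ((n.choose 3 : ℕ) : ℝ) * 6 = (n:ℝ) * (n - 1) * (n - 2) := by
        have := congrArg (Nat.cast : ℕ → ℝ) h6
        push_cast [Nat.cast_sub (show 1 ≤ n by omega), Nat.cast_sub (show 2 ≤ n by omega)] at this
        exact this
      linarith
    have hnN : (N:ℝ) + 4 ≤ n := by exact_mod_cast hn
    have hN0 : (0:ℝ) ≤ N := Nat.cast_nonneg N
    rw [hch]
    clear hch
    generalize (n:ℝ) = x at hc hnN ⊢
    have e1 : 24 ≤ ε * x := by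
      rw [div_lt_iff₀ hε] at hN
      nlinarith
    have e2 : x * (x-1) * (x-2) / 6 ≤ x^3 / 6 := by nlinarith
    have e3 : x^3 / 24 ≤ x * (x-1) * (x-2) / 6 := by
      have : x^2 ≤ 4 * ((x-1)*(x-2)) := by nlinarith
      nlinarith
    have e4 : x^2 ≤ ε * (x^3/24) := by nlinarith [sq_nonneg x]
    have e5 := mul_le_mul_of_nonneg_left e3 hε.le
    have e6 := mul_le_mul_of_nonneg_left e2 (show 0 ≤ 2 * Real.sqrt 3 - 3 by linarith)
    linarith
  · rintro ℓ _ hℓ ⟨c, _, hcc⟩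
    exact hP ℓ hℓ ⟨c, hcc⟩
end

section
/- A 3-uniform hypergraph H on a finite vertex set has a good colouring if and only if H contains no pseudocycle of length ℓ for any ℓ ≥ 3 with ℓ not divisible by 3. -/
/-- `{x, y}` is an edge of the shadow `∂H`: `x ≠ y` and some edge of `H` contains both. -/
def InShadow {V : Type} (H : Finset (Finset V)) (x y : V) : Prop :=
  x ≠ y ∧ ∃ e ∈ H, x ∈ e ∧ y ∈ e

/-- A good colouring of `H`: each shadow edge is either blue, or red with an orientation,
and every edge of `H` can be written as `{x, y, z}` with `xy`, `xz` red directed away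
from `x` and `yz` blue. -/
def HasGoodColouring {V : Type} [DecidableEq V] (H : Finset (Finset V)) : Prop :=
  ∃ Blue Red : V → V → Prop,
    (∀ x y, Blue x y → Blue y x) ∧
    (∀ x y, InShadow H x y →
      (Blue x y ∧ ¬ Red x y ∧ ¬ Red y x) ∨
      (¬ Blue x y ∧ Red x y ∧ ¬ Red y x) ∨
      (¬ Blue x y ∧ ¬ Red x y ∧ Red y x)) ∧
    (∀ e ∈ H, ∃ x y z : V, e = ({x, y, z} : Finset V) ∧ Red x y ∧ Red x z ∧ Blue y z)

/-- Walks of length `n` along a relation. -/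
def PcWalk {α : Type} (R : α → α → Prop) (n : ℕ) (p q : α) : Prop :=
  ∃ f : ℕ → α, f 0 = p ∧ f n = q ∧ ∀ i < n, R (f i) (f (i + 1))

theorem PcWalk.refl {α : Type} (R : α → α → Prop) (p : α) : PcWalk R 0 p p :=
  ⟨fun _ => p, rfl, rfl, by simp⟩

theorem PcWalk.single {α : Type} {R : α → α → Prop} {p q : α} (h : R p q) : PcWalk R 1 p q := by
  refine ⟨fun i => if i = 0 then p else q, by simp, by simp, ?_⟩
  intro i hi
  obtain rfl : i = 0 := by omega
  simpa using h

theorem PcWalk.trans {α : Type} {R : α → α → Prop} {m n : ℕ} {p q r : α}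
    (h : PcWalk R m p q) (h' : PcWalk R n q r) : PcWalk R (m + n) p r := by
  obtain ⟨f, f0, fm, hf⟩ := h
  obtain ⟨g, g0, gn, hg⟩ := h'
  refine ⟨fun i => if i ≤ m then f i else g (i - m), by simp [f0], ?_, ?_⟩
  · by_cases hn : n = 0
    · subst hn; simp [fm, ← gn, g0]
    · have : ¬ (m + n ≤ m) := by omega
      simp [hn, gn]
  · intro i hi
    rcases lt_trichotomy i m with h | h | h
    · have h1 : i ≤ m := by omega
      have h2 : i + 1 ≤ m := by omega
      simp only [h1, h2, if_true]
      exact hf i h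
    · subst h
      have := hg 0 (by omega)
      simpa [fm, ← g0] using this
    · have h1 : ¬ i ≤ m := by omega
      have h2 : ¬ i + 1 ≤ m := by omega
      simp only [h1, h2, if_false]
      have := hg (i - m) (by omega)
      rwa [show i - m + 1 = i + 1 - m by omega] at this

theorem PcWalk.symm {α : Type} {R : α → α → Prop} (hR : ∀ p q, R p q → PcWalk R 2 q p)
    {n : ℕ} : ∀ {p q : α}, PcWalk R n p q → PcWalk R (2 * n) q p := by
  induction n with
  | zero =>
    rintro p q ⟨f, f0, fn, -⟩
    rw [← f0, ← fn]
    exact PcWalk.refl R _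
  | succ k ih =>
    rintro p q ⟨f, f0, fn, hf⟩
    have h1 : PcWalk R k p (f k) := ⟨f, f0, rfl, fun i hi => hf i (by omega)⟩
    have h2 := hR _ _ (hf k (by omega))
    rw [fn] at h2
    have := h2.trans (ih h1)
    rwa [show 2 + 2 * k = 2 * (k + 1) by ring] at this

/-- Existence of a potential modulo 3. -/
theorem pc_potential {α : Type} (R : α → α → Prop) (hR : ∀ p q, R p q → PcWalk R 2 q p)
    (hc : ∀ n p, PcWalk R n p p → 3 ∣ n) :
    ∃ φ : α → ZMod 3, ∀ p q, R p q → φ q = φ p + 1 := by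
  let S : Setoid α :=
    { r := fun p q => ∃ n, PcWalk R n p q
      iseqv :=
        { refl := fun p => ⟨0, PcWalk.refl R p⟩
          symm := fun ⟨n, h⟩ => ⟨2 * n, h.symm hR⟩
          trans := fun ⟨n, h⟩ ⟨m, h'⟩ => ⟨n + m, h.trans h'⟩ } }
  let root : α → α := fun p => (Quotient.mk S p).out
  have hroot : ∀ p, ∃ n, PcWalk R n (root p) p := fun p => Quotient.mk_out (s := S) p
  choose d hd using hroot
  refine ⟨fun p => (d p : ZMod 3), fun p q h => ?_⟩
  have hrr : root p = root q := by
    have : Quotient.mk S p = Quotient.mk S q := Quotient.sound ⟨1, PcWalk.single h⟩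
    simp only [root, this]
  have h1 := hd p
  rw [hrr] at h1
  have h2 := hd q
  have h3 := h2.symm hR
  have c1 := hc _ _ ((h1.trans (PcWalk.single h)).trans h3)
  have c2 := hc _ _ (h2.trans h3)
  rw [← ZMod.natCast_eq_zero_iff] at c1 c2
  push_cast at c1 c2
  linear_combination c2 - c1

theorem pc_distinct {V : Type} [DecidableEq V] {a b c : V}
    (h : ({a, b, c} : Finset V).card = 3) : a ≠ b ∧ a ≠ c ∧ b ≠ c := by
  rw [Finset.card_eq_three] at h
  obtain ⟨x, y, z, hxy, hxz, hyz, h⟩ := h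
  have hx : x ∈ ({a, b, c} : Finset V) := by rw [h]; simp
  have hy : y ∈ ({a, b, c} : Finset V) := by rw [h]; simp
  have hz : z ∈ ({a, b, c} : Finset V) := by rw [h]; simp
  simp only [Finset.mem_insert, Finset.mem_singleton] at hx hy hz
  grind

theorem pc_forward {V : Type} [DecidableEq V] (H : Finset (Finset V))
    (h3 : ∀ e ∈ H, e.card = 3) (hg : HasGoodColouring H) (ℓ : ℕ) (h : HasPseudocycle H ℓ) :
    3 ∣ ℓ := by
  classical
  obtain ⟨B, R, hB, hS, hE⟩ := hg
  obtain ⟨v, hv⟩ := h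
  let ψ : V → V → ZMod 3 := fun a b => if B a b then 0 else if R a b then 2 else 1
  have key : ∀ a b c : V, ({a, b, c} : Finset V) ∈ H → ψ b c = ψ a b + 1 := by
    intro a b c he
    obtain ⟨hab, hac, hbc⟩ := pc_distinct (h3 _ he)
    obtain ⟨x, y, z, hxyz, rxy, rxz, byz⟩ := hE _ he
    have hc := h3 _ he
    rw [hxyz] at hc
    obtain ⟨hxy, hxz, hyz⟩ := pc_distinct hc
    have sxy := hS x y ⟨hxy, _, he, by simp [hxyz], by simp [hxyz]⟩
    have sxz := hS x z ⟨hxz, _, he, by simp [hxyz], by simp [hxyz]⟩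
    have syz := hS y z ⟨hyz, _, he, by simp [hxyz], by simp [hxyz]⟩
    have bzy := hB _ _ byz
    have n1 : ¬ B x y := by tauto
    have n2 : ¬ B y x := fun h => n1 (hB _ _ h)
    have n3 : ¬ R y x := by tauto
    have n4 : ¬ B x z := by tauto
    have n5 : ¬ B z x := fun h => n4 (hB _ _ h)
    have n6 : ¬ R z x := by tauto
    have e0 : (0 : ZMod 3) = 2 + 1 := by decide
    have e1 : (2 : ZMod 3) = 1 + 1 := by decide
    have ha : a ∈ ({x, y, z} : Finset V) := by rw [← hxyz]; simp
    have hb : b ∈ ({x, y, z} : Finset V) := by rw [← hxyz]; simp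
    have hc : c ∈ ({x, y, z} : Finset V) := by rw [← hxyz]; simp
    simp only [Finset.mem_insert, Finset.mem_singleton] at ha hb hc
    rcases ha with rfl | rfl | rfl <;> rcases hb with rfl | rfl | rfl <;>
      first
      | exact absurd rfl hab
      | (rcases hc with rfl | rfl | rfl <;>
          first
          | exact absurd rfl hac
          | exact absurd rfl hbc
          | (simp only [ψ, *, if_true, if_false]; done)
          | (simp only [ψ, rxy, rxz, byz, bzy, n1, n2, n3, n4, n5, n6, if_true, if_false]
             decide))
  have step : ∀ k : ℕ, ψ (v k) (v (k + 1)) = ψ (v 0) (v 1) + k := by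
    intro k
    induction k with
    | zero => simp
    | succ k ih =>
      have := key _ _ _ (hv k)
      push_cast
      rw [show (k : ZMod ℓ) + 1 + 1 = k + 2 by ring, this, ih]
      ring
  have := step ℓ
  simp only [ZMod.natCast_self, zero_add] at this
  rw [← ZMod.natCast_eq_zero_iff]
  linear_combination -this

theorem pc_backward {V : Type} [DecidableEq V] (H : Finset (Finset V))
    (h3 : ∀ e ∈ H, e.card = 3)
    (hp : ∀ ℓ : ℕ, 3 ≤ ℓ → ¬ (3 ∣ ℓ) → ¬ HasPseudocycle H ℓ) : HasGoodColouring H := by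
  let R : V × V → V × V → Prop := fun p q => p.2 = q.1 ∧ ({p.1, p.2, q.2} : Finset V) ∈ H
  have rot : ∀ a b c : V, ({a, b, c} : Finset V) = {b, c, a} := by
    intro a b c; ext; simp; tauto
  have swap : ∀ a b c : V, ({a, b, c} : Finset V) = {c, b, a} := by
    intro a b c; ext; simp; tauto
  have hR : ∀ p q, R p q → PcWalk R 2 q p := by
    rintro ⟨a, b⟩ ⟨b', c⟩ ⟨h1, h2⟩
    simp only at h1 h2
    subst h1
    have w1 : R (b, c) (c, a) := ⟨rfl, by simpa only [← rot] using h2⟩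
    have w2 : R (c, a) (a, b) := ⟨rfl, by
      show ({c, a, b} : Finset V) ∈ H
      rw [rot]; exact h2⟩
    exact (PcWalk.single w1).trans (PcWalk.single w2)
  have hc : ∀ n p, PcWalk R n p p → 3 ∣ n := by
    rintro n p ⟨f, f0, fn, hf⟩
    by_contra hn
    have hpos : 0 < n := by
      rcases Nat.eq_zero_or_pos n with rfl | h
      · simp at hn
      · exact h
    have hper : ∀ i, R (f (i % n)) (f ((i + 1) % n)) := by
      intro i
      have hi := Nat.mod_lt i hpos
      have h1 := hf (i % n) hi
      rcases Nat.lt_or_ge (i % n + 1) n with h | h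
      · have : (i + 1) % n = i % n + 1 := by
          rw [Nat.add_mod, Nat.mod_eq_of_lt (a := 1) (by omega), Nat.mod_eq_of_lt h]
        simpa [this] using h1
      · have h2 : i % n + 1 = n := by omega
        have : (i + 1) % n = 0 := by
          rw [← Nat.mod_add_mod, h2, Nat.mod_self]
        rw [h2, fn, ← f0] at h1
        simpa [this] using h1
    have hedge : ∀ i, ({(f (i % n)).1, (f ((i + 1) % n)).1, (f ((i + 2) % n)).1} : Finset V) ∈ H := by
      intro i
      have h1 := hper i
      have h2 := hper (i + 1)
      have := h1.2
      rw [← h2.1, ← h1.1]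
      exact this
    have hge : 3 ≤ n := by
      by_contra hlt
      have hd := pc_distinct (h3 _ (hedge 0))
      have : n = 1 ∨ n = 2 := by omega
      rcases this with rfl | rfl <;> simp at hd
    refine hp n hge hn ⟨fun i => (f i.val).1, fun i => ?_⟩
    haveI : NeZero n := ⟨by omega⟩
    have h := hedge i.val
    have e0 : i.val % n = i.val := Nat.mod_eq_of_lt (ZMod.val_lt i)
    have e1 : (i + 1).val = (i.val + 1) % n := by
      rw [← ZMod.val_natCast]; simp
    have e2 : (i + 2).val = (i.val + 2) % n := by
      rw [← ZMod.val_natCast]; simp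
    rw [e0] at h
    simp only [e1, e2]
    exact h
  obtain ⟨φ, hφ⟩ := pc_potential R hR hc
  let ψ : V → V → ZMod 3 := fun a b => φ (b, a) - φ (a, b)
  have hanti : ∀ a b, ψ b a = - ψ a b := fun a b => by simp only [ψ]; ring
  have hstep : ∀ a b c : V, ({a, b, c} : Finset V) ∈ H → ψ b c = ψ a b + 1 := by
    intro a b c he
    have h1 := hφ (a, b) (b, c) ⟨rfl, he⟩
    have he' : ({c, b, a} : Finset V) ∈ H := by rw [swap]; exact he
    have h2 := hφ (c, b) (b, a) ⟨rfl, he'⟩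
    have h3 : (3 : ZMod 3) = 0 := by decide
    simp only [ψ]
    linear_combination -h1 - h2 - h3
  refine ⟨fun a b => ψ a b = 0, fun a b => ψ a b = 2, ?_, ?_, ?_⟩
  · intro x y h
    simp only [hanti x y, h, neg_zero]
  · intro x y _
    simp only [hanti x y]
    generalize ψ x y = t
    revert t
    decide
  · intro e he
    obtain ⟨a, b, c, -, -, -, rfl⟩ := Finset.card_eq_three.mp (h3 e he)
    have s1 := hstep a b c he
    have s2 := hstep b c a (by rw [← rot]; exact he)
    have t : ψ a b = 0 ∨ ψ a b = 1 ∨ ψ a b = 2 := by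
      generalize ψ a b = t
      revert t
      decide
    rw [s1] at s2
    rcases t with t | t | t
    · refine ⟨c, a, b, by rw [rot c a b], ?_, ?_, t⟩
      · simp only [s2, t]; decide
      · simp only [hanti b c, s1, t]; decide
    · refine ⟨b, c, a, rot a b c, ?_, ?_, ?_⟩
      · simp only [s1, t]; decide
      · simp only [hanti a b, t]; decide
      · simp only [s2, t]; decide
    · refine ⟨a, b, c, rfl, t, ?_, ?_⟩
      · simp only [hanti c a, s2, t]; decide
      · simp only [s1, t]; decide

/-- A 3-uniform hypergraph has a good colouring iff it has no pseudocycle of length `ℓ`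
for any `ℓ ≥ 3` with `3 ∤ ℓ`. -/
theorem goodColouring_iff_no_odd_pseudocycle (n : ℕ) (H : Finset (Finset (Fin n)))
    (h3 : ∀ e ∈ H, e.card = 3) :
    HasGoodColouring H ↔ ∀ ℓ : ℕ, 3 ≤ ℓ → ¬ (3 ∣ ℓ) → ¬ HasPseudocycle H ℓ :=
  ⟨fun hg ℓ _ hn h => hn (pc_forward H h3 hg ℓ h), fun hp => pc_backward H h3 hp⟩
end
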